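/- Let p, q, p' be positive integers with 3 ≤ q ≤ p−2, and let f : D^I_{p,q} → D^I_{p',q+1} be a proper holomorphic map. Then p' ≥ p and f is of diagonal type: f is equivalent to G_h for some holomorphic map h : D^I_{p,q} → D^I_{p'−p,1}. -/

import Mathlib

open Matrix
open scoped ComplexOrder

attribute [local instance] Matrix.normedAddCommGroup Matrix.normedSpace

/-- The type-I irreducible bounded symmetric domain `D^I_{m,n}`,
realized as the set of complex `m × n` matrices `Z` with `I - Zᴴ Z` positive definite. -/
def typeIDomain (m n : ℕ) : Set (Matrix (Fin m) (Fin n) ℂ) :=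
  {Z | (1 - Zᴴ * Z).PosDef}

/-- `f` maps `D` into `D'` and the `f`-preimage of every compact subset of `D'`
is a compact subset of `D`. -/
def ProperOn {E F : Type*} [TopologicalSpace E] [TopologicalSpace F]
    (f : E → F) (D : Set E) (D' : Set F) : Prop :=
  Set.MapsTo f D D' ∧ ∀ K : Set F, K ⊆ D' → IsCompact K → IsCompact (D ∩ f ⁻¹' K)

/-- `Φ` is a (biholomorphic) automorphism of the type-I domain `D^I_{m,n}`. -/
def IsAutOf {m n : ℕ} (Φ : Matrix (Fin m) (Fin n) ℂ → Matrix (Fin m) (Fin n) ℂ) : Prop :=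
  Set.MapsTo Φ (typeIDomain m n) (typeIDomain m n) ∧
  DifferentiableOn ℂ Φ (typeIDomain m n) ∧
  ∃ Ψ, Set.MapsTo Ψ (typeIDomain m n) (typeIDomain m n) ∧
    DifferentiableOn ℂ Ψ (typeIDomain m n) ∧
    (∀ Z ∈ typeIDomain m n, Ψ (Φ Z) = Z) ∧
    (∀ Z ∈ typeIDomain m n, Φ (Ψ Z) = Z)

/-- The block-diagonal matrix `[[Z, 0], [0, W]]`, reindexed to size `p' × q'`. -/
def diagBlock {p q a b p' q' : ℕ} (hp : p + a = p') (hq : q + b = q')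
    (Z : Matrix (Fin p) (Fin q) ℂ) (W : Matrix (Fin a) (Fin b) ℂ) :
    Matrix (Fin p') (Fin q') ℂ :=
  Matrix.reindex (finCongr hp) (finCongr hq)
    (Matrix.reindex finSumFinEquiv finSumFinEquiv (Matrix.fromBlocks Z 0 0 W))


section
open Matrix
open scoped ComplexOrder
open Set Filter Topology Metric

namespace TypeI

theorem disc_zero {X : Type*} [NormedAddCommGroup X] [NormedSpace ℂ X] {δ : ℂ → X}
    (hd : DifferentiableOn ℂ δ (ball 0 1))
    (hlim : ∀ t : ℕ → ℂ, (∀ n, ‖t n‖ < 1) → Tendsto (fun n => ‖t n‖) atTop (𝓝 1) →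
      ∃ φ : ℕ → ℕ, StrictMono φ ∧ Tendsto (fun n => δ (t (φ n))) atTop (𝓝 0)) :
    ∀ t : ℂ, ‖t‖ < 1 → δ t = 0 := by
  have key : ∀ ε > 0, ∃ r < (1:ℝ), ∀ t : ℂ, r < ‖t‖ → ‖t‖ < 1 → ‖δ t‖ ≤ ε := by
    intro ε hε
    by_contra! hcon
    have h1 : ∀ n : ℕ, (1 : ℝ) - 1 / (n + 1) < 1 := fun n => by
      have : (0:ℝ) < 1 / (n + 1) := by positivity
      linarith
    choose t ht1 ht2 ht3 using fun n : ℕ => hcon _ (h1 n)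
    have hl : Tendsto (fun n : ℕ => (1 : ℝ) - 1 / (n + 1)) atTop (𝓝 1) := by
      simpa using (tendsto_const_nhds (x := (1:ℝ))).sub
        (tendsto_one_div_add_atTop_nhds_zero_nat (𝕜 := ℝ))
    have hl2 : Tendsto (fun n => ‖t n‖) atTop (𝓝 1) :=
      tendsto_of_tendsto_of_tendsto_of_le_of_le hl tendsto_const_nhds
        (fun n => (ht1 n).le) (fun n => (ht2 n).le)
    obtain ⟨φ, _, hφ⟩ := hlim t ht2 hl2
    have := hφ.norm
    rw [norm_zero] at this
    have h2 := this.eventually_lt_const hε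
    obtain ⟨n, hn⟩ := h2.exists
    exact absurd hn (not_lt.mpr (ht3 _).le)
  intro z hz
  rw [← norm_le_zero_iff]
  refine le_of_forall_gt_imp_ge_of_dense fun ε hε => ?_
  obtain ⟨r, hr, hr2⟩ := key ε hε
  obtain ⟨s, hs1, hs2⟩ := exists_between (max_lt hr hz)
  have hs0 : 0 < s := lt_of_le_of_lt (norm_nonneg z) (lt_of_le_of_lt (le_max_right _ _) hs1)
  refine Complex.norm_le_of_forall_mem_frontier_norm_le (U := ball (0:ℂ) s) isBounded_ball
    ?_ ?_ ?_
  · refine DifferentiableOn.diffContOnCl ?_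
    refine hd.mono ?_
    rw [closure_ball _ hs0.ne']
    exact closedBall_subset_ball hs2
  · intro w hw
    rw [frontier_ball _ hs0.ne', mem_sphere_zero_iff_norm] at hw
    exact hr2 w (by rw [hw]; exact lt_of_le_of_lt (le_max_left _ _) hs1) (by rw [hw]; exact hs2)
  · apply subset_closure
    rw [mem_ball_zero_iff]
    exact lt_of_le_of_lt (le_max_right _ _) hs1

theorem ident_line {X : Type*} [NormedAddCommGroup X] [NormedSpace ℂ X] [CompleteSpace X]
    {h : ℂ → X} {S : Set ℂ} (hS : IsOpen S) (hc : Convex ℝ S) (h0 : (0:ℂ) ∈ S)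
    (hd : DifferentiableOn ℂ h S) (he : ∀ᶠ s in 𝓝 (0:ℂ), h s = 0) : ∀ s ∈ S, h s = 0 := by
  have := (hd.analyticOnNhd hS).eqOn_of_preconnected_of_eventuallyEq (g := fun _ => (0:X))
    (analyticOnNhd_const) hc.isPreconnected h0 he
  exact this

theorem ident_convex {V X : Type*} [NormedAddCommGroup V] [NormedSpace ℂ V]
    [NormedAddCommGroup X] [NormedSpace ℂ X] [CompleteSpace X]
    {h : V → X} {S : Set V} (hS : IsOpen S) (hc : Convex ℝ S) {x0 : V} (h0 : x0 ∈ S)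
    (hd : DifferentiableOn ℂ h S) (he : ∀ᶠ s in 𝓝 x0, h s = 0) : ∀ s ∈ S, h s = 0 := by
  intro x hx
  let l : ℂ → V := fun s => x0 + s • (x - x0)
  have hl : Differentiable ℂ l := by
    intro s; fun_prop
  have hl0 : l 0 = x0 := by simp [l]
  have hl1 : l 1 = x := by simp [l]
  have := ident_line (h := fun s => h (l s)) (S := l ⁻¹' S) (hS.preimage hl.continuous) ?_
    (by simpa [hl0] using h0) (hd.comp hl.differentiableOn (fun _ h => h)) ?_ 1
    (by simpa [hl1] using hx)
  · simpa [hl1] using this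
  · intro a ha b hb s t hs ht hst
    have : l (s • a + t • b) = s • l a + t • l b := by
      simp only [l, smul_add]
      have e1 : s • (a • (x - x0)) = ((s • a : ℂ)) • (x - x0) := by rw [smul_assoc]
      have e2 : t • (b • (x - x0)) = ((t • b : ℂ)) • (x - x0) := by rw [smul_assoc]
      rw [e1, e2, add_smul]
      have : x0 = s • x0 + t • x0 := by rw [← add_smul, hst, one_smul]
      nth_rewrite 1 [this]
      abel
    show l _ ∈ S
    rw [this]
    exact hc ha hb hs ht hst
  · have : Tendsto l (𝓝 0) (𝓝 x0) := by
      have := hl.continuous.tendsto 0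
      rwa [hl0] at this
    exact this.eventually he

/-- sequential closedness of a family of subspaces at a point -/
def ClosedAt {X E : Type*} [TopologicalSpace X] [NormedAddCommGroup E] [NormedSpace ℂ E]
    (K : X → Submodule ℂ E) (x0 : X) : Prop :=
  ∀ (x : ℕ → X) (w : ℕ → E) (w0 : E), Tendsto x atTop (𝓝 x0) → (∀ n, w n ∈ K (x n)) →
    Tendsto w atTop (𝓝 w0) → w0 ∈ K x0

theorem ClosedAt.inf {X E : Type*} [TopologicalSpace X] [NormedAddCommGroup E] [NormedSpace ℂ E]
    {K L : X → Submodule ℂ E} {x0 : X} (h : ClosedAt K x0) (h' : ClosedAt L x0) :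
    ClosedAt (fun x => K x ⊓ L x) x0 := by
  intro x w w0 hx hw hw0
  exact ⟨h x w w0 hx (fun n => (hw n).1) hw0, h' x w w0 hx (fun n => (hw n).2) hw0⟩

theorem ClosedAt.eventually_disjoint {X E : Type*} [TopologicalSpace X] [FirstCountableTopology X]
    [NormedAddCommGroup E] [NormedSpace ℂ E] [FiniteDimensional ℂ E]
    {K : X → Submodule ℂ E} {x0 : X} (h : ClosedAt K x0) (S : Submodule ℂ E)
    (h0 : K x0 ⊓ S = ⊥) : ∀ᶠ x in 𝓝 x0, K x ⊓ S = ⊥ := by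
  by_contra hcon
  rw [Filter.not_eventually] at hcon
  obtain ⟨x, hx, hx2⟩ := exists_seq_forall_of_frequently hcon
  have : ∀ n, ∃ w ∈ K (x n) ⊓ S, ‖w‖ = 1 := by
    intro n
    obtain ⟨w, hw, hw0⟩ := Submodule.exists_mem_ne_zero_of_ne_bot (hx2 n)
    refine ⟨((‖w‖⁻¹ : ℝ) : ℂ) • w, Submodule.smul_mem _ _ hw, ?_⟩
    rw [norm_smul]; simp [hw0]
  choose w hw hw1 using this
  haveI : ProperSpace E := FiniteDimensional.proper ℂ E
  obtain ⟨w0, hw0, φ, hφ, hlim⟩ := (isCompact_sphere (0:E) 1).tendsto_subseq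
    (x := w) (fun n => by simp [hw1 n])
  have h1 : w0 ∈ K x0 := h (x ∘ φ) (w ∘ φ) w0 (hx.comp hφ.tendsto_atTop)
    (fun n => (hw _).1) hlim
  have h2 : w0 ∈ S := (Submodule.closed_of_finiteDimensional S).mem_of_tendsto hlim
    (Eventually.of_forall fun n => (hw _).2)
  have : w0 ∈ K x0 ⊓ S := ⟨h1, h2⟩
  rw [h0, Submodule.mem_bot] at this
  simp [this] at hw0

theorem ClosedAt.eventually_finrank_le {X E : Type*} [TopologicalSpace X]
    [FirstCountableTopology X]
    [NormedAddCommGroup E] [NormedSpace ℂ E] [FiniteDimensional ℂ E]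
    {K : X → Submodule ℂ E} {x0 : X} (h : ClosedAt K x0) :
    ∀ᶠ x in 𝓝 x0, Module.finrank ℂ (K x) ≤ Module.finrank ℂ (K x0) := by
  obtain ⟨S, hS⟩ := (K x0).exists_isCompl
  have := Submodule.finrank_add_eq_of_isCompl hS
  filter_upwards [h.eventually_disjoint S hS.inf_eq_bot] with x hx
  have h1 := Submodule.finrank_add_finrank_le_of_disjoint (disjoint_iff.mpr hx)
  omega

theorem proportional {V W : Type*} [NormedAddCommGroup V] [NormedSpace ℂ V]
    [AddCommGroup W] [Module ℂ W] (P Q : V →ₗ[ℂ] W) (hP : Function.Injective P)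
    {O : Set V} (hO : IsOpen O) (hne : O.Nonempty) (h : ∀ u ∈ O, ∃ c : ℂ, Q u = c • P u) :
    ∃ c : ℂ, ∀ u, Q u = c • P u := by
  rcases subsingleton_or_nontrivial V with hV | hV
  · exact ⟨0, fun u => by rw [Subsingleton.elim u 0]; simp⟩
  obtain ⟨u0, hu0, hu00⟩ : ∃ u0 ∈ O, u0 ≠ 0 := by
    by_contra! hcon
    obtain ⟨x, hx⟩ := hne
    have hx0 := hcon x hx
    subst hx0
    obtain ⟨v, hv⟩ := exists_ne (0:V)
    have hc : Tendsto (fun t : ℝ => ((t:ℂ)) • v) (𝓝 0) (𝓝 0) := by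
      have : Continuous (fun t : ℝ => ((t:ℂ)) • v) := by fun_prop
      simpa using this.tendsto 0
    have := hc.eventually (hO.mem_nhds hx)
    obtain ⟨ε, hε, hb⟩ := Metric.eventually_nhds_iff.mp this
    have h1 := hcon _ (hb (y := ε/2) (by simp [abs_of_pos hε]; linarith))
    simp [hv, hε.ne'] at h1
  obtain ⟨c0, hc0⟩ := h u0 hu0
  refine ⟨c0, fun v => ?_⟩
  by_cases hdep : ∃ d : ℂ, v = d • u0
  · obtain ⟨d, rfl⟩ := hdep
    simp [hc0, smul_comm c0 d]
  have hind : ∀ a b : ℂ, a • u0 + b • v = 0 → a = 0 ∧ b = 0 := by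
    intro a b hab
    have hb : b = 0 := by
      by_contra hb
      apply hdep
      refine ⟨-(b⁻¹ * a), ?_⟩
      have : b⁻¹ • (a • u0 + b • v) = 0 := by rw [hab, smul_zero]
      rw [smul_add, smul_smul, smul_smul, inv_mul_cancel₀ hb, one_smul] at this
      rw [neg_smul]; exact eq_neg_of_add_eq_zero_right this
    subst hb
    simp [hu00] at hab
    exact ⟨hab, rfl⟩
  have hc : Tendsto (fun t : ℝ => u0 + ((t:ℂ)) • v) (𝓝 0) (𝓝 u0) := by
    have : Continuous (fun t : ℝ => u0 + ((t:ℂ)) • v) := by fun_prop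
    simpa using this.tendsto 0
  have := hc.eventually (hO.mem_nhds hu0)
  obtain ⟨ε, hε, hb⟩ := Metric.eventually_nhds_iff.mp this
  set t : ℝ := ε / 3 with ht
  have ht0 : (t:ℂ) ≠ 0 := by
    have : t ≠ 0 := by positivity
    exact_mod_cast this
  obtain ⟨c, hc⟩ := h _ (hb (y := t) (by simp [abs_of_pos hε, ht]; linarith))
  obtain ⟨c', hc'⟩ := h _ (hb (y := 2 * t) (by simp [abs_of_pos hε, ht]; linarith))
  simp only [map_add, map_smul, hc0] at hc hc'
  push_cast at hc'
  have e : P ((2 * c - c' - c0) • u0 + (2 * (t:ℂ) * (c - c')) • v) = 0 := by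
    simp only [map_add, map_smul]
    have hc2 : (2:ℂ) • (c0 • P u0 + (t:ℂ) • Q v) = (2:ℂ) • (c • (P u0 + (t:ℂ) • P v)) := by rw [hc]
    have e3 : (2:ℂ) • (c • (P u0 + (t:ℂ) • P v)) - (c' • (P u0 + (2 * (t:ℂ)) • P v)) =
      c0 • P u0 := by
      rw [← hc2, ← hc']; module
    rw [← sub_eq_zero] at e3
    rw [← e3]; module
  have e2 := hind _ _ (hP (by rw [e, map_zero]))
  have hcc : c = c' := by
    have := e2.2
    simp [ht0, sub_eq_zero] at this
    exact this
  subst hcc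
  have hcc : c = c0 := by linear_combination e2.1
  subst hcc
  have : (t:ℂ) • Q v = (t:ℂ) • (c • P v) := by
    rw [smul_add] at hc
    have := add_left_cancel hc
    rw [this, smul_comm]
  exact smul_right_injective W ht0 this

end TypeI

end

section
open Matrix
open scoped ComplexOrder
open Set Filter Topology Metric
set_option linter.unusedSectionVars false
set_option linter.unusedSimpArgs false
set_option linter.style.haveILetI false
set_option linter.unusedVariables false
set_option linter.deprecated false

namespace TypeI

theorem inj_disc {W X : Type*} [NormedAddCommGroup W] [NormedSpace ℂ W] [FiniteDimensional ℂ W]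
    [NormedAddCommGroup X] [NormedSpace ℂ X] [FiniteDimensional ℂ X]
    (L : ℂ → (W →ₗ[ℂ] X)) (hd : ∀ w, DifferentiableOn ℂ (fun t => L t w) (ball 0 1))
    (hb : ∀ w, ∃ C, ∀ t : ℂ, ‖t‖ < 1 → ‖L t w‖ ≤ C)
    (hlim : ∀ t : ℕ → ℂ, (∀ n, ‖t n‖ < 1) → Tendsto (fun n => ‖t n‖) atTop (𝓝 1) →
      ∃ φ : ℕ → ℕ, StrictMono φ ∧ ∃ w ≠ 0, Tendsto (fun n => L (t (φ n)) w) atTop (𝓝 0)) :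
    ∀ t : ℂ, ‖t‖ < 1 → ∃ w ≠ 0, L t w = 0 := by
  intro t0 ht0
  by_contra! hcon
  have hinj : LinearMap.ker (L t0) = ⊥ := by
    rw [LinearMap.ker_eq_bot']
    intro w hw
    by_contra hw0
    exact hcon w hw0 hw
  obtain ⟨R, hR⟩ := (L t0).exists_leftInverse_of_injective hinj
  let b := Module.finBasis ℂ W
  let l : Fin (Module.finrank ℂ W) → (X →L[ℂ] ℂ) := fun i =>
    LinearMap.toContinuousLinearMap ((b.coord i) ∘ₗ R)
  let M : ℂ → Matrix (Fin (Module.finrank ℂ W)) (Fin (Module.finrank ℂ W)) ℂ :=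
    fun t => Matrix.of fun i j => l i (L t (b j))
  have hMv : ∀ t w i, (M t *ᵥ (b.repr w)) i = l i (L t w) := by
    intro t w i
    conv_rhs => rw [← b.sum_repr w]
    simp only [map_sum, map_smul, Matrix.mulVec, dotProduct, M, Matrix.of_apply, smul_eq_mul]
    exact Finset.sum_congr rfl fun j _ => mul_comm _ _
  have hdet : ∀ t : ℂ, ‖t‖ < 1 → (M t).det = 0 := by
    refine disc_zero (δ := fun t => (M t).det) ?_ ?_
    · simp only [Matrix.det_apply]
      refine DifferentiableOn.fun_sum fun σ _ => ?_
      refine DifferentiableOn.const_smul ?_ _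
      refine DifferentiableOn.fun_finsetProd fun i _ => ?_
      exact (l _).differentiable.comp_differentiableOn (hd _)
    · intro t ht1 ht2
      obtain ⟨φ, hφ, w, hw0, hw⟩ := hlim t ht1 ht2
      have hbM : ∀ i j, ∃ C, ∀ t : ℂ, ‖t‖ < 1 → ‖M t i j‖ ≤ C := by
        intro i j
        obtain ⟨C, hC⟩ := hb (b j)
        exact ⟨‖l i‖ * C, fun t ht => (l i).le_opNorm_of_le (hC t ht)⟩
      choose C hC using hbM
      have hcomp : IsCompact (Set.pi univ fun i => Set.pi univ fun j =>
          closedBall (0:ℂ) (C i j)) :=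
        isCompact_univ_pi fun i => isCompact_univ_pi fun j => isCompact_closedBall _ _
      obtain ⟨M0, -, χ, hχ, hM0⟩ := hcomp.tendsto_subseq
        (x := fun n => (fun i j => M (t (φ n)) i j)) (fun n => by
          intro i _ j _
          simpa using hC i j _ (ht1 _))
      refine ⟨φ ∘ χ, hφ.comp hχ, ?_⟩
      have hM0' : Tendsto (fun n => M (t (φ (χ n)))) atTop (𝓝 (Matrix.of M0)) := hM0
      have hz : (Matrix.of M0) *ᵥ (b.repr w) = 0 := by
        ext i
        have h1 : Tendsto (fun n => (M (t (φ (χ n))) *ᵥ (b.repr w)) i) atTop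
            (𝓝 ((Matrix.of M0 *ᵥ (b.repr w)) i)) := by
          have hc : Continuous fun A : Matrix (Fin (Module.finrank ℂ W))
              (Fin (Module.finrank ℂ W)) ℂ => (A *ᵥ (b.repr w)) i := by
            have : Continuous fun A : Matrix (Fin (Module.finrank ℂ W))
              (Fin (Module.finrank ℂ W)) ℂ => A *ᵥ (b.repr w) :=
              Continuous.matrix_mulVec continuous_id continuous_const
            exact (continuous_apply i).comp this
          exact (hc.tendsto _).comp hM0'
        have h2 : Tendsto (fun n => (M (t (φ (χ n))) *ᵥ (b.repr w)) i) atTop (𝓝 0) := by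
          simp only [hMv]
          have := ((l i).continuous.tendsto 0).comp (hw.comp hχ.tendsto_atTop)
          simpa [Function.comp_def] using this
        exact tendsto_nhds_unique h1 h2
      have hdet0 : (Matrix.of M0).det = 0 := by
        rw [← Matrix.exists_mulVec_eq_zero_iff]
        refine ⟨b.repr w, ?_, hz⟩
        intro h
        apply hw0
        have : b.repr w = 0 := by ext i; exact congrFun h i
        simpa using this
      have := ((Continuous.matrix_det continuous_id).tendsto (Matrix.of M0)).comp hM0'
      simpa [hdet0, Function.comp_def] using this
  have h1 : M t0 = 1 := by
    ext i j
    have : R (L t0 (b j)) = b j := by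
      have := LinearMap.congr_fun hR (b j); simpa using this
    simp [M, l, this, Matrix.one_apply, Finsupp.single_apply, eq_comm]
  have := hdet t0 ht0
  rw [h1, Matrix.det_one] at this
  exact one_ne_zero this

theorem finite_iInf {ι E : Type*} [AddCommGroup E] [Module ℂ E] [FiniteDimensional ℂ E]
    (K : ι → Submodule ℂ E) : ∃ s : Finset ι, s.card ≤ Module.finrank ℂ E ∧
      ⨅ i ∈ s, K i = ⨅ i, K i := by
  classical
  have step : ∀ n : ℕ, ∃ s : Finset ι, s.card ≤ n ∧ s.card ≤ Module.finrank ℂ E ∧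
      (⨅ i ∈ s, K i = ⨅ i, K i ∨
        Module.finrank ℂ (⨅ i ∈ s, K i : Submodule ℂ E) + n ≤ Module.finrank ℂ E) := by
    intro n
    induction n with
    | zero => exact ⟨∅, by simp, by simp, Or.inr (by simpa using Submodule.finrank_le _)⟩
    | succ n ih =>
      obtain ⟨s, hs, hs2, h | h⟩ := ih
      · exact ⟨s, by omega, hs2, Or.inl h⟩
      · by_cases he : ⨅ i ∈ s, K i = ⨅ i, K i
        · exact ⟨s, by omega, hs2, Or.inl he⟩
        · have hle : ⨅ i, K i ≤ ⨅ i ∈ s, K i := le_iInf₂ fun i _ => iInf_le _ i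
          obtain ⟨j, hj⟩ : ∃ j, ¬ (⨅ i ∈ s, K i ≤ K j) := by
            by_contra! hc
            exact he (le_antisymm (le_iInf hc) hle)
          have hlt : (⨅ i ∈ insert j s, K i) < ⨅ i ∈ s, K i := by
            rw [Finset.iInf_insert]
            refine lt_of_le_of_ne inf_le_right ?_
            intro h
            exact hj (inf_eq_right.mp h)
          have := Submodule.finrank_lt_finrank_of_lt hlt
          have hcard := Finset.card_insert_le j s
          refine ⟨insert j s, by omega, by omega, Or.inr (by omega)⟩
  obtain ⟨s, hs, hs2, h | h⟩ := step (Module.finrank ℂ E + 1)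
  · exact ⟨s, hs2, h⟩
  · omega

variable {U G E F : Type*}
  [NormedAddCommGroup U] [InnerProductSpace ℂ U] [FiniteDimensional ℂ U]
  [NormedAddCommGroup G] [InnerProductSpace ℂ G] [FiniteDimensional ℂ G]
  [NormedAddCommGroup E] [InnerProductSpace ℂ E] [FiniteDimensional ℂ E]
  [NormedAddCommGroup F] [InnerProductSpace ℂ F] [FiniteDimensional ℂ F]

/-- good (proper holomorphic) maps between operator-norm unit balls -/
structure GM (f : (U →L[ℂ] G) → (E →L[ℂ] F)) : Prop where
  diff : DifferentiableOn ℂ f (ball 0 1)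
  maps : ∀ Z, ‖Z‖ < 1 → ‖f Z‖ < 1
  proper : ∀ r < (1:ℝ), ∃ s < (1:ℝ), ∀ Z, ‖Z‖ < 1 → ‖f Z‖ ≤ r → ‖Z‖ ≤ s

/-- the rank-one operator `v u^*` -/
noncomputable def ro (v : G) (u : U) : U →L[ℂ] G := (innerSL ℂ u).smulRight v

theorem ro_apply (v : G) (u x : U) : ro v u x = (inner ℂ u x) • v := by
  simp [ro]

theorem norm_ro (v : G) (u : U) : ‖ro v u‖ = ‖u‖ * ‖v‖ := by
  simp [ro, ContinuousLinearMap.norm_smulRight_apply]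

/-- admissible face directions -/
def Adm (v : G) (u : U) (Z' : U →L[ℂ] G) : Prop :=
  ‖Z'‖ < 1 ∧ Z' u = 0 ∧ ∀ x, inner ℂ v (Z' x) = 0

theorem norm_face_lt {v : G} {u : U} (hu : ‖u‖ = 1) (hv : ‖v‖ = 1) {Z' : U →L[ℂ] G}
    (hZ : Adm v u Z') {t : ℂ} (ht : ‖t‖ < 1) : ‖Z' + t • ro v u‖ < 1 := by
  obtain ⟨h1, h2, h3⟩ := hZ
  refine lt_of_le_of_lt (ContinuousLinearMap.opNorm_le_bound _
    (M := max ‖Z'‖ ‖t‖) (le_max_of_le_left (norm_nonneg _)) ?_) (max_lt h1 ht)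
  intro x
  set m := max ‖Z'‖ ‖t‖
  have hm0 : 0 ≤ m := le_max_of_le_left (norm_nonneg _)
  set c : ℂ := inner ℂ u x with hc
  have hx1 : inner ℂ (x - c • u) (c • u) = 0 := by
    rw [inner_sub_left, inner_smul_right, inner_smul_right, inner_smul_left]
    rw [inner_self_eq_norm_sq_to_K, hu, ← inner_conj_symm x u, ← hc]
    simp
  have hx : ‖x‖ * ‖x‖ = ‖x - c • u‖ * ‖x - c • u‖ + ‖c • u‖ * ‖c • u‖ := by
    rw [← norm_add_sq_eq_norm_sq_add_norm_sq_of_inner_eq_zero _ _ hx1, sub_add_cancel]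
  have hzx : Z' x = Z' (x - c • u) := by simp [h2]
  have e : (Z' + t • ro v u) x = Z' (x - c • u) + (t * c) • v := by
    rw [← hzx]; simp [ro_apply, smul_smul, hc]
  have ho : inner ℂ (Z' (x - c • u)) ((t * c) • v) = 0 := by
    rw [inner_smul_right, ← inner_conj_symm, h3]; simp
  have hn := norm_add_sq_eq_norm_sq_add_norm_sq_of_inner_eq_zero _ _ ho
  rw [e]
  refine abs_le_of_sq_le_sq' ?_ (by positivity) |>.2
  rw [norm_smul, hu, mul_one] at hx
  rw [norm_smul, hv, mul_one, norm_mul] at hn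
  have b1 : ‖Z' (x - c • u)‖ ≤ m * ‖x - c • u‖ :=
    (Z'.le_opNorm _).trans (mul_le_mul_of_nonneg_right (le_max_left _ _) (norm_nonneg _))
  have b2 : ‖t‖ * ‖c‖ ≤ m * ‖c‖ :=
    mul_le_mul_of_nonneg_right (le_max_right _ _) (norm_nonneg _)
  have c1 := mul_self_le_mul_self (norm_nonneg _) b1
  have c2 := mul_self_le_mul_self (by positivity) b2
  rw [pow_two, hn, mul_pow, pow_two ‖x‖, hx]
  calc _ ≤ _ := add_le_add c1 c2
    _ = _ := by ring

theorem Adm.smul {v : G} {u : U} {Z' : U →L[ℂ] G} (h : Adm v u Z') {s : ℂ} (hs : ‖s • Z'‖ < 1) :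
    Adm v u (s • Z') :=
  ⟨hs, by simp [h.2.1], fun x => by simp [inner_smul_right, h.2.2 x]⟩

theorem Adm.zero (v : G) (u : U) : Adm v u (0 : U →L[ℂ] G) := ⟨by simp, by simp, by simp⟩

theorem bc_bound {φ : ℂ → ℂ} {ρ : ℝ} (hρ : 1 < ρ) (hd : DifferentiableOn ℂ φ (ball 0 ρ))
    (hb : ∀ s ∈ ball (0:ℂ) ρ, ‖φ s‖ ≤ 1) : ‖φ 1 - 1‖ ≤ ‖φ 0 - 1‖ * ((ρ + 1) / (ρ - 1)) := by
  refine le_of_forall_pos_le_add fun ε hε => ?_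
  have hM : 0 < ε * (ρ - 1) / 2 := by
    have : 0 < ρ - 1 := by linarith
    positivity
  have := Complex.borelCaratheodory (f := fun s => φ s - 1) (z := 1) hM (hd.sub_const 1) ?_
    (by linarith) (by simpa using hρ)
  · simp only [norm_one] at this
    have h1 : ρ - 1 ≠ 0 := by linarith
    calc _ ≤ _ := this
      _ = _ := by field_simp; ring
  · intro s hs
    simp only [mem_setOf_eq, Complex.sub_re, Complex.one_re]
    have := (Complex.re_le_norm (φ s)).trans (hb s hs)
    linarith

theorem attain {A : E →L[ℂ] F} (hA : ‖A‖ ≤ 1) {w : E} (hw : ‖A w‖ = ‖w‖) (e : E) :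
    inner ℂ (A w) (A e) = inner ℂ w e := by
  have := FiniteDimensional.complete ℂ E
  have := FiniteDimensional.complete ℂ F
  have h1 : ContinuousLinearMap.adjoint A (A w) = w := by
    rw [← sub_eq_zero, ← norm_eq_zero, ← sq_eq_zero_iff]
    apply le_antisymm _ (sq_nonneg _)
    rw [@norm_sub_sq ℂ, ContinuousLinearMap.adjoint_inner_left, inner_self_eq_norm_sq]
    have : ‖ContinuousLinearMap.adjoint A (A w)‖ ≤ ‖w‖ := by
      calc _ ≤ ‖ContinuousLinearMap.adjoint A‖ * ‖A w‖ := ContinuousLinearMap.le_opNorm _ _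
        _ ≤ 1 * ‖w‖ := by
          rw [hw]
          apply mul_le_mul_of_nonneg_right _ (norm_nonneg _)
          simpa using hA
        _ = _ := one_mul _
    rw [hw]
    nlinarith [norm_nonneg (ContinuousLinearMap.adjoint A (A w)), norm_nonneg w]
  rw [← ContinuousLinearMap.adjoint_inner_left, h1]

theorem exists_norm_attain {A : E →L[ℂ] F} (hA : ‖A‖ = 1) : ∃ w, ‖w‖ = 1 ∧ ‖A w‖ = 1 := by
  have hne : ∃ x : E, x ≠ 0 := by
    by_contra! hc
    have : A = 0 := by ext x; simp [hc x]
    simp [this] at hA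
  obtain ⟨x, hx⟩ := hne
  have := FiniteDimensional.proper ℂ E
  obtain ⟨w, hw, hmax⟩ := (isCompact_sphere (0:E) 1).exists_isMaxOn
    ⟨((‖x‖⁻¹ : ℝ) : ℂ) • x, by simp [norm_smul, hx]⟩
    (f := fun w => ‖A w‖) (by fun_prop)
  have hw1 : ‖w‖ = 1 := by simpa using hw
  refine ⟨w, hw1, le_antisymm ?_ ?_⟩
  · have := A.le_opNorm w
    rwa [hA, hw1, one_mul] at this
  · rw [← hA]
    refine ContinuousLinearMap.opNorm_le_bound _ (norm_nonneg _) fun y => ?_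
    by_cases hy : y = 0
    · simp [hy]
    have h1 := hmax (a := ((‖y‖⁻¹ : ℝ) : ℂ) • y) (by simp [norm_smul, hy])
    simp only [map_smul, norm_smul, Complex.norm_real, norm_inv, norm_norm, mem_setOf_eq] at h1
    have hy' : 0 < ‖y‖ := norm_pos_iff.mpr hy
    rw [inv_mul_le_iff₀ hy'] at h1
    linarith

theorem face_limit {f : (U →L[ℂ] G) → (E →L[ℂ] F)} (hf : GM f) {v : G} {u : U}
    (hu : ‖u‖ = 1) (hv : ‖v‖ = 1) {t : ℕ → ℂ} (ht : ∀ n, ‖t n‖ < 1) {A0 : E →L[ℂ] F}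
    (hA0 : Tendsto (fun n => f (t n • ro v u)) atTop (𝓝 A0)) {w : E} (hw1 : ‖w‖ = 1)
    (hw : ‖A0 w‖ = 1) {Z' : U →L[ℂ] G} (hZ : Adm v u Z') :
    Tendsto (fun n => f (Z' + t n • ro v u) w) atTop (𝓝 (A0 w)) := by
  set ρ : ℝ := 2 / (1 + ‖Z'‖) with hρ
  have hz0 := norm_nonneg Z'
  have hρ1 : 1 < ρ := by
    rw [hρ, lt_div_iff₀ (by positivity)]; linarith [hZ.1]
  have hρz : ρ * ‖Z'‖ < 1 := by
    rw [hρ, div_mul_eq_mul_div, div_lt_one (by positivity)]; linarith [hZ.1]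
  let φ : ℕ → ℂ → ℂ := fun n s => inner ℂ (A0 w) (f (s • Z' + t n • ro v u) w)
  have hin : ∀ n, ∀ s ∈ ball (0:ℂ) ρ, ‖s • Z' + t n • ro v u‖ < 1 := by
    intro n s hs
    refine norm_face_lt hu hv (hZ.smul ?_) (ht n)
    rw [norm_smul]
    refine lt_of_le_of_lt (mul_le_mul_of_nonneg_right ?_ hz0) hρz
    simpa using (mem_ball_zero_iff.mp hs).le
  have hb : ∀ n, ∀ s ∈ ball (0:ℂ) ρ, ‖φ n s‖ ≤ 1 := by
    intro n s hs
    refine (norm_inner_le_norm _ _).trans ?_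
    rw [hw, one_mul]
    have := (f (s • Z' + t n • ro v u)).le_opNorm w
    rw [hw1, mul_one] at this
    exact this.trans (hf.maps _ (hin n s hs)).le
  have hd : ∀ n, DifferentiableOn ℂ (φ n) (ball 0 ρ) := by
    intro n
    have h1 : DifferentiableOn ℂ (fun s : ℂ => f (s • Z' + t n • ro v u)) (ball 0 ρ) := by
      refine hf.diff.comp (f := fun s : ℂ => s • Z' + t n • ro v u) (by fun_prop) ?_
      intro s hs
      simpa using hin n s hs
    have h2 : DifferentiableOn ℂ (fun s : ℂ => f (s • Z' + t n • ro v u) w) (ball 0 ρ) :=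
      h1.clm_apply (differentiableOn_const _)
    exact (innerSL ℂ (A0 w)).differentiable.comp_differentiableOn h2
  have h0 : Tendsto (fun n => φ n 0) atTop (𝓝 1) := by
    have h1 : Tendsto (fun n => f (t n • ro v u) w) atTop (𝓝 (A0 w)) :=
      ((ContinuousLinearMap.apply ℂ F w).continuous.tendsto A0).comp hA0
    have h2 := ((innerSL ℂ (A0 w)).continuous.tendsto _).comp h1
    have h3 : inner ℂ (A0 w) (A0 w) = (1:ℂ) := by
      rw [inner_self_eq_norm_sq_to_K, hw]; simp
    simpa [φ, Function.comp_def, hw] using h2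
  have h1 : Tendsto (fun n => φ n 1) atTop (𝓝 1) := by
    rw [tendsto_iff_norm_sub_tendsto_zero]
    refine squeeze_zero (fun n => norm_nonneg _) (fun n => bc_bound hρ1 (hd n) (hb n)) ?_
    have := (tendsto_iff_norm_sub_tendsto_zero.mp h0).mul_const ((ρ + 1) / (ρ - 1))
    simpa using this
  rw [tendsto_iff_norm_sub_tendsto_zero]
  have hre : Tendsto (fun n => 2 - 2 * (φ n 1).re) atTop (𝓝 0) := by
    have := ((Complex.continuous_re.tendsto _).comp h1).const_mul 2 |>.const_sub 2
    simpa [Function.comp_def] using this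
  have hsq : Tendsto (fun n => ‖f (Z' + t n • ro v u) w - A0 w‖ ^ 2) atTop (𝓝 0) := by
    refine squeeze_zero (fun n => sq_nonneg _) (fun n => ?_) hre
    rw [norm_sub_rev, @norm_sub_sq ℂ, hw]
    have h2 : ‖f (Z' + t n • ro v u) w‖ ≤ 1 := by
      have := (f (Z' + t n • ro v u)).le_opNorm w
      rw [hw1, mul_one] at this
      exact this.trans (hf.maps _ (norm_face_lt hu hv hZ (ht n))).le
    have h3 : RCLike.re (inner ℂ (A0 w) (f (Z' + t n • ro v u) w)) = (φ n 1).re := by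
      simp [φ]
    rw [h3]
    nlinarith [norm_nonneg (f (Z' + t n • ro v u) w)]
  have := hsq.sqrt
  simpa [Real.sqrt_sq] using this

theorem GM.limit_norm {f : (U →L[ℂ] G) → (E →L[ℂ] F)} (hf : GM f) {Z : ℕ → (U →L[ℂ] G)}
    (hZ : ∀ n, ‖Z n‖ < 1) (hZ1 : Tendsto (fun n => ‖Z n‖) atTop (𝓝 1)) {A0 : E →L[ℂ] F}
    (hA0 : Tendsto (fun n => f (Z n)) atTop (𝓝 A0)) : ‖A0‖ = 1 := by
  apply le_antisymm
  · exact le_of_tendsto hA0.norm (Eventually.of_forall fun n => (hf.maps _ (hZ n)).le)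
  · by_contra! hlt
    obtain ⟨r, hr1, hr2⟩ := exists_between hlt
    obtain ⟨s, hs, hs2⟩ := hf.proper r hr2
    have h1 := hA0.norm.eventually_lt_const hr1
    have h2 := hZ1.eventually_const_lt hs
    obtain ⟨n, hn1, hn2⟩ := (h1.and h2).exists
    exact absurd (hs2 _ (hZ n) hn1.le) (not_le.mpr hn2)

theorem GM.subseq {f : (U →L[ℂ] G) → (E →L[ℂ] F)} (hf : GM f) {Z : ℕ → (U →L[ℂ] G)}
    (hZ : ∀ n, ‖Z n‖ < 1) : ∃ A0, ∃ φ : ℕ → ℕ, StrictMono φ ∧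
      Tendsto (fun n => f (Z (φ n))) atTop (𝓝 A0) := by
  have := FiniteDimensional.proper ℂ (E →L[ℂ] F)
  obtain ⟨A0, -, φ, hφ, h⟩ := (isCompact_closedBall (0 : E →L[ℂ] F) 1).tendsto_subseq
    (x := fun n => f (Z n)) (fun n => by simpa using (hf.maps _ (hZ n)).le)
  exact ⟨A0, φ, hφ, h⟩

theorem face_lemma {f : (U →L[ℂ] G) → (E →L[ℂ] F)} (hf : GM f) {v : G} {u : U}
    (hu : ‖u‖ = 1) (hv : ‖v‖ = 1) (E' : Submodule ℂ E)
    (hE' : ∀ t : ℂ, ‖t‖ < 1 → ∀ w ∈ E', f (t • ro v u) w = 0) :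
    ∀ t : ℂ, ‖t‖ < 1 → ∃ w ≠ 0, w ∈ E'ᗮ ∧ ∀ Z', Adm v u Z' →
      f (Z' + t • ro v u) w = f (t • ro v u) w := by
  intro t0 ht0
  by_contra! hcon
  let K : {Z' : U →L[ℂ] G // Adm v u Z'} → Submodule ℂ E'ᗮ := fun Z' =>
    LinearMap.ker ((f (Z'.1 + t0 • ro v u) - f (t0 • ro v u)).toLinearMap ∘ₗ E'ᗮ.subtype)
  obtain ⟨s, -, hs⟩ := finite_iInf K
  have hK : ⨅ i, K i = ⊥ := by
    rw [eq_bot_iff]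
    intro w hw
    rw [Submodule.mem_iInf] at hw
    rw [Submodule.mem_bot]
    by_contra hw0
    obtain ⟨Z', hZ', hne⟩ := hcon w.1 (by simpa using hw0) w.2
    apply hne
    have := hw ⟨Z', hZ'⟩
    simpa [K, sub_eq_zero] using this
  rw [hK] at hs
  let L : ℂ → (E'ᗮ →ₗ[ℂ] (s → F)) := fun t => LinearMap.pi fun i =>
    (f (i.1.1 + t • ro v u) - f (t • ro v u)).toLinearMap ∘ₗ E'ᗮ.subtype
  have hmem : ∀ t : ℂ, ‖t‖ < 1 → ‖t • ro v u‖ < 1 := fun t ht => by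
    have := norm_face_lt hu hv (Adm.zero v u) ht; simpa using this
  have := inj_disc L ?_ ?_ ?_ t0 ht0
  · obtain ⟨w, hw0, hw⟩ := this
    apply hw0
    rw [← Submodule.mem_bot ℂ, ← hs, Submodule.mem_iInf]
    intro i
    rw [Submodule.mem_iInf]
    intro hi
    exact congrFun hw ⟨i, hi⟩
  · intro w
    rw [differentiableOn_pi]
    intro i
    have h1 : DifferentiableOn ℂ (fun t : ℂ => f (i.1.1 + t • ro v u)) (ball 0 1) := by
      refine hf.diff.comp (f := fun t : ℂ => i.1.1 + t • ro v u) (by fun_prop) ?_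
      intro t ht
      simpa using norm_face_lt hu hv i.1.2 (by simpa using ht)
    have h2 : DifferentiableOn ℂ (fun t : ℂ => f (t • ro v u)) (ball 0 1) := by
      refine hf.diff.comp (f := fun t : ℂ => t • ro v u) (by fun_prop) ?_
      intro t ht
      simpa using hmem t (by simpa using ht)
    exact (h1.sub h2).clm_apply (differentiableOn_const (w : E))
  · intro w
    refine ⟨2 * ‖w‖, fun t ht => ?_⟩
    rw [pi_norm_le_iff_of_nonneg (by positivity)]
    intro i
    show ‖(f (i.1.1 + t • ro v u) - f (t • ro v u)) (w:E)‖ ≤ 2 * ‖w‖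
    refine (ContinuousLinearMap.le_opNorm _ _).trans ?_
    refine mul_le_mul_of_nonneg_right ?_ (norm_nonneg _)
    refine (norm_sub_le _ _).trans ?_
    have := hf.maps _ (hmem t ht)
    have := hf.maps _ (norm_face_lt hu hv i.1.2 ht)
    linarith
  · intro t ht1 ht2
    obtain ⟨A0, φ, hφ, hA0⟩ := hf.subseq (Z := fun n => t n • ro v u) (fun n => hmem _ (ht1 n))
    have hA1 : ‖A0‖ = 1 := by
      refine hf.limit_norm (Z := fun n => t (φ n) • ro v u) (fun n => hmem _ (ht1 _)) ?_ hA0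
      simp only [norm_smul, norm_ro, hu, hv, mul_one]
      exact ht2.comp hφ.tendsto_atTop
    obtain ⟨w, hw1, hw2⟩ := exists_norm_attain hA1
    have hw0 : w ≠ 0 := by rintro rfl; simp at hw1
    have hwE : w ∈ E'ᗮ := by
      rw [Submodule.mem_orthogonal']
      intro e he
      rw [← attain hA1.le (hw2.trans hw1.symm)]
      have h1 : Tendsto (fun n => f (t (φ n) • ro v u) e) atTop (𝓝 (A0 e)) :=
        ((ContinuousLinearMap.apply ℂ F e).continuous.tendsto A0).comp hA0
      have h2 : A0 e = 0 := by
        refine tendsto_nhds_unique h1 ?_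
        simp only [hE' _ (ht1 _) e he]
        exact tendsto_const_nhds
      rw [h2, inner_zero_right]
    refine ⟨φ, hφ, ⟨w, hwE⟩, by simpa using hw0, ?_⟩
    rw [tendsto_pi_nhds]
    intro i
    have h1 := face_limit hf hu hv (fun n => ht1 (φ n)) hA0 hw1 hw2 i.1.2
    have h2 : Tendsto (fun n => f (t (φ n) • ro v u) w) atTop (𝓝 (A0 w)) :=
      ((ContinuousLinearMap.apply ℂ F w).continuous.tendsto A0).comp hA0
    have := h1.sub h2
    simpa [L] using this

end TypeI

end

section
open Matrix
open scoped ComplexOrder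
open Set Filter Topology Metric
set_option linter.unusedSectionVars false
set_option linter.unusedSimpArgs false
set_option linter.style.haveILetI false
set_option linter.unusedVariables false
set_option linter.deprecated false

namespace TypeI

variable {U G E F : Type*}
  [NormedAddCommGroup U] [InnerProductSpace ℂ U] [FiniteDimensional ℂ U]
  [NormedAddCommGroup G] [InnerProductSpace ℂ G] [FiniteDimensional ℂ G]
  [NormedAddCommGroup E] [InnerProductSpace ℂ E] [FiniteDimensional ℂ E]
  [NormedAddCommGroup F] [InnerProductSpace ℂ F] [FiniteDimensional ℂ F]

/-- linear automorphisms preserving the indefinite form -/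
structure Mob (U G : Type*) [NormedAddCommGroup U] [InnerProductSpace ℂ U]
    [NormedAddCommGroup G] [InnerProductSpace ℂ G] where
  M : (U × G) ≃L[ℂ] (U × G)
  pres : ∀ x, ‖(M x).1‖ ^ 2 - ‖(M x).2‖ ^ 2 = ‖x.1‖ ^ 2 - ‖x.2‖ ^ 2

namespace Mob

/-- the inverse -/
def symm (M : Mob U G) : Mob U G where
  M := M.M.symm
  pres x := by rw [← M.pres]; simp

/-- denominator -/
noncomputable def den (M : Mob U G) (Z : U →L[ℂ] G) : U →L[ℂ] U :=
  (ContinuousLinearMap.fst ℂ U G) ∘L (M.M : (U × G) →L[ℂ] (U × G)) ∘L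
    (ContinuousLinearMap.inl ℂ U G + (ContinuousLinearMap.inr ℂ U G) ∘L Z)

/-- numerator -/
noncomputable def num (M : Mob U G) (Z : U →L[ℂ] G) : U →L[ℂ] G :=
  (ContinuousLinearMap.snd ℂ U G) ∘L (M.M : (U × G) →L[ℂ] (U × G)) ∘L
    (ContinuousLinearMap.inl ℂ U G + (ContinuousLinearMap.inr ℂ U G) ∘L Z)

/-- the generalized Moebius map -/
noncomputable def map (M : Mob U G) (Z : U →L[ℂ] G) : U →L[ℂ] G :=
  M.num Z ∘L Ring.inverse (M.den Z)

theorem den_apply (M : Mob U G) (Z : U →L[ℂ] G) (u : U) : M.den Z u = (M.M (u, Z u)).1 := by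
  have : ((u, Z u) : U × G) = (u, 0) + (0, Z u) := by simp
  rw [this, map_add]
  simp [den]

theorem num_apply (M : Mob U G) (Z : U →L[ℂ] G) (u : U) : M.num Z u = (M.M (u, Z u)).2 := by
  have : ((u, Z u) : U × G) = (u, 0) + (0, Z u) := by simp
  rw [this, map_add]
  simp [num]

theorem apply_lt {Z : U →L[ℂ] G} (hZ : ‖Z‖ < 1) {u : U} (hu : u ≠ 0) : ‖Z u‖ < ‖u‖ := by
  have hu' : 0 < ‖u‖ := norm_pos_iff.mpr hu
  calc ‖Z u‖ ≤ ‖Z‖ * ‖u‖ := Z.le_opNorm u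
    _ < 1 * ‖u‖ := by gcongr
    _ = ‖u‖ := one_mul _

theorem norm_lt_one_of {Z : U →L[ℂ] G} (h : ∀ u ≠ 0, ‖Z u‖ < ‖u‖) : ‖Z‖ < 1 := by
  have h1 : ‖Z‖ ≤ 1 := by
    refine ContinuousLinearMap.opNorm_le_bound _ zero_le_one fun x => ?_
    by_cases hx : x = 0
    · simp [hx]
    · rw [one_mul]; exact (h x hx).le
  refine lt_of_le_of_ne h1 fun h2 => ?_
  obtain ⟨w, hw1, hw2⟩ := exists_norm_attain h2
  have := h w (by rintro rfl; simp at hw1)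
  rw [hw1, hw2] at this
  exact lt_irrefl _ this

theorem num_lt_den (M : Mob U G) {Z : U →L[ℂ] G} (hZ : ‖Z‖ < 1) {u : U} (hu : u ≠ 0) :
    ‖M.num Z u‖ < ‖M.den Z u‖ := by
  have h1 := M.pres (u, Z u)
  rw [← den_apply, ← num_apply] at h1
  have h2 := apply_lt hZ hu
  simp only at h1
  refine abs_lt_of_sq_lt_sq' ?_ (norm_nonneg _) |>.2
  nlinarith [norm_nonneg (Z u)]

theorem isUnit_den (M : Mob U G) {Z : U →L[ℂ] G} (hZ : ‖Z‖ < 1) : IsUnit (M.den Z) := by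
  have hinj : Function.Injective (M.den Z).toLinearMap := by
    rw [← LinearMap.ker_eq_bot, LinearMap.ker_eq_bot']
    intro u hu
    by_contra hu0
    have h1 := M.num_lt_den hZ hu0
    have h2 : M.den Z u = 0 := hu
    rw [h2, norm_zero] at h1
    exact absurd h1 (not_lt.mpr (norm_nonneg _))
  let e := (LinearEquiv.ofInjectiveEndo _ hinj).toContinuousLinearEquiv
  refine ⟨ContinuousLinearEquiv.toUnit e, ?_⟩
  ext x
  rfl

theorem map_den (M : Mob U G) {Z : U →L[ℂ] G} (hZ : ‖Z‖ < 1) (u : U) :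
    M.map Z (M.den Z u) = M.num Z u := by
  have := Ring.inverse_mul_cancel _ (M.isUnit_den hZ)
  have h2 : Ring.inverse (M.den Z) (M.den Z u) = u := by
    have := congrArg (fun T : U →L[ℂ] U => T u) this
    simpa using this
  simp [map, h2]

theorem den_surj (M : Mob U G) {Z : U →L[ℂ] G} (hZ : ‖Z‖ < 1) (x : U) :
    ∃ u, M.den Z u = x := by
  have := Ring.mul_inverse_cancel _ (M.isUnit_den hZ)
  refine ⟨Ring.inverse (M.den Z) x, ?_⟩
  have := congrArg (fun T : U →L[ℂ] U => T x) this
  simpa using this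

theorem graph (M : Mob U G) {Z : U →L[ℂ] G} (hZ : ‖Z‖ < 1) (u : U) :
    M.M (u, Z u) = (M.den Z u, M.map Z (M.den Z u)) := by
  rw [M.map_den hZ]
  exact Prod.ext (M.den_apply Z u).symm (M.num_apply Z u).symm

theorem map_lt (M : Mob U G) {Z : U →L[ℂ] G} (hZ : ‖Z‖ < 1) : ‖M.map Z‖ < 1 := by
  refine norm_lt_one_of fun x hx => ?_
  obtain ⟨u, rfl⟩ := M.den_surj hZ x
  rw [M.map_den hZ]
  exact M.num_lt_den hZ (by rintro rfl; simp at hx)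

theorem symm_map (M : Mob U G) {Z : U →L[ℂ] G} (hZ : ‖Z‖ < 1) : M.symm.map (M.map Z) = Z := by
  ext u
  have h1 := M.symm.graph (M.map_lt hZ) (M.den Z u)
  rw [← M.graph hZ u] at h1
  have h2 : M.symm.M (M.M (u, Z u)) = (u, Z u) := by simp [symm]
  rw [h2, Prod.mk.injEq] at h1
  rw [← h1.1] at h1
  exact h1.2.symm

theorem symm_symm (M : Mob U G) : M.symm.symm = M := rfl

theorem map_symm (M : Mob U G) {Z : U →L[ℂ] G} (hZ : ‖Z‖ < 1) : M.map (M.symm.map Z) = Z :=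
  M.symm.symm_map hZ

theorem den_diff (M : Mob U G) : Differentiable ℂ M.den := by
  unfold den
  fun_prop

theorem num_diff (M : Mob U G) : Differentiable ℂ M.num := by
  unfold num
  fun_prop

theorem map_diff (M : Mob U G) : DifferentiableOn ℂ M.map (ball 0 1) := by
  have := FiniteDimensional.complete ℂ U
  intro Z hZ
  have hZ : ‖Z‖ < 1 := by simpa using hZ
  obtain ⟨e, he⟩ := M.isUnit_den hZ
  have h1 : DifferentiableAt ℂ (fun Z => Ring.inverse (M.den Z)) Z := by
    have := (differentiableAt_inverse (𝕜 := ℂ) (M.isUnit_den hZ))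
    exact this.comp Z M.den_diff.differentiableAt
  exact (M.num_diff.differentiableAt.clm_comp h1).differentiableWithinAt

theorem map_bound (M : Mob U G) {r : ℝ} (hr : r < 1) :
    ∃ s < (1:ℝ), ∀ Z, ‖Z‖ ≤ r → ‖M.map Z‖ ≤ s := by
  have := FiniteDimensional.proper ℂ (U →L[ℂ] G)
  by_cases h0 : 0 ≤ r
  · obtain ⟨Z0, hZ0, hmax⟩ := (isCompact_closedBall (0 : U →L[ℂ] G) r).exists_isMaxOn
      ⟨0, by simpa using h0⟩ (f := fun Z => ‖M.map Z‖)
      ((M.map_diff.continuousOn.mono (closedBall_subset_ball hr)).norm)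
    refine ⟨_, M.map_lt (Z := Z0) (lt_of_le_of_lt (by simpa using hZ0) hr), fun Z hZ => ?_⟩
    exact hmax (a := Z) (by simpa using hZ)
  · exact ⟨0, zero_lt_one, fun Z hZ => absurd ((norm_nonneg _).trans hZ) h0⟩

/-- base point -/
def Base (M : Mob U G) (Y : U →L[ℂ] G) : Prop := ∀ u, (M.M (u, 0)).2 = Y (M.M (u, 0)).1

theorem Base.map_zero {M : Mob U G} {Y : U →L[ℂ] G} (h : M.Base Y) : M.map 0 = Y := by
  have h0 : ‖(0 : U →L[ℂ] G)‖ < 1 := by simp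
  ext x
  obtain ⟨u, rfl⟩ := M.den_surj h0 x
  rw [M.map_den h0, M.num_apply, M.den_apply]
  exact h u

theorem exists_root {S : U →L[ℂ] U} (hS : IsUnit S) (hp : S.IsPositive) :
    ∃ R a : U →L[ℂ] U, a * R = 1 ∧ R * a = 1 ∧ (∀ x y, inner ℂ (R x) y = inner ℂ x (R y)) ∧
      a * a = S := by
  have := FiniteDimensional.complete ℂ U
  have h0 : 0 ≤ S := by rwa [ContinuousLinearMap.nonneg_iff_isPositive]
  set a := CFC.sqrt S with ha
  have haa : a * a = S := CFC.sqrt_mul_sqrt_self S h0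
  have hu : IsUnit a := by
    rw [← haa] at hS
    exact ((Commute.refl a).isUnit_mul_iff.mp hS).1
  have hsa : IsSelfAdjoint a := IsSelfAdjoint.of_nonneg (CFC.sqrt_nonneg S)
  obtain ⟨e, he⟩ := hu
  refine ⟨↑e⁻¹, a, by rw [← he]; simp, by rw [← he]; simp, ?_, haa⟩
  intro x y
  have h1 : ∀ z w, inner ℂ (a z) w = inner ℂ z (a w) := fun z w => by
    nth_rewrite 1 [← hsa.adjoint_eq]; rw [ContinuousLinearMap.adjoint_inner_left]
  have h2 : ∀ z, a ((↑e⁻¹ : U →L[ℂ] U) z) = z := fun z => by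
    have : a * (↑e⁻¹ : U →L[ℂ] U) = 1 := by rw [← he]; simp
    have := congrArg (fun T : U →L[ℂ] U => T z) this
    simpa using this
  conv_lhs => rw [← h2 y]
  rw [← h1, h2]

theorem exists_base {Y : U →L[ℂ] G} (hY : ‖Y‖ < 1) : ∃ M : Mob U G, M.Base Y := by
  have := FiniteDimensional.complete ℂ U
  have := FiniteDimensional.complete ℂ G
  set Ys := ContinuousLinearMap.adjoint Y with hYs
  have hYsn : ‖Ys‖ < 1 := by rw [hYs]; simpa using hY
  have hn1 : ‖Ys ∘L Y‖ < 1 := by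
    refine lt_of_le_of_lt (ContinuousLinearMap.opNorm_comp_le _ _) ?_
    nlinarith [norm_nonneg Y, norm_nonneg Ys]
  have hn2 : ‖Y ∘L Ys‖ < 1 := by
    refine lt_of_le_of_lt (ContinuousLinearMap.opNorm_comp_le _ _) ?_
    nlinarith [norm_nonneg Y, norm_nonneg Ys]
  have hi : ∀ x c, inner ℂ (Y x) c = inner ℂ x (Ys c) := fun x c =>
    (ContinuousLinearMap.adjoint_inner_right _ _ _).symm
  have hi' : ∀ x c, inner ℂ (Ys c) x = inner ℂ c (Y x) := fun x c =>
    (ContinuousLinearMap.adjoint_inner_left _ _ _)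
  have hp1 : (1 - Ys ∘L Y).IsPositive := by
    rw [ContinuousLinearMap.isPositive_iff]
    refine ⟨?_, fun x => ?_⟩
    · intro x y
      simp [inner_sub_left, inner_sub_right, hi, hi']
    · have : inner ℂ ((1 - Ys ∘L Y) x) x = ((‖x‖ ^ 2 - ‖Y x‖ ^ 2 : ℝ) : ℂ) := by
        simp [inner_sub_left, hi', inner_self_eq_norm_sq_to_K]
      rw [this]
      have h2 : ‖Y x‖ ≤ ‖x‖ := by
        refine (Y.le_opNorm x).trans ?_
        nlinarith [norm_nonneg x]
      have h3 : 0 ≤ ‖x‖ ^ 2 - ‖Y x‖ ^ 2 := by nlinarith [norm_nonneg (Y x)]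
      exact_mod_cast h3
  have hp2 : (1 - Y ∘L Ys).IsPositive := by
    rw [ContinuousLinearMap.isPositive_iff]
    refine ⟨?_, fun x => ?_⟩
    · intro x y
      simp [inner_sub_left, inner_sub_right, hi, hi']
    · have : inner ℂ ((1 - Y ∘L Ys) x) x = ((‖x‖ ^ 2 - ‖Ys x‖ ^ 2 : ℝ) : ℂ) := by
        simp [inner_sub_left, hi, inner_self_eq_norm_sq_to_K]
      rw [this]
      have h2 : ‖Ys x‖ ≤ ‖x‖ := by
        refine (Ys.le_opNorm x).trans ?_
        nlinarith [norm_nonneg x]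
      have h3 : 0 ≤ ‖x‖ ^ 2 - ‖Ys x‖ ^ 2 := by nlinarith [norm_nonneg (Ys x)]
      exact_mod_cast h3
  obtain ⟨R, a, haR, hRa, hR, haa⟩ := exists_root (isUnit_one_sub_of_norm_lt_one hn1) hp1
  obtain ⟨P, b, hbP, hPb, hP, hbb⟩ := exists_root (isUnit_one_sub_of_norm_lt_one hn2) hp2
  have haR' : ∀ x, a (R x) = x := fun x => congrArg (fun T : U →L[ℂ] U => T x) haR
  have hRa' : ∀ x, R (a x) = x := fun x => congrArg (fun T : U →L[ℂ] U => T x) hRa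
  have hbP' : ∀ x, b (P x) = x := fun x => congrArg (fun T : G →L[ℂ] G => T x) hbP
  have hPb' : ∀ x, P (b x) = x := fun x => congrArg (fun T : G →L[ℂ] G => T x) hPb
  have haa' : ∀ x, a (a x) = x - Ys (Y x) := fun x => congrArg (fun T : U →L[ℂ] U => T x) haa
  have hbb' : ∀ x, b (b x) = x - Y (Ys x) := fun x => congrArg (fun T : G →L[ℂ] G => T x) hbb
  -- intertwining
  have hYa : ∀ x, Y (R (R x)) = P (P (Y x)) := by
    intro x
    have : b (b (Y (R (R x)))) = Y x := by
      rw [hbb', ← map_sub, ← haa', haR', haR']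
    rw [← this, hPb', hPb']
  have hYb : ∀ x, Ys (P (P x)) = R (R (Ys x)) := by
    intro x
    have : a (a (Ys (P (P x)))) = Ys x := by
      rw [haa', ← map_sub, ← hbb', hbP', hbP']
    rw [← this, hRa', hRa']
  have hRR : ∀ x, R (R x) - Ys (P (P (Y x))) = x := by
    intro x
    rw [hYb, ← map_sub, ← map_sub, ← haa', hRa', hRa']
  have hPP : ∀ x, P (P x) - Y (R (R (Ys x))) = x := by
    intro x
    rw [hYa, ← map_sub, ← map_sub, ← hbb', hPb', hPb']
  have hRS : ∀ x, R (R x - Ys (Y (R x))) = x := fun x => by rw [← haa', haR', hRa']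
  have hPS : ∀ x, P (P x - Y (Ys (P x))) = x := fun x => by rw [← hbb', hbP', hPb']
  let T : (U × G) →ₗ[ℂ] (U × G) :=
    { toFun := fun x => (R x.1 + Ys (P x.2), Y (R x.1) + P x.2)
      map_add' := fun x y => by
        ext <;> simp <;> abel
      map_smul' := fun c x => by ext <;> simp }
  let T' : (U × G) →ₗ[ℂ] (U × G) :=
    { toFun := fun x => (R (x.1 - Ys x.2), P (x.2 - Y x.1))
      map_add' := fun x y => by
        ext <;> simp <;> abel
      map_smul' := fun c x => by ext <;> simp [smul_sub] }
  have hTT' : ∀ x, T (T' x) = x := by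
    rintro ⟨x, c⟩
    simp only [T, T', LinearMap.coe_mk, AddHom.coe_mk, map_sub]
    ext
    · show R (R x) - R (R (Ys c)) + (Ys (P (P c)) - Ys (P (P (Y x)))) = x
      rw [hYb]
      nth_rewrite 3 [← hRR x]; abel
    · show Y (R (R x)) - Y (R (R (Ys c))) + (P (P c) - P (P (Y x))) = c
      rw [hYa x]
      nth_rewrite 3 [← hPP c]; abel
  have hT'T : ∀ x, T' (T x) = x := by
    rintro ⟨x, c⟩
    simp only [T, T', LinearMap.coe_mk, AddHom.coe_mk]
    ext
    · show R (R x + Ys (P c) - Ys (Y (R x) + P c)) = x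
      rw [← hRS x]
      congr 1
      simp only [hRS, map_add]; abel
    · show P (Y (R x) + P c - Y (R x + Ys (P c))) = c
      rw [← hPS c]
      congr 1
      simp only [hPS, map_add]; abel
  refine ⟨⟨(LinearEquiv.ofLinear T T' (LinearMap.ext hTT') (LinearMap.ext hT'T)).toContinuousLinearEquiv,
    ?_⟩, ?_⟩
  · rintro ⟨x, c⟩
    show ‖R x + Ys (P c)‖ ^ 2 - ‖Y (R x) + P c‖ ^ 2 = ‖x‖ ^ 2 - ‖c‖ ^ 2
    have e1 : ‖R x‖ ^ 2 - ‖Y (R x)‖ ^ 2 = ‖x‖ ^ 2 := by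
      have : inner ℂ (R (R x - Ys (Y (R x)))) x = inner ℂ x x := by rw [hRS]
      rw [hR, inner_sub_left, hi', inner_self_eq_norm_sq_to_K, inner_self_eq_norm_sq_to_K,
        inner_self_eq_norm_sq_to_K] at this
      exact_mod_cast this
    have e2 : ‖P c‖ ^ 2 - ‖Ys (P c)‖ ^ 2 = ‖c‖ ^ 2 := by
      have : inner ℂ (P (P c - Y (Ys (P c)))) c = inner ℂ c c := by rw [hPS]
      rw [hP, inner_sub_left, hi, inner_self_eq_norm_sq_to_K, inner_self_eq_norm_sq_to_K,
        inner_self_eq_norm_sq_to_K] at this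
      exact_mod_cast this
    rw [@norm_add_sq ℂ, @norm_add_sq ℂ, hi, ← e1, ← e2]
    ring
  · intro u
    show Y (R u) + P 0 = Y (R u + Ys (P 0))
    simp

end Mob

theorem GM.conj {f : (U →L[ℂ] G) → (E →L[ℂ] F)} (hf : GM f) (M : Mob U G) (N : Mob E F) :
    GM (fun Z => N.map (f (M.map Z))) where
  diff := by
    refine N.map_diff.comp (hf.diff.comp M.map_diff ?_) ?_
    · intro Z hZ; simpa using M.map_lt (by simpa using hZ)
    · intro Z hZ; simpa using hf.maps _ (M.map_lt (by simpa using hZ))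
  maps Z hZ := N.map_lt (hf.maps _ (M.map_lt hZ))
  proper r hr := by
    obtain ⟨r1, hr1, h1⟩ := N.symm.map_bound hr
    obtain ⟨r2, hr2, h2⟩ := hf.proper r1 hr1
    obtain ⟨r3, hr3, h3⟩ := M.symm.map_bound hr2
    refine ⟨r3, hr3, fun Z hZ hle => ?_⟩
    have e1 := h1 _ hle
    rw [N.symm_map (hf.maps _ (M.map_lt hZ))] at e1
    have e2 := h3 _ (h2 _ (M.map_lt hZ) e1)
    rwa [M.symm_map hZ] at e2

end TypeI

end

section
open Matrix
open scoped ComplexOrder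
open Set Filter Topology Metric
set_option linter.unusedSectionVars false
set_option linter.unusedSimpArgs false
set_option linter.style.haveILetI false
set_option linter.unusedVariables false
set_option linter.deprecated false

namespace TypeI

variable {U G E F : Type*}
  [NormedAddCommGroup U] [InnerProductSpace ℂ U] [FiniteDimensional ℂ U]
  [NormedAddCommGroup G] [InnerProductSpace ℂ G] [FiniteDimensional ℂ G]
  [NormedAddCommGroup E] [InnerProductSpace ℂ E] [FiniteDimensional ℂ E]
  [NormedAddCommGroup F] [InnerProductSpace ℂ F] [FiniteDimensional ℂ F]

theorem tendsto_clm {ι V W : Type*} [NormedAddCommGroup V] [NormedSpace ℂ V]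
    [NormedAddCommGroup W] [NormedSpace ℂ W] {l : Filter ι} {f : ι → V →L[ℂ] W} {g : ι → V}
    {f0 : V →L[ℂ] W} {g0 : V} (hf : Tendsto f l (𝓝 f0)) (hg : Tendsto g l (𝓝 g0)) :
    Tendsto (fun n => f n (g n)) l (𝓝 (f0 g0)) :=
  ((isBoundedBilinearMap_apply (𝕜 := ℂ) (E := V) (F := W)).continuous.tendsto (f0, g0)).comp
    (hf.prodMk_nhds hg)

theorem mem_ball1 {X : Type*} [NormedAddCommGroup X] {Z : X} : Z ∈ ball (0:X) 1 ↔ ‖Z‖ < 1 := by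
  simp

theorem fderiv_cont {V X : Type*} [NormedAddCommGroup V] [NormedSpace ℂ V] [FiniteDimensional ℂ V]
    [NormedAddCommGroup X] [NormedSpace ℂ X]
    {f : V → X} {S : Set V} (hS : IsOpen S) (hf : DifferentiableOn ℂ f S) :
    ContinuousOn (fderiv ℂ f) S := by
  rw [continuousOn_clm_apply]
  intro W Y0 hY0
  have := FiniteDimensional.proper ℂ V
  apply ContinuousAt.continuousWithinAt
  obtain ⟨r, hr, hrS⟩ := Metric.isOpen_iff.mp hS Y0 hY0
  set ρ : ℝ := r / 4 / (‖W‖ + 1) with hρ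
  have hW0 := norm_nonneg W
  have hρ0 : 0 < ρ := by positivity
  have hρW : ρ * ‖W‖ ≤ r / 4 := by
    rw [hρ, div_mul_eq_mul_div, div_le_iff₀ (by positivity)]
    nlinarith
  have huc : UniformContinuousOn f (closedBall Y0 (r / 2)) :=
    (isCompact_closedBall Y0 (r / 2)).uniformContinuousOn_of_continuous
      (hf.continuousOn.mono ((closedBall_subset_ball (by linarith)).trans hrS))
  have hder : ∀ Y ∈ S, deriv (fun s : ℂ => f (Y + s • W)) 0 = fderiv ℂ f Y W := by
    intro Y hY
    have h1 : HasFDerivAt f (fderiv ℂ f Y) (Y + (0:ℂ) • W) := by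
      simpa using (hf.differentiableAt (hS.mem_nhds hY)).hasFDerivAt
    have h2 : HasDerivAt (fun s : ℂ => Y + s • W) W 0 := by
      simpa using ((hasDerivAt_id (0:ℂ)).smul_const W).const_add Y
    exact (h1.comp_hasDerivAt (0:ℂ) h2).deriv
  rw [ContinuousAt, Metric.tendsto_nhds]
  intro ε hε
  rw [Metric.uniformContinuousOn_iff] at huc
  obtain ⟨δ, hδ, hδ2⟩ := huc (ε * ρ / 2) (by positivity)
  have hev : ∀ᶠ Y in 𝓝 Y0, dist Y Y0 < min δ (r / 4) :=
    Metric.ball_mem_nhds Y0 (lt_min hδ (by positivity))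
  filter_upwards [hev] with Y hY
  have hYd : dist Y Y0 < δ := lt_of_lt_of_le hY (min_le_left _ _)
  have hYr : dist Y Y0 < r / 4 := lt_of_lt_of_le hY (min_le_right _ _)
  have hYS : Y ∈ S := hrS (by rw [mem_ball]; linarith)
  have hmem : ∀ Y', dist Y' Y0 < r / 4 → ∀ s : ℂ, ‖s‖ ≤ ρ → Y' + s • W ∈ closedBall Y0 (r/2) := by
    intro Y' hY' s hs
    rw [mem_closedBall, dist_eq_norm]
    have : Y' + s • W - Y0 = (Y' - Y0) + s • W := by abel
    rw [this]
    rw [dist_eq_norm] at hY'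
    have h2 : ‖s • W‖ ≤ r / 4 := by
      rw [norm_smul]; exact (mul_le_mul_of_nonneg_right hs hW0).trans hρW
    linarith [norm_add_le (Y' - Y0) (s • W)]
  have hcb : closedBall Y0 (r/2) ⊆ S := (closedBall_subset_ball (by linarith)).trans hrS
  have hdY : ∀ Y', dist Y' Y0 < r / 4 → DifferentiableOn ℂ (fun s : ℂ => f (Y' + s • W))
      (closedBall 0 ρ) := by
    intro Y' hY'
    refine hf.comp (f := fun s : ℂ => Y' + s • W) (by fun_prop) ?_
    intro s hs
    exact hcb (hmem Y' hY' s (by simpa using hs))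
  have hY00 : dist Y0 Y0 < r / 4 := by rw [dist_self]; positivity
  have hnb : closedBall (0:ℂ) ρ ∈ 𝓝 (0:ℂ) := closedBall_mem_nhds _ hρ0
  have hg := Complex.norm_deriv_le_of_forall_mem_sphere_norm_le (c := 0) (R := ρ)
    (C := ε * ρ / 2)
    (f := fun s : ℂ => f (Y + s • W) - f (Y0 + s • W)) hρ0 ?_ ?_
  · rw [deriv_fun_sub ((hdY Y hYr).differentiableAt hnb) ((hdY Y0 hY00).differentiableAt hnb),
      hder Y hYS, hder Y0 hY0] at hg
    rw [dist_eq_norm]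
    refine lt_of_le_of_lt hg ?_
    rw [div_lt_iff₀ hρ0]; nlinarith
  · refine DifferentiableOn.diffContOnCl ?_
    rw [closure_ball _ hρ0.ne']
    exact (hdY Y hYr).sub (hdY Y0 hY00)
  · intro s hs
    have hs' : ‖s‖ ≤ ρ := by simpa using (mem_sphere_zero_iff_norm.mp hs).le
    rw [← dist_eq_norm]
    refine (hδ2 _ (hmem Y hYr s hs') _ (hmem Y0 hY00 s hs') ?_).le
    simpa [dist_eq_norm] using hYd

theorem line_ident {V X : Type*} [NormedAddCommGroup V] [NormedSpace ℂ V]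
    [NormedAddCommGroup X] [NormedSpace ℂ X] [CompleteSpace X]
    {h : V → X} (hd : DifferentiableOn ℂ h (ball 0 1)) {Y Z : V} (hY : ‖Y‖ < 1) (hZ : ‖Z‖ < 1)
    {c : X} (he : ∀ᶠ s in 𝓝 (0:ℂ), h (Y + s • (Z - Y)) = c) : h Z = c := by
  let l : ℂ → V := fun s => Y + s • (Z - Y)
  have hl : Differentiable ℂ l := by intro s; fun_prop
  have := ident_line (h := fun s => h (l s) - c) (S := l ⁻¹' ball 0 1)
    (isOpen_ball.preimage hl.continuous) ?_ (by simpa [l] using hY)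
    ((hd.comp hl.differentiableOn (fun _ h => h)).sub_const c)
    (he.mono fun s hs => sub_eq_zero.mpr hs) 1 (by simpa [l] using hZ)
  · simpa [l, sub_eq_zero] using this
  · intro a ha b hb s t hs ht hst
    have : l (s • a + t • b) = s • l a + t • l b := by
      simp only [l, smul_add]
      have e1 : s • (a • (Z - Y)) = ((s • a : ℂ)) • (Z - Y) := by rw [smul_assoc]
      have e2 : t • (b • (Z - Y)) = ((t • b : ℂ)) • (Z - Y) := by rw [smul_assoc]
      rw [e1, e2, add_smul]
      have : Y = s • Y + t • Y := by rw [← add_smul, hst, one_smul]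
      nth_rewrite 1 [this]
      abel
    show l _ ∈ ball (0:V) 1
    rw [this]
    exact convex_ball (0:V) 1 ha hb hs ht hst

/-- common-value subspace -/
def Kc (f : (U →L[ℂ] G) → (E →L[ℂ] F)) (Y : U →L[ℂ] G) (S : Set (U →L[ℂ] G)) :
    Submodule ℂ E where
  carrier := {w | ∀ Z ∈ S, f Z w = f Y w}
  add_mem' := fun ha hb Z hZ => by rw [map_add, map_add, ha Z hZ, hb Z hZ]
  zero_mem' := fun Z hZ => by simp
  smul_mem' := fun c a ha Z hZ => by rw [map_smul, map_smul, ha Z hZ]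

theorem mem_Kc {f : (U →L[ℂ] G) → (E →L[ℂ] F)} {Y : U →L[ℂ] G} {S : Set (U →L[ℂ] G)} {w : E} :
    w ∈ Kc f Y S ↔ ∀ Z ∈ S, f Z w = f Y w := Iff.rfl

theorem Kc_mono {f : (U →L[ℂ] G) → (E →L[ℂ] F)} {Y : U →L[ℂ] G} {S T : Set (U →L[ℂ] G)}
    (h : S ⊆ T) : Kc f Y T ≤ Kc f Y S := fun w hw Z hZ => hw Z (h hZ)

/-- rank-one slice -/
def sU (Y : U →L[ℂ] G) (u : U) : Set (U →L[ℂ] G) :=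
  {Z | ‖Z‖ < 1 ∧ ∃ (a : G) (β : U →L[ℂ] ℂ), β u = 0 ∧ Z = Y + β.smulRight a}
/-- slice -/
def sN (Y : U →L[ℂ] G) (u : U) : Set (U →L[ℂ] G) := {Z | ‖Z‖ < 1 ∧ Z u = Y u}
/-- two-sided slice -/
def sV (Y : U →L[ℂ] G) (u : U) (γ : G →L[ℂ] ℂ) : Set (U →L[ℂ] G) :=
  {Z | ‖Z‖ < 1 ∧ Z u = Y u ∧ ∀ x, γ (Z x) = γ (Y x)}

theorem sU_sub (Y : U →L[ℂ] G) (u : U) : sU Y u ⊆ sN Y u := by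
  rintro Z ⟨h, a, β, hβ, rfl⟩
  exact ⟨h, by simp [hβ]⟩

theorem sV_sub (Y : U →L[ℂ] G) (u : U) (γ : G →L[ℂ] ℂ) : sV Y u γ ⊆ sN Y u :=
  fun Z h => ⟨h.1, h.2.1⟩

theorem Kc_closed {X : Type*} [TopologicalSpace X] {f : (U →L[ℂ] G) → (E →L[ℂ] F)}
    (hf : ContinuousOn f (ball 0 1)) {S : X → Set (U →L[ℂ] G)} {y : X → (U →L[ℂ] G)} {x0 : X}
    (hy : ContinuousAt y x0) (hy1 : ‖y x0‖ < 1)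
    (h : ∀ Z ∈ S x0, ‖Z‖ < 1 ∧ ∃ z : X → (U →L[ℂ] G), ContinuousAt z x0 ∧ z x0 = Z ∧
      ∀ᶠ x in 𝓝 x0, ‖z x‖ < 1 → z x ∈ S x) : ClosedAt (fun x => Kc f (y x) (S x)) x0 := by
  intro x w w0 hx hw hw0 Z hZ
  obtain ⟨hZ1, z, hz, rfl, hzS⟩ := h Z hZ
  have c1 : ContinuousAt f (z x0) := hf.continuousAt (isOpen_ball.mem_nhds (mem_ball1.mpr hZ1))
  have c2 : ContinuousAt f (y x0) := hf.continuousAt (isOpen_ball.mem_nhds (mem_ball1.mpr hy1))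
  have t1 : Tendsto (fun n => f (z (x n)) (w n)) atTop (𝓝 (f (z x0) w0)) :=
    tendsto_clm (f := fun n => f (z (x n))) ((c1.tendsto.comp hz.tendsto).comp hx) hw0
  have t2 : Tendsto (fun n => f (y (x n)) (w n)) atTop (𝓝 (f (y x0) w0)) :=
    tendsto_clm (f := fun n => f (y (x n))) ((c2.tendsto.comp hy.tendsto).comp hx) hw0
  have hev : ∀ᶠ n in atTop, f (z (x n)) (w n) = f (y (x n)) (w n) := by
    have hlt : ∀ᶠ x in 𝓝 x0, ‖z x‖ < 1 := hz.norm.eventually_lt_const hZ1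
    filter_upwards [hx.eventually (hzS.and hlt)] with n hn
    exact hw n _ (hn.1 hn.2)
  exact tendsto_nhds_unique (t1.congr' hev) t2

theorem exists_one {V : Type*} [NormedAddCommGroup V] [NormedSpace ℂ V] {u : V} (hu : u ≠ 0) :
    ∃ ξ : V →L[ℂ] ℂ, ξ u = 1 := SeparatingDual.exists_eq_one hu

/-- the projection killing `u` -/
noncomputable def prj (ξ : U →L[ℂ] ℂ) (u : U) : U →L[ℂ] U :=
  ContinuousLinearMap.id ℂ U - ((ξ u)⁻¹ • ξ).smulRight u

theorem prj_self {ξ : U →L[ℂ] ℂ} {u : U} (h : ξ u ≠ 0) : prj ξ u u = 0 := by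
  simp [prj, h]

theorem prj_cont {ξ : U →L[ℂ] ℂ} {u : U} (h : ξ u ≠ 0) : ContinuousAt (prj ξ) u := by
  have h1 : ContinuousAt (fun u => (ξ u)⁻¹) u := ξ.continuous.continuousAt.inv₀ h
  have e : prj ξ = fun u => ContinuousLinearMap.id ℂ U -
      (ξ u)⁻¹ • (ContinuousLinearMap.smulRightL ℂ U U ξ u) := by
    funext u; ext x; simp [prj, smul_smul]
  rw [e]
  exact continuousAt_const.sub (h1.smul (ContinuousLinearMap.continuous _).continuousAt)

theorem closed_N {f : (U →L[ℂ] G) → (E →L[ℂ] F)} (hf : ContinuousOn f (ball 0 1))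
    {Y : U →L[ℂ] G} {u : U} (hY : ‖Y‖ < 1) (hu : u ≠ 0) :
    ClosedAt (fun x : (U →L[ℂ] G) × U => Kc f x.1 (sN x.1 x.2)) (Y, u) := by
  obtain ⟨ξ, hξ⟩ := exists_one hu
  have hξ0 : ξ u ≠ 0 := by simp [hξ]
  refine Kc_closed hf continuousAt_fst hY ?_
  rintro Z ⟨hZ, hZu⟩
  refine ⟨hZ, fun x => x.1 + (Z - Y) ∘L prj ξ x.2, ?_, ?_, ?_⟩
  · refine continuousAt_fst.add (continuousAt_const.clm_comp ?_)
    exact ContinuousAt.comp (f := Prod.snd) (x := (Y, u)) (prj_cont hξ0) continuousAt_snd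
  · ext x
    simp only [prj, hξ, ContinuousLinearMap.add_apply, ContinuousLinearMap.comp_apply]
    simp [hZu]
  · have : ∀ᶠ x : (U →L[ℂ] G) × U in 𝓝 (Y, u), ξ x.2 ≠ 0 :=
      ContinuousAt.eventually_ne (g := fun x : (U →L[ℂ] G) × U => ξ x.2)
        (by fun_prop) hξ0
    filter_upwards [this] with x hx hlt
    exact ⟨hlt, by simp [prj_self hx]⟩

theorem closed_U {f : (U →L[ℂ] G) → (E →L[ℂ] F)} (hf : ContinuousOn f (ball 0 1))
    {Y : U →L[ℂ] G} {u : U} (hY : ‖Y‖ < 1) (hu : u ≠ 0) :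
    ClosedAt (fun x : (U →L[ℂ] G) × U => Kc f x.1 (sU x.1 x.2)) (Y, u) := by
  obtain ⟨ξ, hξ⟩ := exists_one hu
  have hξ0 : ξ u ≠ 0 := by simp [hξ]
  refine Kc_closed hf continuousAt_fst hY ?_
  rintro Z ⟨hZ, a, β, hβ, rfl⟩
  refine ⟨hZ, fun x => x.1 + (β.smulRight a) ∘L prj ξ x.2, ?_, ?_, ?_⟩
  · refine continuousAt_fst.add (continuousAt_const.clm_comp ?_)
    exact ContinuousAt.comp (f := Prod.snd) (x := (Y, u)) (prj_cont hξ0) continuousAt_snd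
  · ext x
    simp [prj, hξ, hβ]
  · have : ∀ᶠ x : (U →L[ℂ] G) × U in 𝓝 (Y, u), ξ x.2 ≠ 0 :=
      ContinuousAt.eventually_ne (g := fun x : (U →L[ℂ] G) × U => ξ x.2)
        (by fun_prop) hξ0
    filter_upwards [this] with x hx hlt
    exact ⟨hlt, a, β ∘L prj ξ x.2, by simp [prj_self hx], by ext; simp⟩

theorem closed_V {f : (U →L[ℂ] G) → (E →L[ℂ] F)} (hf : ContinuousOn f (ball 0 1))
    {Y : U →L[ℂ] G} {u : U} {γ : G →L[ℂ] ℂ} (hY : ‖Y‖ < 1) (hu : u ≠ 0) (hγ : γ ≠ 0) :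
    ClosedAt (fun x : (U →L[ℂ] G) × U × (G →L[ℂ] ℂ) => Kc f x.1 (sV x.1 x.2.1 x.2.2))
      (Y, u, γ) := by
  obtain ⟨ξ, hξ⟩ := exists_one hu
  have hξ0 : ξ u ≠ 0 := by simp [hξ]
  obtain ⟨g, hg⟩ : ∃ g, γ g ≠ 0 := by
    by_contra! h; exact hγ (by ext x; simp [h x])
  refine Kc_closed hf continuousAt_fst hY ?_
  rintro Z ⟨hZ, hZu, hZγ⟩
  refine ⟨hZ, fun x => x.1 + ((Z - Y) ∘L prj ξ x.2.1 -
    (x.2.2 g)⁻¹ • (ContinuousLinearMap.smulRightL ℂ U G (x.2.2 ∘L ((Z - Y) ∘L prj ξ x.2.1)) g)),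
    ?_, ?_, ?_⟩
  · have c1 : ContinuousAt (fun x : (U →L[ℂ] G) × U × (G →L[ℂ] ℂ) =>
        (Z - Y) ∘L prj ξ x.2.1) (Y, u, γ) := by
      refine continuousAt_const.clm_comp ?_
      exact ContinuousAt.comp (f := fun x : (U →L[ℂ] G) × U × (G →L[ℂ] ℂ) => x.2.1)
        (x := (Y, u, γ)) (prj_cont hξ0) (by fun_prop)
    have c2 : ContinuousAt (fun x : (U →L[ℂ] G) × U × (G →L[ℂ] ℂ) => (x.2.2 g)⁻¹) (Y, u, γ) :=
      ContinuousAt.inv₀ (by fun_prop) hg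
    have c3 : ContinuousAt (fun x : (U →L[ℂ] G) × U × (G →L[ℂ] ℂ) =>
        x.2.2 ∘L ((Z - Y) ∘L prj ξ x.2.1)) (Y, u, γ) :=
      ContinuousAt.clm_comp (by fun_prop) c1
    have c4 := ((ContinuousLinearMap.smulRightL ℂ U G).continuous.continuousAt.comp c3).clm_apply
      (continuousAt_const (y := g))
    exact continuousAt_fst.add (c1.sub (c2.smul c4))
  · ext x
    simp [prj, hξ, hZu, hZγ]
  · have h1 : ∀ᶠ x : (U →L[ℂ] G) × U × (G →L[ℂ] ℂ) in 𝓝 (Y, u, γ), ξ x.2.1 ≠ 0 :=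
      ContinuousAt.eventually_ne (g := fun x : (U →L[ℂ] G) × U × (G →L[ℂ] ℂ) => ξ x.2.1)
        (by fun_prop) hξ0
    have h2 : ∀ᶠ x : (U →L[ℂ] G) × U × (G →L[ℂ] ℂ) in 𝓝 (Y, u, γ), x.2.2 g ≠ 0 :=
      ContinuousAt.eventually_ne (g := fun x : (U →L[ℂ] G) × U × (G →L[ℂ] ℂ) => x.2.2 g)
        (by fun_prop) hg
    filter_upwards [h1, h2] with x hx hx2 hlt
    refine ⟨hlt, ?_, ?_⟩
    · simp [prj_self hx]
    · intro y
      have hsr : ∀ (c : U →L[ℂ] ℂ), (ContinuousLinearMap.smulRightL ℂ U G c g) y = c y • g :=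
        fun c => rfl
      simp only [ContinuousLinearMap.add_apply, map_add, ContinuousLinearMap.sub_apply, map_sub,
        ContinuousLinearMap.smul_apply, map_smul, hsr,
        ContinuousLinearMap.comp_apply, ContinuousLinearMap.smulRight_apply, smul_eq_mul]
      field_simp
      ring

theorem GM.comp_mob {f : (U →L[ℂ] G) → (E →L[ℂ] F)} (hf : GM f) (M : Mob U G) :
    GM (fun Z => f (M.map Z)) where
  diff := by
    refine (hf.diff.comp M.map_diff ?_)
    intro Z hZ; simpa using M.map_lt (by simpa using hZ)
  maps Z hZ := (hf.maps _ (M.map_lt hZ))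
  proper r1 hr1 := by
    obtain ⟨r2, hr2, h2⟩ := hf.proper r1 hr1
    obtain ⟨r3, hr3, h3⟩ := M.symm.map_bound hr2
    refine ⟨r3, hr3, fun Z hZ hle => ?_⟩
    have e2 := h3 _ (h2 _ (M.map_lt hZ) hle)
    rwa [M.symm_map hZ] at e2

theorem V_ne_bot {f : (U →L[ℂ] G) → (E →L[ℂ] F)} (hf : GM f)
    {Y : U →L[ℂ] G} {u : U} {γ : G →L[ℂ] ℂ} (hY : ‖Y‖ < 1) (hu : u ≠ 0) (hγ : γ ≠ 0) :
    Kc f Y (sV Y u γ) ≠ ⊥ := by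
  obtain ⟨M, hM⟩ := Mob.exists_base hY
  have h0 : ‖(0 : U →L[ℂ] G)‖ < 1 := by simp
  obtain ⟨x, hx⟩ := M.den_surj h0 u
  have hMx : M.M (x, 0) = (u, Y u) := by
    have := M.graph h0 x
    rw [hx, hM.map_zero] at this
    exact this
  have hx0 : x ≠ 0 := by rintro rfl; simp at hx; exact hu hx.symm
  let Λ : (U × G) →L[ℂ] ℂ := γ ∘L (ContinuousLinearMap.snd ℂ U G - Y ∘L ContinuousLinearMap.fst ℂ U G)
  have hΛ : ∀ p : U × G, Λ p = γ (p.2 - Y p.1) := fun p => by simp [Λ]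
  have hΛ0 : ∀ y, Λ (M.M (y, 0)) = 0 := fun y => by rw [hΛ, hM y]; simp
  let γt : G →L[ℂ] ℂ := Λ ∘L (M.M : (U × G) →L[ℂ] (U × G)) ∘L ContinuousLinearMap.inr ℂ U G
  have hγt : ∀ y c, Λ (M.M (y, c)) = γt c := by
    intro y c
    have : ((y, c) : U × G) = (y, 0) + (0, c) := by simp
    rw [this, map_add, map_add, hΛ0]
    simp [γt]
  have := FiniteDimensional.complete ℂ G
  set v := (InnerProductSpace.toDual ℂ G).symm γt with hv
  have hv' : ∀ c, inner ℂ v c = γt c := fun c => by simp [hv]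
  have hv0 : v ≠ 0 := by
    intro h
    apply hγ
    ext c
    have h1 := hΛ (0, c)
    have h2 : Λ (0, c) = 0 := by
      have : ((0, c) : U × G) = M.M ((M.M.symm (0, c)).1, (M.M.symm (0, c)).2) := by simp
      rw [this, hγt, ← hv', h]; simp
    simpa [h2] using h1.symm
  set u1 : U := ((‖x‖⁻¹ : ℝ) : ℂ) • x with hu1
  set v1 : G := ((‖v‖⁻¹ : ℝ) : ℂ) • v with hv1
  have hu1n : ‖u1‖ = 1 := by simp [hu1, norm_smul, hx0]
  have hv1n : ‖v1‖ = 1 := by simp [hv1, norm_smul, hv0]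
  obtain ⟨w, hw0, -, hw⟩ := face_lemma (hf.comp_mob M) hu1n hv1n ⊥ (by simp) 0 (by simp)
  simp only [zero_smul, add_zero] at hw
  refine (Submodule.ne_bot_iff _).mpr ⟨w, ?_, hw0⟩
  rintro Z ⟨hZ, hZu, hZγ⟩
  have hadm : Adm v1 u1 (M.symm.map Z) := by
    refine ⟨M.symm.map_lt hZ, ?_, fun y => ?_⟩
    · have h1 := M.symm.graph hZ u
      rw [hZu, ← hMx] at h1
      have h2 : M.symm.M (M.M (x, 0)) = (x, 0) := by simp [Mob.symm]
      rw [h2, Prod.mk.injEq] at h1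
      rw [← h1.1] at h1
      rw [hu1, map_smul, ← h1.2, smul_zero]
    · have h1 := M.graph (M.symm.map_lt hZ) y
      rw [M.map_symm hZ] at h1
      have h2 := hγt y (M.symm.map Z y)
      rw [h1, hΛ, map_sub, hZγ, sub_self, ← hv'] at h2
      rw [hv1, inner_smul_left, ← h2, mul_zero]
  have := hw _ hadm
  rw [M.map_symm hZ, hM.map_zero] at this
  exact this

end TypeI

end

section
open Matrix
open scoped ComplexOrder
open Set Filter Topology Metric
set_option linter.unusedSectionVars false
set_option linter.unusedSimpArgs false
set_option linter.style.haveILetI false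
set_option linter.unusedVariables false
set_option linter.deprecated false

namespace TypeI

variable {U G E F : Type*}
  [NormedAddCommGroup U] [InnerProductSpace ℂ U] [FiniteDimensional ℂ U]
  [NormedAddCommGroup G] [InnerProductSpace ℂ G] [FiniteDimensional ℂ G]
  [NormedAddCommGroup E] [InnerProductSpace ℂ E] [FiniteDimensional ℂ E]
  [NormedAddCommGroup F] [InnerProductSpace ℂ F] [FiniteDimensional ℂ F]

theorem sN_congr {Y Z : U →L[ℂ] G} {u : U} (h : Z u = Y u) : sN Z u = sN Y u := by
  ext X; simp [sN, h]

theorem Kc_sN_congr {f : (U →L[ℂ] G) → (E →L[ℂ] F)} {Y Z : U →L[ℂ] G} {u : U}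
    (hY : ‖Y‖ < 1) (hZ : ‖Z‖ < 1)
    (h : Z u = Y u) : Kc f Z (sN Z u) = Kc f Y (sN Y u) := by
  have key : ∀ {Y Z : U →L[ℂ] G}, ‖Y‖ < 1 → ‖Z‖ < 1 → Z u = Y u →
      Kc f Z (sN Z u) ≤ Kc f Y (sN Y u) := by
    intro Y Z hY hZ h w hw X hX
    have h1 := hw X (by rw [sN_congr h]; exact hX)
    have h2 := hw Y ⟨hY, h.symm⟩
    rw [h1, h2]
  exact le_antisymm (key hY hZ h) (key hZ hY h.symm)

/-- minimality of the rank-one space -/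
def MinU (f : (U →L[ℂ] G) → (E →L[ℂ] F)) (Y : U →L[ℂ] G) (u : U) : Prop :=
  ∀ (Y' : U →L[ℂ] G) (u' : U), ‖Y'‖ < 1 → u' ≠ 0 →
    Module.finrank ℂ (Kc f Y (sU Y u)) ≤ Module.finrank ℂ (Kc f Y' (sU Y' u'))

theorem lemA {f : (U →L[ℂ] G) → (E →L[ℂ] F)} (hf : DifferentiableOn ℂ f (ball 0 1))
    (hd : Module.finrank ℂ E < Module.finrank ℂ G)
    {Y : U →L[ℂ] G} {u : U} (hY : ‖Y‖ < 1) (hu : u ≠ 0) (hm : MinU f Y u) :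
    ∃ γ : G →L[ℂ] ℂ, γ ≠ 0 ∧ Kc f Y (sV Y u γ) ≤ Kc f Y (sN Y u) := by
  classical
  let ι := {x : G × (U →L[ℂ] ℂ) // x.2 u = 0 ∧ ‖Y + x.2.smulRight x.1‖ < 1}
  obtain ⟨s, hs, hsI⟩ := finite_iInf (fun i : ι => Kc f Y {Y + i.1.2.smulRight i.1.1})
  let R : (U →L[ℂ] G) → Set (U →L[ℂ] G) := fun Y' => {Z | ∃ i ∈ s, Z = Y' + i.1.2.smulRight i.1.1}
  have hIU : Kc f Y (R Y) = Kc f Y (sU Y u) := by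
    apply le_antisymm
    · intro w hw
      have h1 : w ∈ ⨅ i ∈ s, Kc f Y {Y + i.1.2.smulRight i.1.1} := by
        simp only [Submodule.mem_iInf]
        rintro i hi Z rfl
        exact hw _ ⟨i, hi, rfl⟩
      rw [hsI] at h1
      rintro Z ⟨hZ, a, β, hβ, rfl⟩
      simp only [Submodule.mem_iInf] at h1
      exact h1 ⟨(a, β), hβ, hZ⟩ _ rfl
    · apply Kc_mono
      rintro Z ⟨i, hi, rfl⟩
      exact ⟨i.2.2, i.1.1, i.1.2, i.2.1, rfl⟩
  -- γ
  have hspan : Submodule.span ℂ ((s.image (fun i => i.1.1) : Finset G) : Set G) < ⊤ := by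
    apply lt_top_iff_ne_top.mpr
    intro h
    have h1 := finrank_span_finset_le_card (R := ℂ) (s.image (fun i : ι => i.1.1))
    rw [Set.finrank, h, finrank_top] at h1
    have := Finset.card_image_le (s := s) (f := fun i : ι => i.1.1)
    omega
  obtain ⟨γ0, hγ0, hγk⟩ := Submodule.exists_le_ker_of_lt_top _ hspan
  let γ : G →L[ℂ] ℂ := LinearMap.toContinuousLinearMap γ0
  have hγa : ∀ i ∈ s, γ i.1.1 = 0 := by
    intro i hi
    exact hγk (Submodule.subset_span (Finset.mem_coe.mpr (Finset.mem_image_of_mem _ hi)))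
  have hγne : γ ≠ 0 := by
    intro h; apply hγ0; ext x; exact DFunLike.congr_fun h x
  refine ⟨γ, hγne, ?_⟩
  obtain ⟨g, hg⟩ : ∃ g, γ g = 1 := by
    obtain ⟨g, hg⟩ : ∃ g, γ g ≠ 0 := by
      by_contra! h; exact hγne (by ext x; simp [h x])
    exact ⟨(γ g)⁻¹ • g, by simp [hg]⟩
  have hc : ClosedAt (fun Y' => Kc f Y' (R Y')) Y := by
    refine Kc_closed hf.continuousOn continuousAt_id hY ?_
    rintro Z ⟨i, hi, rfl⟩
    exact ⟨i.2.2, fun Y' => Y' + i.1.2.smulRight i.1.1, by fun_prop, rfl,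
      Eventually.of_forall fun Y' _ => ⟨i, hi, rfl⟩⟩
  have hball : ∀ᶠ Y' in 𝓝 Y, ‖Y'‖ < 1 :=
    (continuous_norm.continuousAt (x := Y)).eventually_lt_const hY
  have hball2 : ∀ᶠ Y' in 𝓝 Y, ∀ i ∈ s, ‖Y' + i.1.2.smulRight i.1.1‖ < 1 := by
    rw [Filter.eventually_all_finset]
    intro i hi
    have hcc : ContinuousAt (fun Y' : U →L[ℂ] G => ‖Y' + i.1.2.smulRight i.1.1‖) Y := by fun_prop
    exact hcc.tendsto.eventually_lt_const i.2.2
  have hgood : ∀ᶠ Y' in 𝓝 Y, ‖Y'‖ < 1 ∧ (∀ i ∈ s, ‖Y' + i.1.2.smulRight i.1.1‖ < 1) ∧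
      Kc f Y' (R Y') = Kc f Y' (sU Y' u) := by
    filter_upwards [hball, hball2, hc.eventually_finrank_le] with Y' h1 h2 h3
    refine ⟨h1, h2, ?_⟩
    have hle : Kc f Y' (sU Y' u) ≤ Kc f Y' (R Y') := by
      apply Kc_mono
      rintro Z ⟨i, hi, rfl⟩
      exact ⟨h2 i hi, i.1.1, i.1.2, i.2.1, rfl⟩
    refine (Submodule.eq_of_le_of_finrank_le hle ?_).symm
    calc _ ≤ _ := h3
      _ = _ := by rw [hIU]
      _ ≤ _ := hm Y' u h1 hu
  intro w hw
  -- near statement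
  have hnear : ∀ᶠ Y'' in 𝓝 Y, Y'' u = Y u → f Y'' w = f Y w := by
    have hcont : ContinuousAt (fun Y'' : U →L[ℂ] G => Y'' - (γ ∘L (Y'' - Y)).smulRight g) Y := by
      have e : (fun Y'' : U →L[ℂ] G => Y'' - (γ ∘L (Y'' - Y)).smulRight g) =
        fun Y'' : U →L[ℂ] G => Y'' - ((ContinuousLinearMap.toSpanSingleton ℂ g) ∘L γ) ∘L (Y'' - Y) := by
        funext Z; ext x; simp [sub_smul]
      rw [e]
      fun_prop
    have hcont' : Tendsto (fun Y'' : U →L[ℂ] G => Y'' - (γ ∘L (Y'' - Y)).smulRight g) (𝓝 Y) (𝓝 Y) := by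
      have := hcont.tendsto
      have e : Y - (γ ∘L (Y - Y)).smulRight g = Y := by ext x; simp
      rwa [e] at this
    filter_upwards [hcont'.eventually hgood, hball] with Y'' h1 h2 hu''
    set Y' := Y'' - (γ ∘L (Y'' - Y)).smulRight g with hY'
    have hY'u : Y' u = Y u := by simp [hY', hu'']
    have hY'γ : ∀ x, γ (Y' x) = γ (Y x) := by intro x; simp [hY', hg]
    have hwY' : f Y' w = f Y w := hw Y' ⟨h1.1, hY'u, hY'γ⟩
    have hwI : w ∈ Kc f Y' (R Y') := by
      rintro Z ⟨i, hi, rfl⟩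
      rw [hwY']
      exact hw _ ⟨h1.2.1 i hi, by simp [hY'u, i.2.1], fun x => by simp [hY'γ, hγa i hi]⟩
    rw [h1.2.2] at hwI
    rw [← hwY']
    refine hwI Y'' ⟨h2, g, γ ∘L (Y'' - Y), by simp [hu''], ?_⟩
    rw [hY']; abel
  rintro Z ⟨hZ, hZu⟩
  refine line_ident (h := fun X => f X w) ?_ hY hZ ?_
  · exact hf.clm_apply (differentiableOn_const w)
  · have : Tendsto (fun s : ℂ => Y + s • (Z - Y)) (𝓝 0) (𝓝 Y) := by
      have : Continuous (fun s : ℂ => Y + s • (Z - Y)) := by fun_prop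
      simpa using this.tendsto 0
    filter_upwards [this.eventually hnear] with s hs
    exact hs (by simp [hZu])

end TypeI

end

section
open Matrix
open scoped ComplexOrder
open Set Filter Topology Metric
set_option linter.unusedSectionVars false
set_option linter.unusedSimpArgs false
set_option linter.style.haveILetI false
set_option linter.unusedVariables false
set_option linter.deprecated false

namespace TypeI

variable {U G E F : Type*}
  [NormedAddCommGroup U] [InnerProductSpace ℂ U] [FiniteDimensional ℂ U]
  [NormedAddCommGroup G] [InnerProductSpace ℂ G] [FiniteDimensional ℂ G]
  [NormedAddCommGroup E] [InnerProductSpace ℂ E] [FiniteDimensional ℂ E]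
  [NormedAddCommGroup F] [InnerProductSpace ℂ F] [FiniteDimensional ℂ F]

theorem ball_ev {V : Type*} [NormedAddCommGroup V] {Y : V} (hY : ‖Y‖ < 1) :
    ∀ᶠ Y' in 𝓝 Y, ‖Y'‖ < 1 :=
  (continuous_norm.tendsto Y).eventually_lt_const hY

theorem ndz {f : (U →L[ℂ] G) → (E →L[ℂ] F)} (hf : DifferentiableOn ℂ f (ball 0 1))
    {Y : U →L[ℂ] G} (hY : ‖Y‖ < 1) {w : E} (hw : ∀ W, fderiv ℂ f Y W w = 0) {Yn : ℕ → U →L[ℂ] G}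
    (hYn : Tendsto Yn atTop (𝓝 Y)) {d : ℕ → E} {ε : ℝ} (hε : 0 < ε)
    (hd : ∀ n, ε * ‖Yn n - Y‖ ≤ ‖d n‖) :
    Tendsto (fun n => (‖d n‖⁻¹ : ℝ) * ‖f (Yn n) w - f Y w‖) atTop (𝓝 0) := by
  have h1 : HasFDerivAt (fun X => f X w) (0 : (U →L[ℂ] G) →L[ℂ] F) Y := by
    have h := (hf.differentiableAt (isOpen_ball.mem_nhds (mem_ball1.mpr hY))).hasFDerivAt
    have h2 := h.clm_apply (hasFDerivAt_const w Y)
    refine h2.congr_fderiv ?_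
    ext W; simp [hw W]
  rw [hasFDerivAt_iff_isLittleO] at h1
  simp only [ContinuousLinearMap.zero_apply, sub_zero] at h1
  rw [Metric.tendsto_nhds]
  intro δ hδ
  rw [Asymptotics.isLittleO_iff] at h1
  have h3 := hYn.eventually (h1 (c := δ * ε / 2) (by positivity))
  filter_upwards [h3] with n hn
  rw [dist_zero_right, Real.norm_of_nonneg (by positivity)]
  by_cases h0 : ‖d n‖ = 0
  · rw [h0]; simpa using hδ
  have hdp : 0 < ‖d n‖ := lt_of_le_of_ne (norm_nonneg _) (Ne.symm h0)
  rw [inv_mul_lt_iff₀ hdp]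
  have := hd n
  nlinarith

theorem nd {f : (U →L[ℂ] G) → (E →L[ℂ] F)} (hf : DifferentiableOn ℂ f (ball 0 1))
    (hN0 : ∀ w, (∀ Z, ‖Z‖ < 1 → f Z w = f 0 w) → w = 0)
    {Y0 : U →L[ℂ] G} {u0 : U} (hY0 : ‖Y0‖ < 1) (hu0 : u0 ≠ 0)
    (hne : Kc f Y0 (sN Y0 u0) ≠ ⊥)
    (hdim : ∀ᶠ Y in 𝓝 Y0, Module.finrank ℂ (Kc f Y (sN Y u0)) =
      Module.finrank ℂ (Kc f Y0 (sN Y0 u0)))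
    {P : (U →L[ℂ] G) → Prop} (hP : ∀ᶠ Y in 𝓝 Y0, P Y) :
    ∃ Y, ‖Y‖ < 1 ∧ P Y ∧ ∃ w ∈ Kc f Y (sN Y u0), ∃ W, fderiv ℂ f Y W w ≠ 0 := by
  by_contra! hcon
  obtain ⟨C, hC⟩ := (Kc f Y0 (sN Y0 u0)).exists_isCompl
  have hcl : ClosedAt (fun Y => Kc f Y (sN Y u0)) Y0 := by
    intro x w w0 hx hw hw0
    exact closed_N hf.continuousOn hY0 hu0 (fun n => (x n, u0)) w w0
      (hx.prodMk_nhds tendsto_const_nhds) hw hw0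
  have hev := (ball_ev hY0).and (hP.and (hdim.and (hcl.eventually_disjoint C hC.inf_eq_bot)))
  obtain ⟨r, hr, hrr⟩ := Metric.eventually_nhds_iff_ball.mp hev
  obtain ⟨w0, hw0, hw00⟩ := Submodule.exists_mem_ne_zero_of_ne_bot hne
  have hdC := Submodule.finrank_add_eq_of_isCompl hC
  have hex : ∀ Y, ∃ w, Y ∈ ball Y0 r → w ∈ Kc f Y (sN Y u0) ∧ w0 - w ∈ C := by
    intro Y
    by_cases hYr : Y ∈ ball Y0 r
    · obtain ⟨h1, -, h3, h4⟩ := hrr Y hYr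
      have h5 : Kc f Y (sN Y u0) ⊔ C = ⊤ := by
        apply Submodule.eq_top_of_finrank_eq
        have := Submodule.finrank_sup_add_finrank_inf_eq (Kc f Y (sN Y u0)) C
        rw [h4, finrank_bot] at this
        omega
      have : w0 ∈ Kc f Y (sN Y u0) ⊔ C := by rw [h5]; trivial
      obtain ⟨a, ha, b, hb, hab⟩ := Submodule.mem_sup.mp this
      exact ⟨a, fun _ => ⟨ha, by rw [← hab]; simpa using hb⟩⟩
    · exact ⟨0, fun h => absurd h hYr⟩
  choose w hw using hex
  have hderiv : ∀ Y ∈ ball Y0 r, HasFDerivAt w (0 : (U →L[ℂ] G) →L[ℂ] E) Y := by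
    intro Y hYr
    rw [hasFDerivAt_iff_isLittleO]
    simp only [ContinuousLinearMap.zero_apply, sub_zero]
    rw [Asymptotics.isLittleO_iff]
    by_contra! hc
    obtain ⟨ε, hε, hfr⟩ := hc
    have hfr2 := hfr.and_eventually (isOpen_ball.mem_nhds hYr)
    obtain ⟨Yn, hYn, hYn2⟩ := exists_seq_forall_of_frequently hfr2
    obtain ⟨hY1, -, h3, h4⟩ := hrr Y hYr
    set d : ℕ → E := fun n => w (Yn n) - w Y with hd
    have hdle : ∀ n, ε * ‖Yn n - Y‖ ≤ ‖d n‖ := fun n => ((hYn2 n).1).le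
    have hd0 : ∀ n, d n ≠ 0 := by
      intro n h
      have := (hYn2 n).1
      rw [show w (Yn n) - w Y = 0 from h, norm_zero] at this
      have h' := norm_nonneg (Yn n - Y)
      nlinarith
    have hdC : ∀ n, d n ∈ C := by
      intro n
      have h1 := (hw (Yn n) (hYn2 n).2).2
      have h2 := (hw Y hYr).2
      have : d n = (w0 - w Y) - (w0 - w (Yn n)) := by simp [hd]
      rw [this]; exact C.sub_mem h2 h1
    haveI : ProperSpace E := FiniteDimensional.proper ℂ E
    set e : ℕ → E := fun n => ((‖d n‖⁻¹ : ℝ) : ℂ) • d n with he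
    have he1 : ∀ n, ‖e n‖ = 1 := fun n => by simp [he, norm_smul, hd0 n]
    obtain ⟨e0, he0, φ, hφ, hlim⟩ := (isCompact_sphere (0:E) 1).tendsto_subseq
      (x := e) (fun n => by simp [he1 n])
    have heC : e0 ∈ C := (Submodule.closed_of_finiteDimensional C).mem_of_tendsto hlim
      (Eventually.of_forall fun n => C.smul_mem _ (hdC _))
    have hYφ : Tendsto (fun n => Yn (φ n)) atTop (𝓝 Y) := hYn.comp hφ.tendsto_atTop
    have key : ∀ Z ∈ ball Y0 r, Z u0 = Y u0 → f Z e0 = f Y e0 := by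
      intro Z hZr hZu
      have hZ1 := (hrr Z hZr).1
      have hZn : Tendsto (fun n => Z + (Yn (φ n) - Y)) atTop (𝓝 Z) := by
        have := (hYφ.sub_const Y).const_add Z
        simpa using this
      have hwY : w Y ∈ Kc f Y (sN Y u0) := (hw Y hYr).1
      have hwZ : w Y ∈ Kc f Z (sN Z u0) := by rw [Kc_sN_congr hY1 hZ1 hZu]; exact hwY
      have q1 := ndz hf hY1 (hcon Y hY1 (hrr Y hYr).2.1 _ hwY) hYφ hε (fun n => hdle (φ n))
      have q2 := ndz hf hZ1 (hcon Z hZ1 (hrr Z hZr).2.1 _ hwZ) hZn (d := fun n => d (φ n)) hε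
        (fun n => by simpa using hdle (φ n))
      have q3 := q2.add q1
      rw [add_zero] at q3
      have q4 : Tendsto (fun n => (f (Z + (Yn (φ n) - Y)) - f (Yn (φ n))) (e (φ n))) atTop (𝓝 0) := by
        refine squeeze_zero_norm' ?_ q3
        filter_upwards [hZn.eventually (ball_ev hZ1)] with n hn
        have hz := (hw (Yn (φ n)) (hYn2 (φ n)).2).1 (Z + (Yn (φ n) - Y)) ⟨hn, by simp [hZu]⟩
        have hzz : f Z (w Y) = f Y (w Y) := hwY Z ⟨hZ1, hZu⟩
        have : (f (Z + (Yn (φ n) - Y)) - f (Yn (φ n))) (e (φ n)) =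
          ((‖d (φ n)‖⁻¹ : ℝ) : ℂ) • ((f (Yn (φ n)) (w Y) - f Y (w Y)) -
            (f (Z + (Yn (φ n) - Y)) (w Y) - f Z (w Y))) := by
          simp only [he, map_smul, ContinuousLinearMap.sub_apply, hd, map_sub, hz, hzz]
          congr 1
          abel
        rw [this, norm_smul, Complex.norm_real, Real.norm_of_nonneg (by positivity), ← mul_add]
        refine mul_le_mul_of_nonneg_left ?_ (by positivity)
        refine (norm_sub_le _ _).trans (le_of_eq ?_)
        ring
      have c1 : Tendsto (fun n => f (Z + (Yn (φ n) - Y))) atTop (𝓝 (f Z)) :=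
        ((hf.continuousOn.continuousAt (isOpen_ball.mem_nhds (mem_ball1.mpr hZ1))).tendsto.comp hZn)
      have c2 : Tendsto (fun n => f (Yn (φ n))) atTop (𝓝 (f Y)) :=
        ((hf.continuousOn.continuousAt (isOpen_ball.mem_nhds (mem_ball1.mpr hY1))).tendsto.comp hYφ)
      have c3 := tendsto_clm (c1.sub c2) hlim
      have := tendsto_nhds_unique c3 q4
      simpa [sub_eq_zero] using this
    have heN : e0 ∈ Kc f Y (sN Y u0) := by
      rintro Z ⟨hZ, hZu⟩
      refine line_ident (h := fun X => f X e0) (hf.clm_apply (differentiableOn_const e0)) hY1 hZ ?_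
      have : Tendsto (fun s : ℂ => Y + s • (Z - Y)) (𝓝 0) (𝓝 Y) := by
        have : Continuous (fun s : ℂ => Y + s • (Z - Y)) := by fun_prop
        simpa using this.tendsto 0
      filter_upwards [this.eventually (isOpen_ball.mem_nhds hYr)] with s hs
      exact key _ hs (by simp [hZu])
    have : e0 ∈ Kc f Y (sN Y u0) ⊓ C := ⟨heN, heC⟩
    rw [h4, Submodule.mem_bot] at this
    simp [this] at he0
  -- w constant
  have hY0r : Y0 ∈ ball Y0 r := mem_ball_self hr
  have hwc : ∀ Y ∈ ball Y0 r, w Y = w Y0 := by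
    intro Y hY
    refine (convex_ball Y0 r).is_const_of_fderivWithin_eq_zero (𝕜 := ℂ) (f := w) ?_ ?_ hY hY0r
    · exact fun X hX => (hderiv X hX).differentiableAt.differentiableWithinAt
    · intro X hX
      rw [fderivWithin_of_isOpen isOpen_ball hX]
      exact (hderiv X hX).fderiv
  have hww : w Y0 = w0 := by
    have h := hw Y0 hY0r
    have : w0 - w Y0 ∈ Kc f Y0 (sN Y0 u0) ⊓ C := ⟨Submodule.sub_mem _ hw0 h.1, h.2⟩
    rw [hC.inf_eq_bot, Submodule.mem_bot, sub_eq_zero] at this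
    exact this.symm
  have hconst : ∀ Y ∈ ball Y0 r, f Y w0 = f Y0 w0 := by
    intro Y hY
    refine (convex_ball Y0 r).is_const_of_fderivWithin_eq_zero (𝕜 := ℂ) (f := fun X => f X w0)
      ?_ ?_ hY hY0r
    · exact (hf.mono fun X hX => mem_ball1.mpr (hrr X hX).1).clm_apply (differentiableOn_const w0)
    · intro X hX
      have hX1 := (hrr X hX).1
      rw [fderivWithin_of_isOpen isOpen_ball hX]
      have h := (hf.differentiableAt (isOpen_ball.mem_nhds (mem_ball1.mpr hX1))).hasFDerivAt
      rw [(h.clm_apply (hasFDerivAt_const w0 X)).fderiv]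
      ext W
      have := hcon X hX1 (hrr X hX).2.1 (w X) (hw X hX).1 W
      rw [hwc X hX, hww] at this
      simp [this]
  apply hw00
  have hall : ∀ Z, ‖Z‖ < 1 → f Z w0 = f Y0 w0 := by
    intro Z hZ
    refine line_ident (h := fun X => f X w0) (hf.clm_apply (differentiableOn_const w0)) hY0 hZ ?_
    have : Tendsto (fun s : ℂ => Y0 + s • (Z - Y0)) (𝓝 0) (𝓝 Y0) := by
      have : Continuous (fun s : ℂ => Y0 + s • (Z - Y0)) := by fun_prop
      simpa using this.tendsto 0
    filter_upwards [this.eventually (isOpen_ball.mem_nhds hY0r)] with s hs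
    exact hconst _ hs
  refine hN0 w0 fun Z hZ => ?_
  rw [hall Z hZ, hall 0 (by simp)]

end TypeI

end

section
open Matrix
open scoped ComplexOrder
open Set Filter Topology Metric
set_option linter.unusedSectionVars false
set_option linter.unusedSimpArgs false
set_option linter.style.haveILetI false
set_option linter.unusedVariables false
set_option linter.deprecated false

namespace TypeI

variable {U G E F : Type*}
  [NormedAddCommGroup U] [InnerProductSpace ℂ U] [FiniteDimensional ℂ U]
  [NormedAddCommGroup G] [InnerProductSpace ℂ G] [FiniteDimensional ℂ G]
  [NormedAddCommGroup E] [InnerProductSpace ℂ E] [FiniteDimensional ℂ E]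
  [NormedAddCommGroup F] [InnerProductSpace ℂ F] [FiniteDimensional ℂ F]

/-- the operator `T` -/
noncomputable def Top (D : (U →L[ℂ] G) →L[ℂ] (E →L[ℂ] F)) (a : G) (c : F →L[ℂ] ℂ) : E →ₗ[ℂ] U where
  toFun w := ∑ i, c (D (ro a (stdOrthonormalBasis ℂ U i)) w) • stdOrthonormalBasis ℂ U i
  map_add' x y := by simp [add_smul, Finset.sum_add_distrib]
  map_smul' r x := by simp [Finset.smul_sum, smul_smul]

theorem sum_ro (β : U →L[ℂ] ℂ) (a : G) :
    β.smulRight a = ∑ i, β (stdOrthonormalBasis ℂ U i) • ro a (stdOrthonormalBasis ℂ U i) := by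
  ext x
  simp only [ContinuousLinearMap.smulRight_apply, ContinuousLinearMap.sum_apply,
    ContinuousLinearMap.smul_apply, ro_apply]
  conv_lhs => rw [← (stdOrthonormalBasis ℂ U).sum_repr x]
  simp only [map_sum, map_smul, smul_eq_mul, OrthonormalBasis.repr_apply_apply, Finset.sum_smul,
    smul_smul]
  exact Finset.sum_congr rfl fun i _ => by rw [mul_comm]

theorem sum_ro2 (W : U →L[ℂ] G) :
    W = ∑ i, ro (W (stdOrthonormalBasis ℂ U i)) (stdOrthonormalBasis ℂ U i) := by
  ext x
  simp only [ContinuousLinearMap.sum_apply, ro_apply]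
  conv_lhs => rw [← (stdOrthonormalBasis ℂ U).sum_repr x]
  simp only [map_sum, map_smul, OrthonormalBasis.repr_apply_apply]

theorem top_spec (D : (U →L[ℂ] G) →L[ℂ] (E →L[ℂ] F)) (a : G) (c : F →L[ℂ] ℂ) (β : U →L[ℂ] ℂ)
    (w : E) : β (Top D a c w) = c (D (β.smulRight a) w) := by
  rw [sum_ro β a]
  simp only [Top, LinearMap.coe_mk, AddHom.coe_mk, map_sum, map_smul,
    ContinuousLinearMap.sum_apply, ContinuousLinearMap.smul_apply, smul_eq_mul]
  exact Finset.sum_congr rfl fun i _ => mul_comm _ _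

theorem top_zero_iff {D : (U →L[ℂ] G) →L[ℂ] (E →L[ℂ] F)} {a : G} {c : F →L[ℂ] ℂ} {w : E} :
    Top D a c w = 0 ↔ ∀ β : U →L[ℂ] ℂ, c (D (β.smulRight a) w) = 0 := by
  constructor
  · intro h β; rw [← top_spec, h, map_zero]
  · intro h
    by_contra hne
    obtain ⟨β, hβ⟩ := exists_one hne
    rw [top_spec, h] at hβ
    exact zero_ne_one hβ

theorem mem_span_of_dual {u x : U} (h : ∀ β : U →L[ℂ] ℂ, β u = 0 → β x = 0) : ∃ c : ℂ, x = c • u := by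
  have : x ∈ (ℂ ∙ u) := by
    rw [← Submodule.orthogonal_orthogonal (ℂ ∙ u), Submodule.mem_orthogonal]
    intro y hy
    have := h (innerSL ℂ y) (by
      have := (Submodule.mem_orthogonal _ _).mp hy u (Submodule.mem_span_singleton_self u)
      rw [innerSL_apply_apply, ← inner_conj_symm, this, map_zero])
    simpa using this
  obtain ⟨c, hc⟩ := Submodule.mem_span_singleton.mp this
  exact ⟨c, hc.symm⟩

theorem fderiv_line {f : (U →L[ℂ] G) → (E →L[ℂ] F)} (hf : DifferentiableOn ℂ f (ball 0 1))
    {Y W : U →L[ℂ] G} (hY : ‖Y‖ < 1) (w : E) :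
    HasDerivAt (fun s : ℂ => f (Y + s • W) w) (fderiv ℂ f Y W w) 0 := by
  have h := (hf.differentiableAt (isOpen_ball.mem_nhds (mem_ball1.mpr hY))).hasFDerivAt
  have h1 : HasFDerivAt f (fderiv ℂ f Y) (Y + (0:ℂ) • W) := by simpa using h
  have h2 : HasDerivAt (fun s : ℂ => Y + s • W) W 0 := by
    simpa using ((hasDerivAt_id (0:ℂ)).smul_const W).const_add Y
  have h3 := h1.comp_hasDerivAt (0:ℂ) h2
  have := h3.clm_apply (hasDerivAt_const (0:ℂ) w)
  simpa using this

theorem tendsto_line {V : Type*} [NormedAddCommGroup V] [NormedSpace ℂ V] (Y W : V) :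
    Tendsto (fun s : ℂ => Y + s • W) (𝓝 0) (𝓝 Y) := by
  have : Continuous (fun s : ℂ => Y + s • W) := by fun_prop
  simpa using this.tendsto 0

theorem fderiv_N {f : (U →L[ℂ] G) → (E →L[ℂ] F)} (hf : DifferentiableOn ℂ f (ball 0 1))
    {Y W : U →L[ℂ] G} (hY : ‖Y‖ < 1) {u : U} (hW : W u = 0) {w : E} (hw : w ∈ Kc f Y (sN Y u)) :
    fderiv ℂ f Y W w = 0 := by
  have h1 := fderiv_line hf (W := W) hY w
  have h2 : (fun s : ℂ => f (Y + s • W) w) =ᶠ[𝓝 0] fun _ => f Y w := by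
    filter_upwards [(tendsto_line Y W).eventually (ball_ev hY)] with s hs
    exact hw _ ⟨hs, by simp [hW]⟩
  have h3 := (hasDerivAt_const (0:ℂ) (f Y w)).congr_of_eventuallyEq h2
  exact h1.unique h3

theorem top_N {f : (U →L[ℂ] G) → (E →L[ℂ] F)} (hf : DifferentiableOn ℂ f (ball 0 1))
    {Y : U →L[ℂ] G} (hY : ‖Y‖ < 1) {u : U} {w : E} (hw : w ∈ Kc f Y (sN Y u)) (a : G)
    (c : F →L[ℂ] ℂ) : ∃ r : ℂ, Top (fderiv ℂ f Y) a c w = r • u := by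
  refine mem_span_of_dual fun β hβ => ?_
  rw [top_spec, fderiv_N hf hY (by simp [hβ]) hw, map_zero]

theorem closed_kT {f : (U →L[ℂ] G) → (E →L[ℂ] F)} (hf : DifferentiableOn ℂ f (ball 0 1))
    {Y : U →L[ℂ] G} (hY : ‖Y‖ < 1) (a : G) (c : F →L[ℂ] ℂ) :
    ClosedAt (fun x : (U →L[ℂ] G) × G => LinearMap.ker (Top (fderiv ℂ f x.1) x.2 c)) (Y, a) := by
  intro x w w0 hx hw hw0
  simp only [LinearMap.mem_ker, top_zero_iff] at hw ⊢
  intro β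
  have h1 : Tendsto (fun n => fderiv ℂ f (x n).1) atTop (𝓝 (fderiv ℂ f Y)) :=
    ((fderiv_cont isOpen_ball hf).continuousAt (isOpen_ball.mem_nhds (mem_ball1.mpr hY))).tendsto.comp
      ((continuous_fst.tendsto _).comp hx)
  have h2 : Tendsto (fun n => β.smulRight (x n).2) atTop (𝓝 (β.smulRight a)) := by
    have e : (fun n => β.smulRight (x n).2) =
      fun n => ContinuousLinearMap.smulRightL ℂ U G β (x n).2 := rfl
    rw [e]
    exact ((ContinuousLinearMap.continuous _).tendsto a).comp ((continuous_snd.tendsto _).comp hx)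
  have h3 := (c.continuous.tendsto _).comp (tendsto_clm (tendsto_clm h1 h2) hw0)
  refine tendsto_nhds_unique h3 ?_
  have : (c ∘ fun n => (fderiv ℂ f (x n).1 (β.smulRight (x n).2)) (w n)) = fun _ => 0 := by
    funext n; exact hw n β
  rw [this]; exact tendsto_const_nhds

theorem exists_min_nat {α : Type*} (S : Set α) (hS : S.Nonempty) (m : α → ℕ) :
    ∃ x ∈ S, ∀ y ∈ S, m x ≤ m y := by
  obtain ⟨x, hx, h⟩ := WellFounded.has_min (InvImage.wf m Nat.lt_wfRel.wf) S hS
  exact ⟨x, hx, fun y hy => not_lt.mp (h y hy)⟩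

theorem stage1a {f : (U →L[ℂ] G) → (E →L[ℂ] F)} (hG : GM f) [Nontrivial U]
    (hN0 : ∀ w, (∀ Z, ‖Z‖ < 1 → f Z w = f 0 w) → w = 0)
    (hd : Module.finrank ℂ E < Module.finrank ℂ G) :
    ∃ (Y1 : U →L[ℂ] G) (u1 : U) (a0 : G) (c : F →L[ℂ] ℂ), ‖Y1‖ < 1 ∧ u1 ≠ 0 ∧
      ∀ᶠ x : (U →L[ℂ] G) × U × G in 𝓝 (Y1, u1, a0), ‖x.1‖ < 1 ∧ x.2.1 ≠ 0 ∧
        (∃ w ∈ Kc f x.1 (sN x.1 x.2.1), Top (fderiv ℂ f x.1) x.2.2 c w = x.2.1) ∧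
        (∃ γ : G →L[ℂ] ℂ, γ ≠ 0 ∧ Kc f x.1 (sV x.1 x.2.1 γ) ≤ Kc f x.1 (sN x.1 x.2.1)) := by
  have hf := hG.diff
  obtain ⟨uu, huu⟩ := exists_ne (0:U)
  let S1 : Set ((U →L[ℂ] G) × U) := {x | ‖x.1‖ < 1 ∧ x.2 ≠ 0}
  have hS1 : ∀ x ∈ S1, ∀ᶠ y in 𝓝 x, y ∈ S1 := by
    rintro ⟨Y, u⟩ ⟨h1, h2⟩
    exact ((continuous_fst.tendsto (Y, u)).eventually (ball_ev h1)).and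
      ((continuous_snd.tendsto (Y, u)).eventually_ne h2)
  obtain ⟨x, hx, hxm⟩ := exists_min_nat S1 ⟨(0, uu), by simp [S1, huu]⟩
    (fun x => Module.finrank ℂ (Kc f x.1 (sU x.1 x.2)))
  let S2 : Set ((U →L[ℂ] G) × U) := {x | x ∈ S1 ∧ MinU f x.1 x.2}
  obtain ⟨⟨Y0, u0⟩, ⟨⟨hY0, hu0⟩, hm0⟩, hxm2⟩ := exists_min_nat S2
    ⟨x, hx, fun Y' u' h1 h2 => hxm (Y', u') ⟨h1, h2⟩⟩
    (fun x => Module.finrank ℂ (Kc f x.1 (sN x.1 x.2)))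
  simp only at hY0 hu0 hm0 hxm2
  set n := Module.finrank ℂ (Kc f Y0 (sN Y0 u0)) with hn
  have hgood : ∀ᶠ y : (U →L[ℂ] G) × U in 𝓝 (Y0, u0), y ∈ S2 ∧
      Module.finrank ℂ (Kc f y.1 (sN y.1 y.2)) = n := by
    filter_upwards [hS1 (Y0, u0) ⟨hY0, hu0⟩, (closed_U hf.continuousOn hY0 hu0).eventually_finrank_le,
      (closed_N hf.continuousOn hY0 hu0).eventually_finrank_le] with y h1 h2 h3
    have hy2 : y ∈ S2 := ⟨h1, fun Y' u' h4 h5 => h2.trans (hm0 Y' u' h4 h5)⟩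
    exact ⟨hy2, le_antisymm h3 (hxm2 y hy2)⟩
  have hlem : ∀ y ∈ S2, ∃ γ : G →L[ℂ] ℂ, γ ≠ 0 ∧ Kc f y.1 (sV y.1 y.2 γ) ≤ Kc f y.1 (sN y.1 y.2) :=
    fun y hy => lemA hf hd hy.1.1 hy.1.2 hy.2
  have hne : Kc f Y0 (sN Y0 u0) ≠ ⊥ := by
    obtain ⟨γ, hγ, hle⟩ := hlem (Y0, u0) ⟨⟨hY0, hu0⟩, hm0⟩
    intro h
    exact V_ne_bot hG hY0 hu0 hγ (le_bot_iff.mp (h ▸ hle))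
  have hline : Tendsto (fun Y : U →L[ℂ] G => (Y, u0)) (𝓝 Y0) (𝓝 (Y0, u0)) :=
    tendsto_id.prodMk_nhds tendsto_const_nhds
  obtain ⟨Y1, hY1, hP, w1, hw1, W, hW⟩ := nd hf hN0 hY0 hu0 hne
    ((hline.eventually hgood).mono fun Y h => h.2)
    (P := fun Y => ∀ᶠ y : (U →L[ℂ] G) × U in 𝓝 (Y, u0), y ∈ S2 ∧
      Module.finrank ℂ (Kc f y.1 (sN y.1 y.2)) = n)
    (hline.eventually hgood.eventually_nhds)
  -- rank one direction
  obtain ⟨a0, β0, hab⟩ : ∃ (a : G) (β : U →L[ℂ] ℂ), fderiv ℂ f Y1 (β.smulRight a) w1 ≠ 0 := by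
    by_contra! hcon
    apply hW
    rw [sum_ro2 W, map_sum, ContinuousLinearMap.sum_apply]
    exact Finset.sum_eq_zero fun i _ => hcon _ _
  obtain ⟨c, hc⟩ := exists_one hab
  have hTw1 : Top (fderiv ℂ f Y1) a0 c w1 ≠ 0 := by
    intro h
    rw [top_zero_iff] at h
    rw [h β0] at hc
    exact zero_ne_one hc
  refine ⟨Y1, u0, a0, c, hY1, hu0, ?_⟩
  have hcl : ClosedAt (fun x : (U →L[ℂ] G) × U × G => Kc f x.1 (sN x.1 x.2.1) ⊓
      LinearMap.ker (Top (fderiv ℂ f x.1) x.2.2 c)) (Y1, u0, a0) := by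
    apply ClosedAt.inf
    · intro x w w0 hx hw hw0
      exact closed_N hf.continuousOn hY1 hu0 (fun n => ((x n).1, (x n).2.1)) w w0
        (((continuous_fst.prodMk (continuous_fst.comp continuous_snd)).tendsto _).comp hx) hw hw0
    · intro x w w0 hx hw hw0
      exact closed_kT hf hY1 a0 c (fun n => ((x n).1, (x n).2.2)) w w0
        (((continuous_fst.prodMk (continuous_snd.comp continuous_snd)).tendsto _).comp hx) hw hw0
  have hP1 := hP.self_of_nhds
  have hlt : Module.finrank ℂ (Kc f Y1 (sN Y1 u0) ⊓
      LinearMap.ker (Top (fderiv ℂ f Y1) a0 c) : Submodule ℂ E) < n := by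
    rw [← hP1.2]
    apply Submodule.finrank_lt_finrank_of_lt
    refine lt_of_le_of_ne inf_le_left fun h => hTw1 ?_
    have : w1 ∈ Kc f Y1 (sN Y1 u0) ⊓ LinearMap.ker (Top (fderiv ℂ f Y1) a0 c) := by
      rw [h]; exact hw1
    exact this.2
  have hproj : Tendsto (fun x : (U →L[ℂ] G) × U × G => (x.1, x.2.1)) (𝓝 (Y1, u0, a0))
      (𝓝 (Y1, u0)) := (continuous_fst.prodMk (continuous_fst.comp continuous_snd)).tendsto _
  filter_upwards [hcl.eventually_finrank_le, hproj.eventually hP] with x h1 h2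
  refine ⟨h2.1.1.1, h2.1.1.2, ?_, hlem _ h2.1⟩
  obtain ⟨w, hw, hwT⟩ : ∃ w ∈ Kc f x.1 (sN x.1 x.2.1),
      w ∉ LinearMap.ker (Top (fderiv ℂ f x.1) x.2.2 c) := by
    by_contra! hcon
    have : Kc f x.1 (sN x.1 x.2.1) ⊓ LinearMap.ker (Top (fderiv ℂ f x.1) x.2.2 c) =
      Kc f x.1 (sN x.1 x.2.1) := inf_eq_left.mpr hcon
    rw [this] at h1
    have := h2.2
    omega
  obtain ⟨r, hr⟩ := top_N hf h2.1.1.1 hw x.2.2 c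
  have hr0 : r ≠ 0 := by
    rintro rfl
    exact hwT (by simpa using hr)
  refine ⟨r⁻¹ • w, Submodule.smul_mem _ _ hw, ?_⟩
  rw [map_smul, hr, smul_smul, inv_mul_cancel₀ hr0, one_smul]

end TypeI

end

section
open Matrix
open scoped ComplexOrder
open Set Filter Topology Metric
set_option linter.unusedSectionVars false
set_option linter.unusedSimpArgs false
set_option linter.style.haveILetI false
set_option linter.unusedVariables false
set_option linter.deprecated false

namespace TypeI

variable {U G E F : Type*}
  [NormedAddCommGroup U] [InnerProductSpace ℂ U] [FiniteDimensional ℂ U]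
  [NormedAddCommGroup G] [InnerProductSpace ℂ G] [FiniteDimensional ℂ G]
  [NormedAddCommGroup E] [InnerProductSpace ℂ E] [FiniteDimensional ℂ E]
  [NormedAddCommGroup F] [InnerProductSpace ℂ F] [FiniteDimensional ℂ F]

theorem basis_in_open {V : Type*} [NormedAddCommGroup V] [NormedSpace ℂ V] [FiniteDimensional ℂ V]
    {O : Set V} (hO : IsOpen O) (hne : O.Nonempty) :
    ∃ b : Module.Basis (Fin (Module.finrank ℂ V)) ℂ V, ∀ i, b i ∈ O := by
  obtain ⟨b, hb, hspan, hli⟩ := exists_linearIndependent ℂ O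
  have htop : Submodule.span ℂ O = ⊤ := by
    apply Submodule.eq_top_of_nonempty_interior'
    obtain ⟨x, hx⟩ := hne
    exact ⟨x, interior_maximal Submodule.subset_span hO hx⟩
  rw [htop] at hspan
  let B : Module.Basis b ℂ V := Module.Basis.mk hli (by rw [Subtype.range_coe, hspan])
  haveI : Fintype b := FiniteDimensional.fintypeBasisIndex B
  have hc : Fintype.card b = Module.finrank ℂ V := (Module.finrank_eq_card_basis B).symm
  refine ⟨B.reindex (Fintype.equivFinOfCardEq hc), fun i => ?_⟩
  rw [Module.Basis.reindex_apply]
  have : B ((Fintype.equivFinOfCardEq hc).symm i) = ((Fintype.equivFinOfCardEq hc).symm i : V) := by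
    simp [B]
  rw [this]
  exact hb (Subtype.mem _)

/-- rank-one perturbations -/
def sF (Y : U →L[ℂ] G) : Set (U →L[ℂ] G) :=
  {Z | ‖Z‖ < 1 ∧ ∃ (a : G) (β : U →L[ℂ] ℂ), Z = Y + β.smulRight a}

theorem closed_F {f : (U →L[ℂ] G) → (E →L[ℂ] F)} (hf : ContinuousOn f (ball 0 1))
    {Y : U →L[ℂ] G} (hY : ‖Y‖ < 1) :
    ClosedAt (fun x : (U →L[ℂ] G) => Kc f x (sF x)) Y := by
  refine Kc_closed hf continuousAt_id hY ?_
  rintro Z ⟨hZ, a, β, rfl⟩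
  exact ⟨hZ, fun x => x + β.smulRight a, by fun_prop, rfl,
    Eventually.of_forall fun x hx => ⟨hx, a, β, rfl⟩⟩

theorem range_top_of_open {V W : Type*} [AddCommGroup V] [Module ℂ V] [NormedAddCommGroup W]
    [NormedSpace ℂ W] (T : V →ₗ[ℂ] W) {O : Set W} (hO : IsOpen O) (hne : O.Nonempty)
    (h : ∀ u ∈ O, ∃ w, T w = u) : LinearMap.range T = ⊤ := by
  apply Submodule.eq_top_of_nonempty_interior'
  obtain ⟨x, hx⟩ := hne
  exact ⟨x, interior_maximal (fun u hu => h u hu) hO hx⟩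

theorem F_ker {f : (U →L[ℂ] G) → (E →L[ℂ] F)} (hf : DifferentiableOn ℂ f (ball 0 1))
    {Y : U →L[ℂ] G} (hY : ‖Y‖ < 1) {a : G} {c : F →L[ℂ] ℂ} {w : E} {v : F}
    (h : ∀ β : U →L[ℂ] ℂ, ‖Y + β.smulRight a‖ < 1 → f (Y + β.smulRight a) w = v) :
    Top (fderiv ℂ f Y) a c w = 0 := by
  rw [top_zero_iff]
  intro β
  have h1 := fderiv_line hf (W := β.smulRight a) hY w
  have h2 : (fun s : ℂ => f (Y + s • β.smulRight a) w) =ᶠ[𝓝 0] fun _ => v := by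
    filter_upwards [(tendsto_line Y (β.smulRight a)).eventually (ball_ev hY)] with s hs
    have e : s • β.smulRight a = (s • β).smulRight a := by ext x; simp [smul_smul]
    rw [e] at hs ⊢
    exact h _ hs
  have h3 := (hasDerivAt_const (0:ℂ) v).congr_of_eventuallyEq h2
  rw [h1.unique h3, map_zero]

theorem existsQ {f : (U →L[ℂ] G) → (E →L[ℂ] F)} (hf : DifferentiableOn ℂ f (ball 0 1))
    (hN0 : ∀ w, (∀ Z, ‖Z‖ < 1 → f Z w = f 0 w) → w = 0)
    {Y1 : U →L[ℂ] G} {a0 : G} {c : F →L[ℂ] ℂ} {r : ℝ} (hr : 0 < r)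
    (hO : ∀ Y ∈ ball Y1 r, ‖Y‖ < 1)
    (hT : ∀ Y ∈ ball Y1 r, ∀ a ∈ ball a0 r,
      Module.finrank ℂ (LinearMap.ker (Top (fderiv ℂ f Y) a c)) ≤ 1) :
    ∃ Y ∈ ball Y1 r, LinearMap.ker (Top (fderiv ℂ f Y) a0 c) ⊓ Kc f Y (sF Y) = ⊥ := by
  classical
  by_contra! hcon
  have ha0 : a0 ∈ ball a0 r := mem_ball_self hr
  have hY1 : Y1 ∈ ball Y1 r := mem_ball_self hr
  -- ker ≤ Fix
  have hle : ∀ Y ∈ ball Y1 r, LinearMap.ker (Top (fderiv ℂ f Y) a0 c) ≤ Kc f Y (sF Y) := by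
    intro Y hY
    have h1 := hT Y hY a0 ha0
    have h2 : 0 < Module.finrank ℂ
        (LinearMap.ker (Top (fderiv ℂ f Y) a0 c) ⊓ Kc f Y (sF Y) : Submodule ℂ E) :=
      Nat.pos_of_ne_zero fun h => hcon Y hY (Submodule.finrank_eq_zero.mp h)
    have h3 := Submodule.eq_of_le_of_finrank_le
      (inf_le_left : LinearMap.ker (Top (fderiv ℂ f Y) a0 c) ⊓ Kc f Y (sF Y) ≤ _) (by omega)
    exact inf_eq_left.mp h3
  have hkeq : ∀ Y ∈ ball Y1 r, ∀ a ∈ ball a0 r, LinearMap.ker (Top (fderiv ℂ f Y) a c) ≤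
      LinearMap.ker (Top (fderiv ℂ f Y) a0 c) := by
    intro Y hY a ha
    have h1 : LinearMap.ker (Top (fderiv ℂ f Y) a0 c) ≤ LinearMap.ker (Top (fderiv ℂ f Y) a c) := by
      intro w hw
      exact F_ker hf (hO Y hY) (v := f Y w) fun β hβ => hle Y hY hw _ ⟨hβ, a, β, rfl⟩
    have h2 : 0 < Module.finrank ℂ (LinearMap.ker (Top (fderiv ℂ f Y) a0 c)) := by
      apply Nat.pos_of_ne_zero
      intro h
      apply hcon Y hY
      rw [Submodule.finrank_eq_zero.mp h, bot_inf_eq]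
    exact (Submodule.eq_of_le_of_finrank_le h1 ((hT Y hY a ha).trans h2)).ge
  obtain ⟨ε0, hε, hε0⟩ := Submodule.exists_mem_ne_zero_of_ne_bot (hcon Y1 hY1)
  obtain ⟨b, hb⟩ := basis_in_open (isOpen_ball (x := a0) (ε := r)) ⟨a0, ha0⟩
  let B : Fin (Module.finrank ℂ G) → (G →L[ℂ] ℂ) := fun i => LinearMap.toContinuousLinearMap (b.coord i)
  let L : Finset (Fin (Module.finrank ℂ G)) → (U →L[ℂ] G) → (U →L[ℂ] G) :=
    fun s W => ∑ i ∈ s, ((ContinuousLinearMap.toSpanSingleton ℂ (b i)) ∘L (B i)) ∘L W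
  have hL : ∀ s, Tendsto (fun W => Y1 + L s W) (𝓝 0) (𝓝 Y1) := by
    intro s
    have : Continuous (fun W => Y1 + L s W) := by
      refine continuous_const.add (continuous_finset_sum _ fun i _ => ?_)
      fun_prop
    have h := this.tendsto 0
    simpa [L] using h
  have hLuniv : ∀ W, L Finset.univ W = W := by
    intro W
    ext x
    simp only [L, ContinuousLinearMap.sum_apply]
    conv_rhs => rw [← b.sum_repr (W x)]
    exact Finset.sum_congr rfl fun i _ => by simp [B]
  have hind : ∀ s : Finset (Fin (Module.finrank ℂ G)), ∀ᶠ W in 𝓝 (0 : U →L[ℂ] G),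
      ε0 ∈ LinearMap.ker (Top (fderiv ℂ f (Y1 + L s W)) a0 c) ∧ f (Y1 + L s W) ε0 = f Y1 ε0 := by
    intro s
    induction s using Finset.induction_on with
    | empty =>
      refine Eventually.of_forall fun W => ?_
      simp only [L, Finset.sum_empty, add_zero, and_true]
      exact hε.1
    | insert i s hi ih =>
      filter_upwards [ih, (hL s).eventually (isOpen_ball.mem_nhds hY1),
        (hL (insert i s)).eventually (isOpen_ball.mem_nhds hY1)] with W h1 h2 h3
      set Y := Y1 + L s W with hYd
      have e : Y1 + L (insert i s) W = Y + ((B i) ∘L W).smulRight (b i) := by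
        simp only [L, Finset.sum_insert hi, hYd]
        rw [add_comm (_ ∘L W), ← add_assoc]
        congr 1
      rw [e] at h3 ⊢
      have hF := hle Y h2 h1.1
      refine ⟨?_, ?_⟩
      · apply hkeq _ h3 _ (hb i)
        refine F_ker hf (hO _ h3) (v := f Y ε0) fun β hβ => ?_
        have e2 : Y + ((B i) ∘L W).smulRight (b i) + β.smulRight (b i) =
          Y + ((B i) ∘L W + β).smulRight (b i) := by ext x; simp [add_smul, add_assoc]
        rw [e2] at hβ ⊢
        exact hF _ ⟨hβ, b i, _, rfl⟩
      · rw [← h1.2]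
        exact hF _ ⟨hO _ h3, b i, _, rfl⟩
  have hfin := hind Finset.univ
  simp only [hLuniv] at hfin
  have hY1n := hO Y1 hY1
  have hall : ∀ Z, ‖Z‖ < 1 → f Z ε0 = f Y1 ε0 := by
    intro Z hZ
    refine line_ident (h := fun X => f X ε0) (hf.clm_apply (differentiableOn_const ε0)) hY1n hZ ?_
    have ht : Tendsto (fun s : ℂ => s • (Z - Y1)) (𝓝 0) (𝓝 0) := by
      simpa using tendsto_line (0 : U →L[ℂ] G) (Z - Y1)
    exact (ht.eventually hfin).mono fun s hs => hs.2
  exact hε0 (hN0 ε0 fun Z hZ => by rw [hall Z hZ, hall 0 (by simp)])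

end TypeI

end

section
open Matrix
open scoped ComplexOrder
open Set Filter Topology Metric
set_option linter.unusedSectionVars false
set_option linter.unusedSimpArgs false
set_option linter.style.haveILetI false
set_option linter.unusedVariables false
set_option linter.deprecated false

namespace TypeI

variable {U G E F : Type*}
  [NormedAddCommGroup U] [InnerProductSpace ℂ U] [FiniteDimensional ℂ U]
  [NormedAddCommGroup G] [InnerProductSpace ℂ G] [FiniteDimensional ℂ G]
  [NormedAddCommGroup E] [InnerProductSpace ℂ E] [FiniteDimensional ℂ E]
  [NormedAddCommGroup F] [InnerProductSpace ℂ F] [FiniteDimensional ℂ F]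

theorem N_all {f : (U →L[ℂ] G) → (E →L[ℂ] F)} (hf : DifferentiableOn ℂ f (ball 0 1))
    {Y : U →L[ℂ] G} (hY : ‖Y‖ < 1) (A : U →ₗ[ℂ] E) {us : U}
    (hA : ∀ᶠ u in 𝓝 us, A u ∈ Kc f Y (sN Y u)) (u : U) : A u ∈ Kc f Y (sN Y u) := by
  by_cases hu : u = 0
  · rw [hu, map_zero]; exact Submodule.zero_mem _
  obtain ⟨ξ, hξ⟩ := exists_one hu
  rintro Z ⟨hZ, hZu⟩
  set W := Z - Y with hW
  have hWu : W u = 0 := by simp [hW, hZu]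
  let us' : ℂ → U := fun s => us + s • (u - us)
  let Ws : ℂ → (U →L[ℂ] G) := fun s => (ξ (us' s)) • W - (ContinuousLinearMap.smulRightL ℂ U G ξ) (W (us' s))
  have hWs0 : ∀ s, Ws s (us' s) = 0 := by
    intro s
    have : (ContinuousLinearMap.smulRightL ℂ U G ξ) (W (us' s)) (us' s) = ξ (us' s) • W (us' s) := rfl
    simp [Ws, this]
  have hus1 : us' 1 = u := by simp [us']
  have hWs1 : Ws 1 = W := by simp [Ws, hus1, hξ, hWu]
  have dus : Differentiable ℂ us' := by intro s; fun_prop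
  have dWs : Differentiable ℂ Ws := by
    refine Differentiable.sub ?_ ?_
    · exact (ξ.differentiable.comp dus).smul_const W
    · exact (ContinuousLinearMap.differentiable _).comp (W.differentiable.comp dus)
  have Alin : A = (LinearMap.toContinuousLinearMap A : U →L[ℂ] E) := rfl
  set A' : U →L[ℂ] E := LinearMap.toContinuousLinearMap A with hA'
  obtain ⟨B, hB⟩ := (isCompact_closedBall (0:ℂ) 2).exists_bound_of_continuousOn
    dWs.continuous.continuousOn
  have hsmall : ∀ᶠ κ in 𝓝 (0:ℂ), ∀ s ∈ ball (0:ℂ) 2, ‖Y + κ • Ws s‖ < 1 := by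
    have ht : Tendsto (fun κ : ℂ => ‖Y‖ + ‖κ‖ * B) (𝓝 0) (𝓝 ‖Y‖) := by
      have : Continuous (fun κ : ℂ => ‖Y‖ + ‖κ‖ * B) := by fun_prop
      simpa using this.tendsto 0
    filter_upwards [ht.eventually_lt_const hY] with κ hκ s hs
    refine lt_of_le_of_lt ((norm_add_le _ _).trans ?_) hκ
    rw [norm_smul]
    gcongr
    exact hB s (ball_subset_closedBall hs)
  refine line_ident (h := fun X => f X (A u)) (hf.clm_apply (differentiableOn_const _)) hY hZ ?_
  filter_upwards [hsmall] with κ hκ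
  have hd1 : DifferentiableOn ℂ (fun s => f (Y + κ • Ws s) (A' (us' s)) - f Y (A' (us' s))) (ball 0 2) := by
    have hm : MapsTo (fun s => Y + κ • Ws s) (ball (0:ℂ) 2) (ball 0 1) := fun s hs =>
      mem_ball1.mpr (hκ s hs)
    have h1 := hf.comp (f := fun s => Y + κ • Ws s)
      ((dWs.const_smul κ).const_add Y).differentiableOn hm
    have h2 : DifferentiableOn ℂ (fun s => A' (us' s)) (ball (0:ℂ) 2) :=
      (A'.differentiable.comp dus).differentiableOn
    refine (h1.clm_apply h2).sub ?_
    exact ((f Y).differentiable.comp (A'.differentiable.comp dus)).differentiableOn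
  have hz := ident_line (h := fun s => f (Y + κ • Ws s) (A' (us' s)) - f Y (A' (us' s)))
    isOpen_ball (convex_ball (0:ℂ) 2) (mem_ball_self (by norm_num)) hd1 ?_ 1 (by simp)
  · simp only [hus1, hWs1] at hz
    exact sub_eq_zero.mp hz
  · have ht : Tendsto us' (𝓝 0) (𝓝 us) := tendsto_line us (u - us)
    filter_upwards [ht.eventually hA, ball_mem_nhds (0:ℂ) (by norm_num : (0:ℝ) < 2)] with s hs hs2
    exact sub_eq_zero.mpr (hs _ ⟨hκ s hs2, by simp [hWs0 s]⟩)

/-- good functionals -/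
def Good (f : (U →L[ℂ] G) → (E →L[ℂ] F)) (Y : U →L[ℂ] G) (ε : E) (β : U →L[ℂ] ℂ) : Prop :=
  ∃ a : G, ‖Y + β.smulRight a‖ < 1 ∧ f (Y + β.smulRight a) ε ≠ f Y ε

theorem Good.smul {f : (U →L[ℂ] G) → (E →L[ℂ] F)} {Y : U →L[ℂ] G} {ε : E} {β : U →L[ℂ] ℂ}
    (h : Good f Y ε β) {t : ℂ} (ht : t ≠ 0) : Good f Y ε (t • β) := by
  obtain ⟨a, h1, h2⟩ := h
  have e : (t • β).smulRight (t⁻¹ • a) = β.smulRight a := by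
    ext x; simp [smul_smul, ht, mul_assoc, mul_comm, mul_left_comm]
  exact ⟨t⁻¹ • a, by rwa [e], by rwa [e]⟩

theorem continuous_smulRight (a : G) : Continuous (fun β : U →L[ℂ] ℂ => β.smulRight a) := by
  have e : (fun β : U →L[ℂ] ℂ => β.smulRight a) =
    fun β : U →L[ℂ] ℂ => (ContinuousLinearMap.toSpanSingleton ℂ a) ∘L β := by
    funext β; ext x; simp
  rw [e]; fun_prop

theorem Good.eventually {f : (U →L[ℂ] G) → (E →L[ℂ] F)} (hf : DifferentiableOn ℂ f (ball 0 1))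
    {Y : U →L[ℂ] G} {ε : E} {β : U →L[ℂ] ℂ}
    (h : Good f Y ε β) : ∀ᶠ β' in 𝓝 β, Good f Y ε β' := by
  obtain ⟨a, h1, h2⟩ := h
  have hc : Tendsto (fun β' : U →L[ℂ] ℂ => Y + β'.smulRight a) (𝓝 β) (𝓝 (Y + β.smulRight a)) :=
    (continuous_const.add (continuous_smulRight a)).tendsto _
  have hc2 : ContinuousAt f (Y + β.smulRight a) :=
    hf.continuousOn.continuousAt (isOpen_ball.mem_nhds (mem_ball1.mpr h1))
  have hc3 : Tendsto (fun β' : U →L[ℂ] ℂ => f (Y + β'.smulRight a) ε) (𝓝 β)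
      (𝓝 (f (Y + β.smulRight a) ε)) :=
    tendsto_clm (f := fun β' : U →L[ℂ] ℂ => f (Y + β'.smulRight a)) (hc2.tendsto.comp hc)
      tendsto_const_nhds
  filter_upwards [hc.eventually (ball_ev h1), hc3.eventually_ne h2] with β' h3 h4
  exact ⟨a, h3, h4⟩

theorem Good.frequently {f : (U →L[ℂ] G) → (E →L[ℂ] F)} (hf : DifferentiableOn ℂ f (ball 0 1))
    {Y : U →L[ℂ] G} (hY : ‖Y‖ < 1) {ε : E} {βb : U →L[ℂ] ℂ}
    (h : Good f Y ε βb) (β0 : U →L[ℂ] ℂ) : ∃ᶠ s in 𝓝 (0:ℂ), Good f Y ε (β0 + s • βb) := by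
  intro hcon
  obtain ⟨a, h1, h2⟩ := h
  apply h2
  have ht : Tendsto (fun t : ℝ => Y + ((t:ℂ)) • β0.smulRight a) (𝓝 0) (𝓝 Y) := by
    have : Continuous (fun t : ℝ => Y + ((t:ℂ)) • β0.smulRight a) := by fun_prop
    simpa using this.tendsto 0
  have h3 : ∀ᶠ t : ℝ in 𝓝[>] (0:ℝ), ‖Y + ((t:ℂ)) • β0.smulRight a‖ < 1 :=
    (ht.eventually (ball_ev hY)).filter_mono nhdsWithin_le_nhds
  obtain ⟨t, ht1, ht0⟩ := (h3.and self_mem_nhdsWithin).exists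
  have ht0' : (t:ℂ) ≠ 0 := by
    have : (0:ℝ) < t := ht0
    exact_mod_cast this.ne'
  refine line_ident (h := fun X => f X ε) (hf.clm_apply (differentiableOn_const _)) ht1 h1 ?_
  have hs : Tendsto (fun s : ℂ => s / ((1 - s) * t)) (𝓝 0) (𝓝 0) := by
    have : ContinuousAt (fun s : ℂ => s / ((1 - s) * t)) 0 := by
      refine ContinuousAt.div (by fun_prop) (by fun_prop) (by simpa using ht0')
    simpa using this.tendsto
  have hs1 : ∀ᶠ s in 𝓝 (0:ℂ), (1:ℂ) - s ≠ 0 := by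
    have : ContinuousAt (fun s : ℂ => 1 - s) 0 := by fun_prop
    exact this.eventually_ne (by simp)
  have hl := tendsto_line (Y + ((t:ℂ)) • β0.smulRight a)
    (Y + βb.smulRight a - (Y + ((t:ℂ)) • β0.smulRight a))
  filter_upwards [hs.eventually hcon, hs1, hl.eventually (ball_ev ht1)] with s h5 h6 h7
  by_contra hne
  apply h5
  have e : Y + ((t:ℂ)) • β0.smulRight a + s • (Y + βb.smulRight a - (Y + ((t:ℂ)) • β0.smulRight a))
    = Y + (((1 - s) * t) • (β0 + (s / ((1 - s) * t)) • βb)).smulRight a := by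
    ext x
    have e1 : (1 - s) * ↑t * (s / ((1 - s) * ↑t)) = s := by field_simp
    simp only [ContinuousLinearMap.add_apply, ContinuousLinearMap.smul_apply,
      ContinuousLinearMap.smulRight_apply, ContinuousLinearMap.sub_apply, smul_eq_mul, mul_add,
      ← mul_assoc, e1]
    module
  rw [e] at hne h7
  have g : Good f Y ε (((1 - s) * t) • (β0 + (s / ((1 - s) * t)) • βb)) := ⟨a, h7, hne⟩
  have hne0 : ((1 - s) * (t:ℂ)) ≠ 0 := mul_ne_zero h6 ht0'
  have := g.smul (inv_ne_zero hne0)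
  rwa [smul_smul, inv_mul_cancel₀ hne0, one_smul] at this

/-- linear structure on the kernel of a good functional -/
theorem Good.lin {f : (U →L[ℂ] G) → (E →L[ℂ] F)} (hf : DifferentiableOn ℂ f (ball 0 1))
    {Y : U →L[ℂ] G} (hY : ‖Y‖ < 1) {ε : E} {β : U →L[ℂ] ℂ} (h : Good f Y ε β)
    (T : E →ₗ[ℂ] U) (hT : LinearMap.range T = ⊤)
    (hker : ∀ w, T w = 0 → ∃ r : ℂ, w = r • ε) (hε : T ε = 0) :
    ∃ A : U →ₗ[ℂ] E, (∀ u, T (A u) = u) ∧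
      ∀ u w, β u = 0 → w ∈ Kc f Y (sN Y u) → w = A (T w) := by
  obtain ⟨a, h1, h2⟩ := h
  obtain ⟨S, hS⟩ := T.exists_rightInverse_of_surjective hT
  have hS' : ∀ u, T (S u) = u := fun u => DFunLike.congr_fun hS u
  set W := β.smulRight a with hW
  -- nonzero derivative
  obtain ⟨s, hs1, hs2⟩ : ∃ s : ℂ, ‖Y + s • W‖ < 1 ∧ fderiv ℂ f (Y + s • W) W ε ≠ 0 := by
    by_contra! hcon
    apply h2
    set l : ℂ → (U →L[ℂ] G) := fun s => Y + s • W with hl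
    have hlc : Continuous l := by fun_prop
    have hopen : IsOpen (l ⁻¹' ball 0 1) := isOpen_ball.preimage hlc
    have hconv : Convex ℝ (l ⁻¹' ball 0 1) := by
      intro x hx y hy p q hp hq hpq
      have : l (p • x + q • y) = p • l x + q • l y := by
        simp only [hl, smul_add]
        have e1 : p • (x • W) = ((p • x : ℂ)) • W := by rw [smul_assoc]
        have e2 : q • (y • W) = ((q • y : ℂ)) • W := by rw [smul_assoc]
        rw [e1, e2, add_smul]
        have : Y = p • Y + q • Y := by rw [← add_smul, hpq, one_smul]
        nth_rewrite 1 [this]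
        abel
      show l _ ∈ ball _ _
      rw [this]
      exact convex_ball _ 1 hx hy hp hq hpq
    have hder : ∀ s ∈ l ⁻¹' ball 0 1, HasDerivAt (fun s => f (l s) ε) 0 s := by
      intro s hs
      have hs' : ‖Y + s • W‖ < 1 := mem_ball1.mp hs
      have q := fderiv_line hf (W := W) hs' ε
      rw [hcon s hs'] at q
      have e : (fun t => f (l t) ε) = (fun t => f (Y + s • W + t • W) ε) ∘ fun t => t - s := by
        funext t; simp only [hl, Function.comp]
        congr 2; module
      rw [e]
      have q2 : HasDerivAt (fun t : ℂ => t - s) 1 s := (hasDerivAt_id s).sub_const s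
      have q' : HasDerivAt (fun t => f (Y + s • W + t • W) ε) 0 (s - s) := by simpa using q
      have := HasDerivAt.scomp (h := fun t : ℂ => t - s) s q' q2
      simpa using this
    have := hconv.is_const_of_fderivWithin_eq_zero (𝕜 := ℂ) (f := fun s => f (l s) ε)
      (x := 1) (y := 0)
      (fun s hs => (hder s hs).differentiableAt.differentiableWithinAt) (by
        intro s hs
        rw [fderivWithin_of_isOpen hopen hs]
        ext; simpa using (hder s hs).deriv) (by simpa [hl] using h1) (by simpa [hl] using hY)
    simpa [hl] using this
  obtain ⟨c', hc'⟩ := exists_one hs2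
  set Ys := Y + s • W with hYs
  let ℓ : E →L[ℂ] ℂ := c' ∘L (fderiv ℂ f Ys W)
  have hℓ : ℓ ε = 1 := hc'
  refine ⟨S - (ℓ.toLinearMap ∘ₗ S).smulRight ε, fun u => by simp [hS', hε], ?_⟩
  intro u w hu hw
  have hWu : W u = 0 := by simp [hW, hu]
  have hwℓ : ℓ w = 0 := by
    have : w ∈ Kc f Ys (sN Ys u) := by
      rw [Kc_sN_congr hY hs1 (by simp [hYs, hWu])]; exact hw
    simp [ℓ, fderiv_N hf hs1 hWu this]
  obtain ⟨r, hr⟩ := hker (w - S (T w)) (by rw [map_sub, hS', sub_self])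
  have hw2 : w = S (T w) + r • ε := by rw [← hr]; abel
  have : ℓ (S (T w)) + r = 0 := by
    have h3 := hwℓ
    rw [hw2, map_add, map_smul, hℓ] at h3
    simpa [hS', hε] using h3
  have hr2 : r = - ℓ (S (T w)) := by linear_combination this
  conv_lhs => rw [hw2, hr2]
  simp [sub_eq_add_neg]

end TypeI

end

section
open Matrix
open scoped ComplexOrder
open Set Filter Topology Metric
set_option linter.unusedSectionVars false
set_option linter.unusedSimpArgs false
set_option linter.style.haveILetI false
set_option linter.unusedVariables false
set_option linter.deprecated false

namespace TypeI

variable {U G E F : Type*}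
  [NormedAddCommGroup U] [InnerProductSpace ℂ U] [FiniteDimensional ℂ U]
  [NormedAddCommGroup G] [InnerProductSpace ℂ G] [FiniteDimensional ℂ G]
  [NormedAddCommGroup E] [InnerProductSpace ℂ E] [FiniteDimensional ℂ E]
  [NormedAddCommGroup F] [InnerProductSpace ℂ F] [FiniteDimensional ℂ F]


theorem exists_sep {u x : U} (hu : u ≠ 0) (hx : ∀ c : ℂ, x ≠ c • u) :
    ∃ β : U →L[ℂ] ℂ, β u = 0 ∧ β x = 1 := by
  by_contra! hcon
  obtain ⟨c, hc⟩ := mem_span_of_dual (u := u) (x := x) (by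
    intro β hβ
    by_contra hne
    refine hcon ((β x)⁻¹ • β) (by simp [hβ]) (by simp [hne]))
  exact hx c hc

theorem exists_indep_ker (h3 : 3 ≤ Module.finrank ℂ U) (β : U →L[ℂ] ℂ) (u : U) :
    ∃ x : U, β x = 0 ∧ ∀ c : ℂ, x ≠ c • u := by
  by_contra! hcon
  have h1 : LinearMap.ker β.toLinearMap ≤ (ℂ ∙ u) := by
    intro x hx
    obtain ⟨c, hc⟩ := hcon x hx
    rw [hc]; exact Submodule.smul_mem _ _ (Submodule.mem_span_singleton_self u)
  have h2 := Submodule.finrank_mono h1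
  have h4 := LinearMap.finrank_range_add_finrank_ker β.toLinearMap
  have h5 : Module.finrank ℂ (LinearMap.range β.toLinearMap) ≤ 1 := by
    simpa using Submodule.finrank_le (LinearMap.range β.toLinearMap)
  have h6 : Module.finrank ℂ (ℂ ∙ u) ≤ 1 := finrank_span_le_card ({u} : Set U) |>.trans (by simp)
  omega

/-- patching of partially linear maps -/
theorem patch (h3 : 3 ≤ Module.finrank ℂ U) (P : (U →L[ℂ] ℂ) → Prop) (βb : U →L[ℂ] ℂ)
    (hopen : ∀ β, P β → ∀ᶠ β' in 𝓝 β, P β')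
    (hfreq : ∀ β0 : U →L[ℂ] ℂ, ∃ᶠ s in 𝓝 (0:ℂ), P (β0 + s • βb))
    {O : Set U} (hO : IsOpen O) (hne : O.Nonempty) (h0 : (0:U) ∉ O) (w : U → E)
    (hw : ∀ β, P β → ∃ A : U →ₗ[ℂ] E, ∀ u ∈ O, β u = 0 → w u = A u) :
    ∃ (A : U →ₗ[ℂ] E) (u0 : U) (β0 : U →L[ℂ] ℂ), u0 ∈ O ∧ P β0 ∧ β0 u0 = 0 ∧
      ∀ᶠ u in 𝓝 u0, w u = A u := by
  obtain ⟨ut, hut⟩ := hne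
  have hut0 : ut ≠ 0 := fun h => h0 (h ▸ hut)
  obtain ⟨e, -, he⟩ := exists_indep_ker h3 0 ut
  obtain ⟨β0', hβ0u, hβ0e⟩ := exists_sep hut0 he
  -- first perturbation
  obtain ⟨β0, u0', hP0, hu0', hβu, hβe⟩ : ∃ (β0 : U →L[ℂ] ℂ) (u0' : U), P β0 ∧ u0' ∈ O ∧
      β0 u0' = 0 ∧ β0 e ≠ 0 := by
    have c1 : ContinuousAt (fun s : ℂ => (β0' + s • βb) e) 0 := by
      simp only [ContinuousLinearMap.add_apply, ContinuousLinearMap.smul_apply]; fun_prop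
    have c0 : ContinuousAt (fun s : ℂ => (β0' + s • βb) ut) 0 := by
      simp only [ContinuousLinearMap.add_apply, ContinuousLinearMap.smul_apply]; fun_prop
    have c2 : ContinuousAt (fun s : ℂ => ut - ((β0' + s • βb) ut / (β0' + s • βb) e) • e) 0 :=
      continuousAt_const.sub ((c0.div c1 (by simp [hβ0e])).smul continuousAt_const)
    have ev1 : ∀ᶠ s in 𝓝 (0:ℂ), (β0' + s • βb) e ≠ 0 := c1.eventually_ne (by simp [hβ0e])
    have ev2 : ∀ᶠ s in 𝓝 (0:ℂ), ut - ((β0' + s • βb) ut / (β0' + s • βb) e) • e ∈ O :=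
      c2.eventually (hO.mem_nhds (by simpa [hβ0u] using hut))
    obtain ⟨s, hs, hs1, hs2⟩ := ((hfreq β0').and_eventually (ev1.and ev2)).exists
    refine ⟨_, _, hs, hs2, ?_, hs1⟩
    rw [map_sub, map_smul, smul_eq_mul, div_mul_cancel₀ _ hs1, sub_self]
  have hu0'0 : u0' ≠ 0 := fun h => h0 (h ▸ hu0')
  obtain ⟨x', hx'0, hx'⟩ := exists_indep_ker h3 β0 u0'
  obtain ⟨β1', hβ1u, hβ1x⟩ := exists_sep hu0'0 hx'
  obtain ⟨β1, u0, hP1, hu0, hβ0u0, hβ1u0, hβ1x'⟩ : ∃ (β1 : U →L[ℂ] ℂ) (u0 : U), P β1 ∧ u0 ∈ O ∧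
      β0 u0 = 0 ∧ β1 u0 = 0 ∧ β1 x' ≠ 0 := by
    have c1 : ContinuousAt (fun s : ℂ => (β1' + s • βb) x') 0 := by
      simp only [ContinuousLinearMap.add_apply, ContinuousLinearMap.smul_apply]; fun_prop
    have c0 : ContinuousAt (fun s : ℂ => (β1' + s • βb) u0') 0 := by
      simp only [ContinuousLinearMap.add_apply, ContinuousLinearMap.smul_apply]; fun_prop
    have c2 : ContinuousAt (fun s : ℂ => u0' - ((β1' + s • βb) u0' / (β1' + s • βb) x') • x') 0 :=
      continuousAt_const.sub ((c0.div c1 (by simp [hβ1x])).smul continuousAt_const)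
    have ev1 : ∀ᶠ s in 𝓝 (0:ℂ), (β1' + s • βb) x' ≠ 0 := c1.eventually_ne (by simp [hβ1x])
    have ev2 : ∀ᶠ s in 𝓝 (0:ℂ), u0' - ((β1' + s • βb) u0' / (β1' + s • βb) x') • x' ∈ O :=
      c2.eventually (hO.mem_nhds (by simpa [hβ1u] using hu0'))
    obtain ⟨s, hs, hs1, hs2⟩ := ((hfreq β1').and_eventually (ev1.and ev2)).exists
    refine ⟨_, _, hs, hs2, ?_, ?_, hs1⟩
    · rw [map_sub, map_smul, hβu, hx'0]; simp
    · rw [map_sub, map_smul, smul_eq_mul, div_mul_cancel₀ _ hs1, sub_self]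
  have hu00 : u0 ≠ 0 := fun h => h0 (h ▸ hu0)
  set x := e - (β1 e / β1 x') • x' with hx
  have hβ1x0 : β1 x = 0 := by
    rw [hx, map_sub, map_smul, smul_eq_mul, div_mul_cancel₀ _ hβ1x', sub_self]
  have hβ0x : β0 x ≠ 0 := by rw [hx, map_sub, map_smul, hx'0]; simpa using hβe
  obtain ⟨us, hus, hβ1us, hβ0us⟩ : ∃ us ∈ O, β1 us = 0 ∧ β0 us ≠ 0 := by
    have ev : ∀ᶠ τ in 𝓝[≠] (0:ℂ), u0 + τ • x ∈ O :=
      ((tendsto_line u0 x).eventually (hO.mem_nhds hu0)).filter_mono nhdsWithin_le_nhds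
    obtain ⟨τ, h1, h2⟩ := (ev.and self_mem_nhdsWithin).exists
    refine ⟨_, h1, by simp [hβ1u0, hβ1x0], ?_⟩
    have : τ ≠ 0 := h2
    simp [hβ0u0, this, hβ0x]
  obtain ⟨A0, hA0⟩ := hw β0 hP0
  set A : U →ₗ[ℂ] E := A0 + (β0.toLinearMap).smulRight ((β0 us)⁻¹ • (w us - A0 us)) with hA
  have hAus : A us = w us := by simp [hA, smul_smul, hβ0us]
  have hAk : ∀ z, β0 z = 0 → A z = A0 z := by intro z hz; simp [hA, hz]
  obtain ⟨ξ, hξ0, hξs⟩ : ∃ ξ : U →L[ℂ] ℂ, ξ u0 = 1 ∧ ξ us = 0 := by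
    obtain ⟨ξ', h⟩ := exists_one hu00
    refine ⟨ξ' - (ξ' us / β0 us) • β0, by simp [h, hβ0u0], by simp [hβ0us]⟩
  refine ⟨A, u0, β0, hu0, hP0, hβ0u0, ?_⟩
  let z : U → U := fun u => u - (β0 u / β0 us) • us
  have cz : Continuous z := by fun_prop
  have hz0 : z u0 = u0 := by simp [z, hβ0u0]
  have evz : ∀ᶠ u in 𝓝 u0, z u ∈ O := cz.continuousAt.eventually (hO.mem_nhds (by rwa [hz0]))
  have evξ : ∀ᶠ u in 𝓝 u0, ξ (z u) ≠ 0 :=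
    (ξ.continuous.comp cz).continuousAt.eventually_ne (by simp [hz0, hξ0])
  let β : U → (U →L[ℂ] ℂ) := fun u => β1 - (β1 (z u) / ξ (z u)) • ξ
  have cβ : ContinuousAt β u0 := by
    have q : ContinuousAt (fun u => β1 (z u) / ξ (z u)) u0 :=
      ((β1.continuous.comp cz).continuousAt).div ((ξ.continuous.comp cz).continuousAt)
        (by simp [hz0, hξ0])
    have q2 : ContinuousAt (fun u => (β1 (z u) / ξ (z u)) • ξ) u0 :=
      ContinuousAt.smul q continuousAt_const
    exact continuousAt_const.sub q2
  have hβ0' : β u0 = β1 := by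
    have : β u0 = β1 - (β1 (z u0) / ξ (z u0)) • ξ := rfl
    rw [this, hz0, hβ1u0, zero_div, zero_smul ℂ ξ, sub_zero]
  have evβ : ∀ᶠ u in 𝓝 u0, P (β u) := cβ.eventually (by rw [hβ0']; exact hopen β1 hP1)
  filter_upwards [evz, evξ, evβ, hO.mem_nhds hu0] with u h1 h2 h4 h5
  obtain ⟨B, hB⟩ := hw _ h4
  have k1 : β u (z u) = 0 := by simp [β, h2]
  have k2 : β u us = 0 := by simp [β, hβ1us, hξs]
  have k4 : β0 (z u) = 0 := by simp [z, hβ0us]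
  have hu : u = z u + (β0 u / β0 us) • us := by simp [z]
  have k3 : β u u = 0 := by
    have : β u (z u + (β0 u / β0 us) • us) = 0 := by rw [map_add, map_smul, k1, k2]; simp
    rwa [← hu] at this
  rw [hB u h5 k3]
  conv_lhs => rw [hu, map_add, map_smul, ← hB _ h1 k1, ← hB _ hus k2, hA0 _ h1 k4, ← hAk _ k4,
    ← hAus, ← map_smul, ← map_add, ← hu]

/-- linear selection at a single point -/
theorem lin_sel (h3 : 3 ≤ Module.finrank ℂ U) {f : (U →L[ℂ] G) → (E →L[ℂ] F)}
    (hf : DifferentiableOn ℂ f (ball 0 1)) {Y : U →L[ℂ] G} (hY : ‖Y‖ < 1)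
    {a0 : G} {c : F →L[ℂ] ℂ} {T : E →ₗ[ℂ] U} (hTdef : T = Top (fderiv ℂ f Y) a0 c)
    {O : Set U} (hO : IsOpen O) (hne : O.Nonempty) (h0 : (0:U) ∉ O)
    (hw : ∀ u ∈ O, ∃ w ∈ Kc f Y (sN Y u), T w = u)
    (hk : Module.finrank ℂ (LinearMap.ker T) ≤ 1)
    (hF : LinearMap.ker T ⊓ Kc f Y (sF Y) = ⊥) :
    ∃ A : U →ₗ[ℂ] E, (∀ u, T (A u) = u) ∧ (∀ u, A u ∈ Kc f Y (sN Y u)) ∧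
      ∃ u0 ∈ O, ∀ w ∈ Kc f Y (sN Y u0), ∃ r : ℂ, w = r • A u0 := by
  have hT : LinearMap.range T = ⊤ :=
    range_top_of_open T hO hne (fun u hu => let ⟨w, _, h⟩ := hw u hu; ⟨w, h⟩)
  have hN : ∀ u w, w ∈ Kc f Y (sN Y u) → ∃ r : ℂ, T w = r • u := fun u w h => by
    rw [hTdef]; exact top_N hf hY h a0 c
  choose! w hwN hwT using hw
  have fin : ∀ (A : U →ₗ[ℂ] E) (us : U), us ∈ O → (∀ᶠ u in 𝓝 us, w u = A u) →
      (∀ u, T (A u) = u) ∧ (∀ u, A u ∈ Kc f Y (sN Y u)) := by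
    intro A us hus hA
    constructor
    · have ho : {u | T (A u) = u} ∈ 𝓝 us := by
        filter_upwards [hA, hO.mem_nhds hus] with u h1 h2
        show T (A u) = u
        rw [← h1, hwT u h2]
      have ht : LinearMap.eqLocus (T ∘ₗ A) LinearMap.id = ⊤ := by
        apply Submodule.eq_top_of_nonempty_interior'
        exact ⟨us, mem_interior_iff_mem_nhds.mpr ho⟩
      intro u
      have : u ∈ LinearMap.eqLocus (T ∘ₗ A) LinearMap.id := by rw [ht]; trivial
      exact this
    · refine N_all hf hY A (us := us) ?_
      filter_upwards [hA, hO.mem_nhds hus] with u h1 h2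
      rw [← h1]; exact hwN u h2
  by_cases hker : LinearMap.ker T = ⊥
  · have hinj := LinearMap.ker_eq_bot.mp hker
    obtain ⟨S, hS⟩ := T.exists_rightInverse_of_surjective hT
    have hS' : ∀ u, T (S u) = u := fun u => DFunLike.congr_fun hS u
    obtain ⟨us, hus⟩ := hne
    obtain ⟨h1, h2⟩ := fin S us hus (by
      filter_upwards [hO.mem_nhds hus] with u hu
      exact hinj (by rw [hwT u hu, hS']))
    refine ⟨S, h1, h2, us, hus, fun y hy => ?_⟩
    obtain ⟨r, hr⟩ := hN us y hy
    exact ⟨r, hinj (by rw [hr, map_smul, hS'])⟩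
  · obtain ⟨ε, hε, hε0⟩ := Submodule.exists_mem_ne_zero_of_ne_bot hker
    have hε' : T ε = 0 := hε
    have hkε : ∀ y, T y = 0 → ∃ r : ℂ, y = r • ε := by
      intro y hy
      have h1 : Module.finrank ℂ (LinearMap.ker T) = 1 := by
        have : Module.finrank ℂ (LinearMap.ker T) ≠ 0 := fun h => hker (Submodule.finrank_eq_zero.mp h)
        omega
      obtain ⟨r, hr⟩ := (finrank_eq_one_iff_of_nonzero' (⟨ε, hε⟩ : LinearMap.ker T)
        (by simpa using hε0)).mp h1 ⟨y, hy⟩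
      exact ⟨r, by simpa using (congrArg Subtype.val hr).symm⟩
    obtain ⟨βb, hβb⟩ : ∃ βb, Good f Y ε βb := by
      by_contra! hcon
      apply hε0
      have : ε ∈ LinearMap.ker T ⊓ Kc f Y (sF Y) := by
        refine ⟨hε, ?_⟩
        rintro Z ⟨hZ, a, β, rfl⟩
        by_contra hne
        exact hcon β ⟨a, hZ, hne⟩
      rw [hF] at this; exact this
    obtain ⟨A, u0, β0, hu0, hP0, hβu, hev⟩ := patch h3 (Good f Y ε) βb (fun β h => h.eventually hf)
      (fun β0 => hβb.frequently hf hY β0) hO hne h0 w (by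
        intro β hβ
        obtain ⟨A, hA1, hA2⟩ := hβ.lin hf hY T hT hkε hε'
        exact ⟨A, fun u hu h => by rw [hA2 u (w u) h (hwN u hu), hwT u hu]⟩)
    obtain ⟨h1, h2⟩ := fin A u0 hu0 hev
    refine ⟨A, h1, h2, u0, hu0, fun y hy => ?_⟩
    obtain ⟨B, hB1, hB2⟩ := hP0.lin hf hY T hT hkε hε'
    obtain ⟨r, hr⟩ := hN u0 y hy
    refine ⟨r, ?_⟩
    rw [hB2 u0 y hβu hy, hr, hB2 u0 (A u0) hβu (h2 u0), h1, map_smul]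

end TypeI

end

section
open Matrix
open scoped ComplexOrder
open Set Filter Topology Metric
set_option linter.unusedSectionVars false
set_option linter.unusedSimpArgs false
set_option linter.style.haveILetI false
set_option linter.unusedVariables false
set_option linter.deprecated false

namespace TypeI

variable {U G E F : Type*}
  [NormedAddCommGroup U] [InnerProductSpace ℂ U] [FiniteDimensional ℂ U]
  [NormedAddCommGroup G] [InnerProductSpace ℂ G] [FiniteDimensional ℂ G]
  [NormedAddCommGroup E] [InnerProductSpace ℂ E] [FiniteDimensional ℂ E]
  [NormedAddCommGroup F] [InnerProductSpace ℂ F] [FiniteDimensional ℂ F]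


theorem stage1b {f : (U →L[ℂ] G) → (E →L[ℂ] F)} (hG : GM f)
    (h3 : 3 ≤ Module.finrank ℂ U) (hEU : Module.finrank ℂ E ≤ Module.finrank ℂ U + 1)
    (hN0 : ∀ w, (∀ Z, ‖Z‖ < 1 → f Z w = f 0 w) → w = 0)
    (hd : Module.finrank ℂ E < Module.finrank ℂ G) :
    ∃ (Y2 : U →L[ℂ] G) (u2 : U) (r : ℝ), 0 < r ∧ ‖Y2‖ < 1 ∧ u2 ≠ 0 ∧
      (∀ Y ∈ ball Y2 r, ‖Y‖ < 1 ∧ ∃ A : U →ₗ[ℂ] E, Function.Injective A ∧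
        (∀ u, A u ∈ Kc f Y (sN Y u)) ∧
        ∀ u ∈ ball u2 r, u ≠ 0 ∧ ∀ w ∈ Kc f Y (sN Y u), ∃ c : ℂ, w = c • A u) ∧
      (∃ γ : G →L[ℂ] ℂ, γ ≠ 0 ∧ Kc f Y2 (sV Y2 u2 γ) ≤ Kc f Y2 (sN Y2 u2)) := by
  haveI : Nontrivial U := Module.nontrivial_of_finrank_pos (R := ℂ) (by omega)
  have hf := hG.diff
  obtain ⟨Y1, u1, a0, c, hY1, hu1, hev⟩ := stage1a hG hN0 hd
  obtain ⟨r, hr, hball⟩ := Metric.eventually_nhds_iff_ball.mp hev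
  have hgood : ∀ Y ∈ ball Y1 r, ∀ u ∈ ball u1 r, ∀ a ∈ ball a0 r, ‖Y‖ < 1 ∧ u ≠ 0 ∧
        (∃ w ∈ Kc f Y (sN Y u), Top (fderiv ℂ f Y) a c w = u) ∧
        (∃ γ : G →L[ℂ] ℂ, γ ≠ 0 ∧ Kc f Y (sV Y u γ) ≤ Kc f Y (sN Y u)) := by
    intro Y hY u hu a ha
    exact hball (Y, u, a) (by
      simp only [mem_ball, Prod.dist_eq, max_lt_iff] at *
      exact ⟨hY, hu, ha⟩)
  have hu1m : u1 ∈ ball u1 r := mem_ball_self hr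
  have ha0m : a0 ∈ ball a0 r := mem_ball_self hr
  have hO0 : (0:U) ∉ ball u1 r := fun h => (hgood Y1 (mem_ball_self hr) 0 h a0 ha0m).2.1 rfl
  have hker : ∀ Y ∈ ball Y1 r, ∀ a ∈ ball a0 r,
      Module.finrank ℂ (LinearMap.ker (Top (fderiv ℂ f Y) a c)) ≤ 1 := by
    intro Y hY a ha
    have h1 := range_top_of_open (Top (fderiv ℂ f Y) a c) (isOpen_ball (x := u1) (ε := r))
      ⟨u1, hu1m⟩ (fun u hu => let ⟨w, _, h⟩ := (hgood Y hY u hu a ha).2.2.1; ⟨w, h⟩)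
    have h2 := LinearMap.finrank_range_add_finrank_ker (Top (fderiv ℂ f Y) a c)
    rw [h1, finrank_top] at h2
    omega
  obtain ⟨Y2, hY2, hF⟩ := existsQ hf hN0 hr
    (fun Y hY => (hgood Y hY u1 hu1m a0 ha0m).1) hker
  have hY2n : ‖Y2‖ < 1 := (hgood Y2 hY2 u1 hu1m a0 ha0m).1
  have sel : ∀ Y ∈ ball Y1 r, LinearMap.ker (Top (fderiv ℂ f Y) a0 c) ⊓ Kc f Y (sF Y) = ⊥ →
    ∃ A : U →ₗ[ℂ] E, (∀ u, Top (fderiv ℂ f Y) a0 c (A u) = u) ∧ (∀ u, A u ∈ Kc f Y (sN Y u)) ∧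
      ∃ u0 ∈ ball u1 r, ∀ w ∈ Kc f Y (sN Y u0), ∃ r : ℂ, w = r • A u0 := by
    intro Y hY hFY
    exact lin_sel h3 hf (hgood Y hY u1 hu1m a0 ha0m).1 rfl isOpen_ball ⟨u1, hu1m⟩ hO0
      (fun u hu => (hgood Y hY u hu a0 ha0m).2.2.1) (hker Y hY a0 ha0m) hFY
  obtain ⟨A2, -, hA2N, u2, hu2, hA2⟩ := sel Y2 hY2 hF
  have hu20 : u2 ≠ 0 := fun h => hO0 (h ▸ hu2)
  have hfin : Module.finrank ℂ (Kc f Y2 (sN Y2 u2)) ≤ 1 := by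
    have : Kc f Y2 (sN Y2 u2) ≤ (ℂ ∙ (A2 u2)) := by
      intro w hw
      obtain ⟨r, hr⟩ := hA2 w hw
      rw [hr]; exact Submodule.smul_mem _ _ (Submodule.mem_span_singleton_self _)
    exact (Submodule.finrank_mono this).trans ((finrank_span_le_card _).trans (by simp))
  have ev1 : ∀ᶠ x : (U →L[ℂ] G) × U in 𝓝 (Y2, u2),
      Module.finrank ℂ (Kc f x.1 (sN x.1 x.2)) ≤ 1 := by
    filter_upwards [(closed_N hf.continuousOn hY2n hu20).eventually_finrank_le] with x hx
    exact hx.trans hfin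
  have cl : ClosedAt (fun Y : U →L[ℂ] G =>
      LinearMap.ker (Top (fderiv ℂ f Y) a0 c) ⊓ Kc f Y (sF Y)) Y2 := by
    refine ClosedAt.inf ?_ (closed_F hf.continuousOn hY2n)
    intro x w w0 hx hw hw0
    exact closed_kT hf hY2n a0 c (fun n => (x n, a0)) w w0 (hx.prodMk_nhds tendsto_const_nhds) hw hw0
  have ev2 : ∀ᶠ Y in 𝓝 Y2, LinearMap.ker (Top (fderiv ℂ f Y) a0 c) ⊓ Kc f Y (sF Y) = ⊥ := by
    filter_upwards [cl.eventually_disjoint ⊤ (by rw [hF]; simp)] with Y hY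
    simpa using hY
  have ev3 : ∀ᶠ x : (U →L[ℂ] G) × U in 𝓝 (Y2, u2),
      Module.finrank ℂ (Kc f x.1 (sN x.1 x.2)) ≤ 1 ∧
      LinearMap.ker (Top (fderiv ℂ f x.1) a0 c) ⊓ Kc f x.1 (sF x.1) = ⊥ ∧
      x.1 ∈ ball Y1 r ∧ x.2 ∈ ball u1 r := by
    filter_upwards [ev1, (continuous_fst.tendsto (Y2, u2)).eventually ev2,
      (continuous_fst.tendsto (Y2, u2)).eventually (isOpen_ball.mem_nhds hY2),
      (continuous_snd.tendsto (Y2, u2)).eventually (isOpen_ball.mem_nhds hu2)] with x a b c d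
    exact ⟨a, b, c, d⟩
  obtain ⟨ρ, hρ, hball2⟩ := Metric.eventually_nhds_iff_ball.mp ev3
  refine ⟨Y2, u2, ρ, hρ, hY2n, hu20, ?_, (hgood Y2 hY2 u2 hu2 a0 ha0m).2.2.2⟩
  intro Y hY
  have hh : ∀ u ∈ ball u2 ρ, _ := fun u hu => hball2 (Y, u) (by
      simp only [mem_ball, Prod.dist_eq, max_lt_iff] at *
      exact ⟨hY, hu⟩)
  obtain ⟨-, k1, k2, -⟩ := hh u2 (mem_ball_self hρ)
  obtain ⟨A, hTA, hAN, -⟩ := sel Y k2 k1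
  have hinj : Function.Injective A := by
    intro x y hxy
    rw [← hTA x, ← hTA y, hxy]
  refine ⟨(hgood Y k2 u1 hu1m a0 ha0m).1, A, hinj, hAN, fun u hu => ?_⟩
  obtain ⟨l1, -, -, l4⟩ := hh u hu
  have hu0 : u ≠ 0 := fun h => hO0 (h ▸ l4)
  refine ⟨hu0, fun w hw => ?_⟩
  have hAu : A u ≠ 0 := fun h => hu0 (hinj (by rw [h, map_zero]))
  have h1 : Module.finrank ℂ (Kc f Y (sN Y u)) = 1 := by
    have : Module.finrank ℂ (Kc f Y (sN Y u)) ≠ 0 := fun h => by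
      have := Submodule.finrank_eq_zero.mp h
      exact hAu (by simpa [this] using hAN u)
    exact le_antisymm l1 (by omega)
  obtain ⟨r', hr'⟩ := (finrank_eq_one_iff_of_nonzero' (⟨A u, hAN u⟩ : Kc f Y (sN Y u))
    (by simpa using hAu)).mp h1 ⟨w, hw⟩
  exact ⟨r', by simpa using (congrArg Subtype.val hr').symm⟩

end TypeI

end

section
open Matrix
open scoped ComplexOrder
open Set Filter Topology Metric
set_option linter.unusedSectionVars false
set_option linter.unusedSimpArgs false
set_option linter.style.haveILetI false
set_option linter.unusedVariables false
set_option linter.deprecated false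

namespace TypeI

variable {U G E F : Type*}
  [NormedAddCommGroup U] [InnerProductSpace ℂ U] [FiniteDimensional ℂ U]
  [NormedAddCommGroup G] [InnerProductSpace ℂ G] [FiniteDimensional ℂ G]
  [NormedAddCommGroup E] [InnerProductSpace ℂ E] [FiniteDimensional ℂ E]
  [NormedAddCommGroup F] [InnerProductSpace ℂ F] [FiniteDimensional ℂ F]


theorem local_linear {W : Type*} [AddCommGroup W] [Module ℂ W] (ψ : G → W) {ρ : ℝ} (hρ : 0 < ρ)
    (hadd : ∀ x a : G, ‖x‖ < ρ → ‖a‖ < ρ → ψ (x + a) = ψ x + ψ a)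
    (hsmul : ∀ (s : ℂ) (a : G), ‖s‖ ≤ 1 → ‖a‖ < ρ → ψ (s • a) = s • ψ a) :
    ∃ K : G →ₗ[ℂ] W, ∀ x, ‖x‖ < ρ → ψ x = K x := by
  have key : ∀ (x : G) (c c' : ℝ), 0 < c → c ≤ c' → c' * ‖x‖ < ρ →
      (c:ℂ)⁻¹ • ψ ((c:ℂ) • x) = (c':ℂ)⁻¹ • ψ ((c':ℂ) • x) := by
    intro x c c' hc hcc hx
    have hc' : 0 < c' := hc.trans_le hcc
    have h1 : (c:ℂ) ≠ 0 := by exact_mod_cast hc.ne'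
    have h2 : (c':ℂ) ≠ 0 := by exact_mod_cast hc'.ne'
    have e : (c:ℂ) • x = ((c:ℂ) / c') • ((c':ℂ) • x) := by
      rw [smul_smul, div_mul_cancel₀ _ h2]
    rw [e, hsmul _ _ (by
      rw [norm_div, Complex.norm_of_nonneg hc.le, Complex.norm_of_nonneg hc'.le]
      exact (div_le_one hc').mpr hcc) (by
      rw [norm_smul, Complex.norm_of_nonneg hc'.le]; exact hx), smul_smul]
    congr 1
    field_simp
  let c : G → ℝ := fun x => ρ / (1 + ‖x‖)
  have hc0 : ∀ x, 0 < c x := fun x => by positivity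
  have hcx : ∀ x, c x * ‖x‖ < ρ := fun x => by
    have : 0 < 1 + ‖x‖ := by positivity
    rw [div_mul_eq_mul_div, div_lt_iff₀ this]; nlinarith
  let k : G → W := fun x => (c x : ℂ)⁻¹ • ψ ((c x : ℂ) • x)
  have hk : ∀ (x : G) (t : ℝ), 0 < t → t * ‖x‖ < ρ → k x = (t:ℂ)⁻¹ • ψ ((t:ℂ) • x) := by
    intro x t ht htx
    rcases le_total (c x) t with h | h
    · exact key x _ _ (hc0 x) h htx
    · exact (key x _ _ ht h (hcx x)).symm
  have small : ∀ M : ℝ, 0 ≤ M → ∃ t : ℝ, 0 < t ∧ ∀ x : G, ‖x‖ ≤ M → t * ‖x‖ < ρ := by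
    intro M hM
    refine ⟨ρ / (1 + M), by positivity, fun x hx => ?_⟩
    have : 0 < 1 + M := by positivity
    rw [div_mul_eq_mul_div, div_lt_iff₀ this]; nlinarith
  have nrm : ∀ (t : ℝ) (x : G), 0 < t → ‖(t:ℂ) • x‖ = t * ‖x‖ := fun t x ht => by
    rw [norm_smul, Complex.norm_of_nonneg ht.le]
  refine ⟨⟨⟨k, ?_⟩, ?_⟩, ?_⟩
  · intro x y
    obtain ⟨t, ht, h⟩ := small (‖x‖ + ‖y‖) (by positivity)
    have h1 := h x (by linarith [norm_nonneg y])
    have h2 := h y (by linarith [norm_nonneg x])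
    rw [hk _ t ht (h _ (norm_add_le x y)), hk x t ht h1, hk y t ht h2, smul_add,
      hadd _ _ (by rwa [nrm _ _ ht]) (by rwa [nrm _ _ ht]), smul_add]
  · intro s x
    simp only [RingHom.id_apply]
    obtain ⟨t, ht, h⟩ := small ((1 + ‖s‖) * ‖x‖) (by positivity)
    have h1 := h x (by nlinarith [norm_nonneg s, norm_nonneg x])
    have h2 := h (s • x) (by rw [norm_smul]; nlinarith [norm_nonneg s, norm_nonneg x])
    have hs : (0:ℝ) < 1 + ‖s‖ := by positivity
    have hs' : ((1 + ‖s‖ : ℝ) : ℂ) ≠ 0 := by exact_mod_cast hs.ne'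
    have h3 : ((1 + ‖s‖) * t) * ‖x‖ < ρ := by
      have := h (((1 + ‖s‖ : ℝ) : ℂ) • x) (by rw [nrm _ _ hs])
      rw [nrm _ _ hs] at this
      linarith
    show k (s • x) = s • k x
    rw [hk _ t ht h2, hk x _ (by positivity) h3]
    have e : (t:ℂ) • s • x = (s / ((1 + ‖s‖ : ℝ) : ℂ)) • ((((1 + ‖s‖) * t : ℝ) : ℂ) • x) := by
      rw [smul_smul, smul_smul]
      congr 1
      push_cast at hs' ⊢
      field_simp
    rw [e, hsmul _ _ (by
      rw [norm_div, Complex.norm_of_nonneg hs.le]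
      exact (div_le_one hs).mpr (by linarith)) (by rw [nrm _ _ (by positivity)]; exact h3)]
    rw [smul_smul, smul_smul]
    congr 1
    push_cast at hs' ⊢
    have : (t:ℂ) ≠ 0 := by exact_mod_cast ht.ne'
    field_simp
  · intro x hx
    show ψ x = k x
    rw [hk x 1 one_pos (by simpa using hx)]; simp

theorem third {n : ℕ} (hn : 3 ≤ n) (i j : Fin n) : ∃ k, k ≠ i ∧ k ≠ j := by
  by_contra! h
  have : (Finset.univ : Finset (Fin n)) ⊆ {i, j} := by
    intro k _
    by_cases hk : k = i
    · simp [hk]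
    · simp [h k hk]
  have h1 := Finset.card_le_card this
  have h2 := Finset.card_le_two (a := i) (b := j)
  simp at h1
  omega

theorem local_proj {W : Type*} [AddCommGroup W] [Module ℂ W] (h3 : 3 ≤ Module.finrank ℂ U)
    (J : (U →L[ℂ] G) → (U →ₗ[ℂ] W)) {r : ℝ} (hr : 0 < r)
    (hinj : ∀ X ∈ ball 0 r, Function.Injective (J X)) {O : Set U} (hO : IsOpen O)
    (hne : O.Nonempty) (h0 : (0:U) ∉ O)
    (h : ∀ X ∈ ball 0 r, ∀ X' ∈ ball 0 r, ∀ u ∈ O, X u = X' u → ∃ c : ℂ, J X' u = c • J X u) :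
    ∃ K : G →ₗ[ℂ] W, ∀ᶠ X in 𝓝 (0 : U →L[ℂ] G), ∃ μ : ℂ, μ ≠ 0 ∧
      ∀ u, J X u = μ • (J 0 u + K (X u)) := by
  classical
  have prop : ∀ X ∈ ball 0 r, ∀ X' ∈ ball 0 r, ∀ s : Set U, (∃ u ∈ s, u ∈ O) →
      (∀ u ∈ s, X u = X' u) → ∃ c : ℂ, c ≠ 0 ∧ ∀ u ∈ s, J X' u = c • J X u := by
    intro X hX X' hX' s ⟨u0, hu0s, hu0⟩ hs
    have hV : ∀ u ∈ Submodule.span ℂ s, X u = X' u := by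
      intro u hu
      exact LinearMap.eqOn_span (f := X.toLinearMap) (g := X'.toLinearMap) hs hu
    obtain ⟨c, hc⟩ := proportional ((J X).comp (Submodule.span ℂ s).subtype)
      ((J X').comp (Submodule.span ℂ s).subtype)
      ((hinj X hX).comp (Submodule.injective_subtype _))
      (O := (Submodule.span ℂ s).subtype ⁻¹' O) (hO.preimage continuous_subtype_val)
      ⟨⟨u0, Submodule.subset_span hu0s⟩, hu0⟩
      (fun u hu => h X hX X' hX' u hu (hV u u.2))
    have hc' : ∀ u ∈ s, J X' u = c • J X u := fun u hu => hc ⟨u, Submodule.subset_span hu⟩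
    refine ⟨c, ?_, hc'⟩
    rintro rfl
    have := hc' u0 hu0s
    rw [zero_smul] at this
    exact h0 (by rwa [hinj X' hX' (this.trans (map_zero _).symm)] at hu0)
  obtain ⟨n, h3, b, hb⟩ : ∃ n, 3 ≤ n ∧ ∃ b : Module.Basis (Fin n) ℂ U, ∀ i, b i ∈ O :=
    ⟨_, h3, basis_in_open hO hne⟩
  let S : (Fin n → G) → (U →L[ℂ] G) := fun x =>
    ∑ i, (LinearMap.toContinuousLinearMap (b.coord i) : U →L[ℂ] ℂ).smulRight (x i)
  have hSb : ∀ x j, S x (b j) = x j := by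
    intro x j
    simp [S, ContinuousLinearMap.sum_apply, Finsupp.single_apply]
  have hSc : Continuous S := by
    refine continuous_finset_sum _ fun i _ => ?_
    have : (fun x : Fin n → G =>
      (LinearMap.toContinuousLinearMap (b.coord i) : U →L[ℂ] ℂ).smulRight (x i)) =
      fun x => ContinuousLinearMap.smulRightL ℂ U G (LinearMap.toContinuousLinearMap (b.coord i)) (x i) := rfl
    rw [this]
    exact (ContinuousLinearMap.continuous _).comp (continuous_apply i)
  have hS0 : S 0 = 0 := by simp [S]
  obtain ⟨ρ, hρ, hS⟩ : ∃ ρ > 0, ∀ x : Fin n → G, (∀ i, ‖x i‖ < ρ) → S x ∈ ball 0 r := by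
    have := (hSc.tendsto 0).eventually (isOpen_ball.mem_nhds (x := S 0)
      (s := ball 0 r) (by rw [hS0]; exact mem_ball_self hr))
    obtain ⟨ρ, hρ, hh⟩ := Metric.eventually_nhds_iff_ball.mp this
    refine ⟨ρ, hρ, fun x hx => hh x ?_⟩
    rw [mem_ball_zero_iff, pi_norm_lt_iff hρ]; exact hx
  have sing : ∀ i (x : G), ‖x‖ < ρ → ∀ j, ‖(Pi.single i x : Fin n → G) j‖ < ρ := by
    intro i x hx j
    by_cases hj : j = i
    · subst hj; simpa using hx
    · simpa [Pi.single_apply, hj] using hρ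
  have sing2 : ∀ i j (x y : G), i ≠ j → ‖x‖ < ρ → ‖y‖ < ρ →
      ∀ l, ‖(Pi.single i x + Pi.single j y : Fin n → G) l‖ < ρ := by
    intro i j x y hij hx hy l
    by_cases hl : l = i
    · subst hl; simpa [Pi.single_apply, hij] using hx
    · by_cases hl2 : l = j
      · subst hl2; simpa [Pi.single_apply, hl] using hy
      · simpa [Pi.single_apply, hl, hl2] using hρ
  have hbne : ∀ x, (∀ i, ‖x i‖ < ρ) → ∀ i, J (S x) (b i) ≠ 0 := by
    intro x hx i h
    exact b.ne_zero i (hinj _ (hS x hx) (h.trans (map_zero _).symm))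
  have z0 : ∀ i, ‖(0 : Fin n → G) i‖ < ρ := by simpa using fun _ => hρ
  have hlam : ∀ i (x : G), ‖x‖ < ρ → ∃ c : ℂ, c ≠ 0 ∧ ∀ j, j ≠ i →
      J (S (Pi.single i x)) (b j) = c • J (S 0) (b j) := by
    intro i x hx
    obtain ⟨k, hk, -⟩ := third h3 i i
    obtain ⟨c, hc, hc2⟩ := prop _ (hS 0 z0) _ (hS _ (sing i x hx)) {u | ∃ j, j ≠ i ∧ u = b j}
      ⟨b k, ⟨k, hk, rfl⟩, hb k⟩ (by
        rintro _ ⟨j, hj, rfl⟩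
        rw [hSb, hSb]; simp [Pi.single_apply, hj])
    exact ⟨c, hc, fun j hj => hc2 _ ⟨j, hj, rfl⟩⟩
  choose! lam hlam0 hlam using hlam
  let ϕ : Fin n → G → W := fun i x => (lam i x)⁻¹ • J (S (Pi.single i x)) (b i)
  have hϕ : ∀ i x, ‖x‖ < ρ → J (S (Pi.single i x)) (b i) = lam i x • ϕ i x := by
    intro i x hx
    simp only [ϕ, smul_smul, mul_inv_cancel₀ (hlam0 i x hx), one_smul]
  have hϕ0 : ∀ i x, ‖x‖ < ρ → ϕ i x ≠ 0 := by
    intro i x hx h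
    apply hbne _ (sing i x hx) i
    rw [hϕ i x hx, h, smul_zero]
  -- pairs
  have pair : ∀ x, (∀ i, ‖x i‖ < ρ) → ∀ i j, i ≠ j → ∃ μ : ℂ, μ ≠ 0 ∧
      J (S x) (b i) = μ • ϕ i (x i) ∧ J (S x) (b j) = μ • ϕ j (x j) := by
    intro x hx i j hij
    obtain ⟨k, hki, hkj⟩ := third h3 i j
    have hx2 := sing2 i j (x i) (x j) hij (hx i) (hx j)
    obtain ⟨c0, hc0, h0'⟩ := prop _ (hS _ hx2) _ (hS x hx) {b i, b j} ⟨b i, by simp, hb i⟩ (by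
      rintro u (rfl | rfl)
      · rw [hSb, hSb]; simp [Pi.single_apply, hij]
      · rw [hSb, hSb]; simp [Pi.single_apply, hij.symm])
    obtain ⟨c1, hc1, h1⟩ := prop _ (hS _ (sing i (x i) (hx i))) _ (hS _ hx2) {b i, b k}
      ⟨b i, by simp, hb i⟩ (by
      rintro u (rfl | rfl)
      · rw [hSb, hSb]; simp [Pi.single_apply, hij]
      · rw [hSb, hSb]; simp [Pi.single_apply, hki, hkj])
    obtain ⟨c2, hc2, h2⟩ := prop _ (hS _ (sing j (x j) (hx j))) _ (hS _ hx2) {b j, b k}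
      ⟨b j, by simp, hb j⟩ (by
      rintro u (rfl | rfl)
      · rw [hSb, hSb]; simp [Pi.single_apply, hij.symm]
      · rw [hSb, hSb]; simp [Pi.single_apply, hki, hkj])
    have e1 := h1 (b k) (by simp)
    have e2 := h2 (b k) (by simp)
    rw [hlam i _ (hx i) k hki, smul_smul] at e1
    rw [e1, hlam j _ (hx j) k hkj, smul_smul] at e2
    have e3 : c1 * lam i (x i) = c2 * lam j (x j) :=
      smul_left_injective ℂ (hbne 0 z0 k) e2
    refine ⟨c0 * (c1 * lam i (x i)), mul_ne_zero hc0 (mul_ne_zero hc1 (hlam0 i _ (hx i))), ?_, ?_⟩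
    · rw [h0' (b i) (by simp), h1 (b i) (by simp), hϕ i _ (hx i), smul_smul, smul_smul, mul_assoc]
    · rw [e3, h0' (b j) (by simp), h2 (b j) (by simp), hϕ j _ (hx j), smul_smul, smul_smul, mul_assoc]
  have all : ∀ x, (∀ i, ‖x i‖ < ρ) → ∃ μ : ℂ, μ ≠ 0 ∧ ∀ i, J (S x) (b i) = μ • ϕ i (x i) := by
    intro x hx
    have i0 : Fin n := ⟨0, by omega⟩
    obtain ⟨k, hk, -⟩ := third h3 i0 i0
    obtain ⟨μ, hμ, e1, -⟩ := pair x hx i0 k hk.symm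
    refine ⟨μ, hμ, fun j => ?_⟩
    by_cases hj : i0 = j
    · rw [← hj]; exact e1
    · obtain ⟨μ', -, e2, e3⟩ := pair x hx i0 j hj
      rw [e1] at e2
      rw [smul_left_injective ℂ (hϕ0 i0 _ (hx i0)) e2]; exact e3
  have n0 : ‖(0:G)‖ < ρ := by simpa using hρ
  have rel : ∀ i j, i ≠ j → ∀ (x y a : G) (s : ℂ), ‖x‖ < ρ → ‖y‖ < ρ → ‖x + a‖ < ρ →
      ‖y + s • a‖ < ρ → s • (ϕ i (x + a) - ϕ i x) = ϕ j (y + s • a) - ϕ j y := by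
    intro i j hij x y a s hx hy hxa hya
    obtain ⟨k, hki, hkj⟩ := third h3 i j
    have q1 := sing2 i j x y hij hx hy
    have q2 := sing2 i j _ _ hij hxa hya
    obtain ⟨μ, hμ, m1⟩ := all _ q1
    obtain ⟨μ', hμ', m2⟩ := all _ q2
    obtain ⟨c, hc, hh⟩ := prop _ (hS _ q1) _ (hS _ q2) {s • b i - b j, b k} ⟨b k, by simp, hb k⟩ (by
      rintro u (rfl | rfl)
      · rw [map_sub, map_sub, map_smul, map_smul, hSb, hSb, hSb, hSb]
        simp only [Pi.add_apply, Pi.single_eq_same, Pi.single_eq_of_ne hij,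
          Pi.single_eq_of_ne hij.symm]
        module
      · rw [hSb, hSb]; simp [Pi.single_apply, hki, hkj])
    have e1 := hh (b k) (by simp)
    rw [m1, m2, smul_smul c μ] at e1
    simp only [Pi.add_apply, Pi.single_eq_of_ne hki, Pi.single_eq_of_ne hkj, add_zero] at e1
    have e2 : μ' = c * μ := smul_left_injective ℂ (hϕ0 k 0 n0) e1
    have e3 := hh (s • b i - b j) (by simp)
    simp only [map_sub, map_smul, m1, m2, Pi.add_apply, Pi.single_eq_same, Pi.single_eq_of_ne hij,
          Pi.single_eq_of_ne hij.symm, add_zero, zero_add] at e3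
    have e4 : (c * μ) • (s • (ϕ i (x + a) - ϕ i x)) = (c * μ) • (ϕ j (y + s • a) - ϕ j y) := by
      rw [e2] at e3
      rw [← sub_eq_zero] at e3 ⊢
      rw [← e3]; module
    exact smul_right_injective W (mul_ne_zero hc hμ) e4
  have i0 : Fin n := ⟨0, by omega⟩
  have eqψ : ∀ i j (a : G), ‖a‖ < ρ → ϕ i a - ϕ i 0 = ϕ j a - ϕ j 0 := by
    have aux : ∀ i j, i ≠ j → ∀ (a : G), ‖a‖ < ρ → ϕ i a - ϕ i 0 = ϕ j a - ϕ j 0 := by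
      intro i j hij a ha
      simpa using rel i j hij 0 0 a 1 n0 n0 (by simpa using ha) (by simpa using ha)
    intro i j a ha
    by_cases hij : i = j
    · rw [hij]
    · exact aux i j hij a ha
  obtain ⟨j0, hj0, -⟩ := third h3 i0 i0
  obtain ⟨K, hK⟩ := local_linear (fun a => ϕ i0 a - ϕ i0 0) (half_pos hρ) (by
      intro x a hx ha
      have hx' : ‖x‖ < ρ := by linarith
      have ha' : ‖a‖ < ρ := by linarith
      have := rel i0 j0 hj0.symm x 0 a 1 hx' n0 ((norm_add_le _ _).trans_lt (by linarith))
        (by simpa using ha')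
      simp only [one_smul, zero_add] at this
      rw [← eqψ i0 j0 a ha'] at this
      rw [← this]; abel) (by
      intro s a hs ha
      have ha' : ‖a‖ < ρ := by linarith
      have hsa : ‖s • a‖ < ρ := by
        rw [norm_smul]; nlinarith [norm_nonneg a]
      have := rel i0 j0 hj0.symm 0 0 a s n0 n0 (by simpa using ha') (by simpa using hsa)
      simp only [zero_add] at this
      rw [← eqψ i0 j0 _ hsa] at this
      exact this.symm)
  refine ⟨K, ?_⟩
  -- base values
  obtain ⟨μ0, hμ0, hb0⟩ := all 0 z0
  have hP : ∀ i, J 0 (b i) = ϕ i 0 := by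
    intro i
    have e1 := hϕ i 0 n0
    rw [Pi.single_zero, hS0] at e1
    obtain ⟨k, hk, -⟩ := third h3 i i
    have e2 := hlam i 0 n0 k hk
    rw [Pi.single_zero] at e2
    have e3 : (1:ℂ) = lam i 0 := smul_left_injective ℂ (hbne 0 z0 k) (by simpa using e2)
    rw [e1, ← e3, one_smul]
  have ev : ∀ᶠ X in 𝓝 (0 : U →L[ℂ] G), ∀ i, ‖X (b i)‖ < ρ / 2 := by
    rw [eventually_all]
    intro i
    have : Continuous fun X : U →L[ℂ] G => ‖X (b i)‖ := by fun_prop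
    exact this.continuousAt.eventually_lt continuousAt_const (by simpa using hρ)
  filter_upwards [ev] with X hX
  have hX' : ∀ i, ‖X (b i)‖ < ρ := fun i => (hX i).trans (by linarith)
  have hXS : X = S (fun i => X (b i)) := by
    apply ContinuousLinearMap.coe_injective
    refine b.ext fun i => ?_
    exact (hSb (fun i => X (b i)) i).symm
  obtain ⟨μ, hμ, hh⟩ := all (fun i => X (b i)) hX'
  rw [← hXS] at hh
  refine ⟨μ, hμ, fun u => ?_⟩
  have : J X = μ • (J 0 + K ∘ₗ X.toLinearMap) := by
    refine b.ext fun i => ?_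
    rw [hh i]
    simp only [LinearMap.smul_apply, LinearMap.add_apply, LinearMap.comp_apply, hP i]
    have e := hK _ (hX i)
    have e2 := eqψ i i0 _ (hX' i)
    rw [e] at e2
    congr 1
    show ϕ i (X (b i)) = ϕ i 0 + K (X (b i))
    rw [← e2]; abel
  rw [this]; rfl

end TypeI

end

section
open Matrix
open scoped ComplexOrder
open Set Filter Topology Metric
set_option linter.unusedSectionVars false
set_option linter.unusedSimpArgs false
set_option linter.style.haveILetI false
set_option linter.unusedVariables false
set_option linter.deprecated false

namespace TypeI

variable {U G E F : Type*}
  [NormedAddCommGroup U] [InnerProductSpace ℂ U] [FiniteDimensional ℂ U]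
  [NormedAddCommGroup G] [InnerProductSpace ℂ G] [FiniteDimensional ℂ G]
  [NormedAddCommGroup E] [InnerProductSpace ℂ E] [FiniteDimensional ℂ E]
  [NormedAddCommGroup F] [InnerProductSpace ℂ F] [FiniteDimensional ℂ F]


theorem stage1 {f : (U →L[ℂ] G) → (E →L[ℂ] F)} (hG : GM f)
    (h3 : 3 ≤ Module.finrank ℂ U) (hEU : Module.finrank ℂ E ≤ Module.finrank ℂ U + 1)
    (hN0 : ∀ w, (∀ Z, ‖Z‖ < 1 → f Z w = f 0 w) → w = 0)
    (hd : Module.finrank ℂ E < Module.finrank ℂ G) :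
    ∃ (Y2 : U →L[ℂ] G) (u2 : U) (γ : G →L[ℂ] ℂ) (JE : (U × G) →ₗ[ℂ] E) (JF : (U × G) →ₗ[ℂ] F),
      ‖Y2‖ < 1 ∧ u2 ≠ 0 ∧ γ ≠ 0 ∧ Module.finrank ℂ (Kc f Y2 (sV Y2 u2 γ)) ≤ 1 ∧
      (∀ Y, ‖Y‖ < 1 → ∀ u, f Y (JE (u, Y u)) = JF (u, Y u)) ∧
      (∀ u, JE (u, Y2 u) = 0 → u = 0) := by
  have hf := hG.diff
  obtain ⟨Y2, u2, r, hr, hY2, hu2, hA, γ, hγ, hV⟩ := stage1b hG h3 hEU hN0 hd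
  choose! hn A hAi hAN hAu using hA
  have hm : ∀ X ∈ ball (0 : U →L[ℂ] G) r, Y2 + X ∈ ball Y2 r := by
    intro X hX; simpa using hX
  have hY2m : Y2 ∈ ball Y2 r := mem_ball_self hr
  let J : (U →L[ℂ] G) → (U →ₗ[ℂ] E × F) := fun X =>
    (A (Y2 + X)).prod ((f (Y2 + X)).toLinearMap ∘ₗ A (Y2 + X))
  obtain ⟨K, hK⟩ := local_proj h3 J hr (by
      intro X hX u v huv
      exact hAi _ (hm X hX) (congrArg Prod.fst huv)) (O := ball u2 r) isOpen_ball
      ⟨u2, mem_ball_self hr⟩ (fun h => (hAu Y2 hY2m 0 h).1 rfl) (by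
      intro X hX X' hX' u hu hXu
      have hXu' : (Y2 + X') u = (Y2 + X) u := by simp [hXu]
      have e := Kc_sN_congr (f := f) (hn _ (hm X hX)) (hn _ (hm X' hX')) hXu'
      have h1 : A (Y2 + X') u ∈ Kc f (Y2 + X) (sN (Y2 + X) u) := by
        rw [← e]; exact hAN _ (hm X' hX') u
      obtain ⟨c, hc⟩ := (hAu _ (hm X hX) u hu).2 _ h1
      refine ⟨c, ?_⟩
      have h2 := h1 (Y2 + X') ⟨hn _ (hm X' hX'), hXu'⟩
      show (A (Y2 + X') u, f (Y2 + X') (A (Y2 + X') u)) = c • (A (Y2 + X) u, f (Y2 + X) (A (Y2 + X) u))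
      rw [h2, hc, map_smul]; rfl)
  let JJ : (U × G) →ₗ[ℂ] E × F :=
    J 0 ∘ₗ LinearMap.fst ℂ U G + K ∘ₗ (LinearMap.snd ℂ U G - Y2.toLinearMap ∘ₗ LinearMap.fst ℂ U G)
  have hJJ : ∀ X u, JJ (u, (Y2 + X) u) = J 0 u + K (X u) := by
    intro X u; simp [JJ]
  have hfin : Module.finrank ℂ (Kc f Y2 (sV Y2 u2 γ)) ≤ 1 := by
    have : Kc f Y2 (sV Y2 u2 γ) ≤ (ℂ ∙ (A Y2 u2)) := by
      intro w hw
      obtain ⟨c, hc⟩ := (hAu Y2 hY2m u2 (mem_ball_self hr)).2 w (hV hw)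
      rw [hc]; exact Submodule.smul_mem _ _ (Submodule.mem_span_singleton_self _)
    exact (Submodule.finrank_mono this).trans ((finrank_span_le_card _).trans (by simp))
  refine ⟨Y2, u2, γ, LinearMap.fst ℂ E F ∘ₗ JJ, LinearMap.snd ℂ E F ∘ₗ JJ, hY2, hu2, hγ, hfin, ?_, ?_⟩
  · intro Y hY u
    let l1 : (U →L[ℂ] G) →L[ℂ] E := LinearMap.toContinuousLinearMap
      { toFun := fun X => (JJ (0, X u)).1
        map_add' := fun X X' => by
          have : ((0:U), (X + X') u) = (0, X u) + (0, X' u) := by simp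
          rw [this, map_add]; rfl
        map_smul' := fun c X => by
          have : ((0:U), (c • X) u) = c • (0, X u) := by simp
          rw [this, map_smul]; rfl }
    let l2 : (U →L[ℂ] G) →L[ℂ] F := LinearMap.toContinuousLinearMap
      { toFun := fun X => (JJ (0, X u)).2
        map_add' := fun X X' => by
          have : ((0:U), (X + X') u) = (0, X u) + (0, X' u) := by simp
          rw [this, map_add]; rfl
        map_smul' := fun c X => by
          have : ((0:U), (c • X) u) = c • (0, X u) := by simp
          rw [this, map_smul]; rfl }
    have split : ∀ X : U →L[ℂ] G, JJ (u, X u) = JJ (u, 0) + JJ (0, X u) := by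
      intro X; rw [← map_add]; simp
    have e1 : ∀ X : U →L[ℂ] G, (JJ (u, X u)).1 = (JJ (u, 0)).1 + l1 X := by
      intro X; rw [split]; rfl
    have e2 : ∀ X : U →L[ℂ] G, (JJ (u, X u)).2 = (JJ (u, 0)).2 + l2 X := by
      intro X; rw [split]; rfl
    have hd : DifferentiableOn ℂ (fun X : U →L[ℂ] G => f X (JJ (u, X u)).1 - (JJ (u, X u)).2)
        (ball 0 1) := by
      simp only [e1, e2]
      exact (hf.clm_apply (by fun_prop)).sub (by fun_prop)
    have := line_ident (h := fun X : U →L[ℂ] G => f X (JJ (u, X u)).1 - (JJ (u, X u)).2) (c := 0)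
      hd hY2 hY ?_
    · exact sub_eq_zero.mp this
    · have ht : Tendsto (fun s : ℂ => s • (Y - Y2)) (𝓝 0) (𝓝 0) := by
        have : Continuous (fun s : ℂ => s • (Y - Y2)) := by fun_prop
        simpa using this.tendsto 0
      filter_upwards [ht.eventually hK] with s ⟨μ, hμ, hh⟩
      rw [hJJ]
      have h1 := hh u
      have h2 : J 0 u + K ((s • (Y - Y2)) u) = μ⁻¹ • J (s • (Y - Y2)) u := by
        rw [h1, smul_smul, inv_mul_cancel₀ hμ, one_smul]
      rw [h2]
      simp [J]
  · intro u hu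
    have h1 : JJ (u, Y2 u) = J 0 u := by simpa using hJJ 0 u
    have h2 : (J 0 u).1 = 0 := by rw [← h1]; exact hu
    have h3 : A Y2 u = 0 := by simpa [J] using h2
    exact hAi Y2 hY2m (by rw [h3, map_zero])

end TypeI

end

section
open Matrix
open scoped ComplexOrder
open Set Filter Topology Metric
set_option linter.unusedSectionVars false
set_option linter.unusedSimpArgs false
set_option linter.style.haveILetI false
set_option linter.unusedVariables false
set_option linter.deprecated false

namespace TypeI

variable {U G E F : Type*}
  [NormedAddCommGroup U] [InnerProductSpace ℂ U] [FiniteDimensional ℂ U]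
  [NormedAddCommGroup G] [InnerProductSpace ℂ G] [FiniteDimensional ℂ G]
  [NormedAddCommGroup E] [InnerProductSpace ℂ E] [FiniteDimensional ℂ E]
  [NormedAddCommGroup F] [InnerProductSpace ℂ F] [FiniteDimensional ℂ F]


/-- The set `sV` at a multiple of a rank one operator consists of admissible perturbations. -/
theorem adm_of_sV {v : G} {u : U} (hu : ‖u‖ = 1) (hv : ‖v‖ = 1) {t : ℂ} {Z : U →L[ℂ] G}
    (hZ : Z ∈ sV (t • ro v u) u (innerSL ℂ v)) : Adm v u (Z - t • ro v u) := by
  obtain ⟨h1, h2, h3⟩ := hZ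
  have huu : inner ℂ u u = (1 : ℂ) := by rw [inner_self_eq_norm_sq_to_K, hu]; simp
  have hvv : inner ℂ v v = (1 : ℂ) := by rw [inner_self_eq_norm_sq_to_K, hv]; simp
  have h2' : Z u = t • v := by
    rw [h2]; simp [ro_apply, hu]
  refine ⟨?_, ?_, fun x => ?_⟩
  · refine lt_of_le_of_lt ?_ h1
    refine ContinuousLinearMap.opNorm_le_bound _ (norm_nonneg _) fun x => ?_
    have e : (Z - t • ro v u) x = Z (x - inner ℂ u x • u) := by
      simp only [ContinuousLinearMap.sub_apply, ContinuousLinearMap.smul_apply, ro_apply, map_sub,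
        map_smul, h2', smul_smul, mul_comm]
    rw [e]
    refine (Z.le_opNorm _).trans (mul_le_mul_of_nonneg_left ?_ (norm_nonneg _))
    have hpy : ‖x‖ ^ 2 = ‖x - inner ℂ u x • u‖ ^ 2 + ‖inner ℂ u x • u‖ ^ 2 := by
      have := norm_add_sq (𝕜 := ℂ) (x - inner ℂ u x • u) (inner ℂ u x • u)
      have h0 : inner ℂ (x - inner ℂ u x • u) (inner ℂ u x • u) = (0 : ℂ) := by
        rw [inner_smul_right, inner_sub_left, inner_smul_left, huu, mul_one, inner_conj_symm,
          sub_self, mul_zero]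
      rw [h0] at this
      simpa using this
    refine abs_le_of_sq_le_sq' ?_ (norm_nonneg _) |>.2
    nlinarith [sq_nonneg ‖inner ℂ u x • u‖]
  · simp [h2', ro_apply, hu]
  · have := h3 x
    simp only [innerSL_apply_apply] at this
    simp [inner_sub_right, this]

theorem ro_ne_zero_apply {v : G} {u : U} (hu : ‖u‖ = 1) (t : ℂ) : (t • ro v u) u = t • v := by
  have huu : inner ℂ u u = (1 : ℂ) := by rw [inner_self_eq_norm_sq_to_K, hu]; simp
  simp [ro_apply, hu]

theorem norm_tro {v : G} {u : U} (hu : ‖u‖ = 1) (hv : ‖v‖ = 1) {t : ℂ} (ht : ‖t‖ < 1) :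
    ‖t • ro v u‖ < 1 := by
  rw [norm_smul, norm_ro, hu, hv]; simpa using ht

theorem orth1 {f : (U →L[ℂ] G) → (E →L[ℂ] F)} (hf : GM f)
    {A : U →ₗ[ℂ] E} {K1 : G →ₗ[ℂ] E} {K2 : G →ₗ[ℂ] F}
    (hJ : ∀ Y, ‖Y‖ < 1 → ∀ u, f Y (A u + K1 (Y u)) = K2 (Y u))
    {v : G} {u : U} (hu : ‖u‖ = 1) (hv : ‖v‖ = 1) {t : ℂ} (ht : ‖t‖ < 1)
    (hdim : Module.finrank ℂ (Kc f (t • ro v u) (sV (t • ro v u) u (innerSL ℂ v))) ≤ 1)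
    (hne : A u + t • K1 v ≠ 0) (u' : U) (hu' : inner ℂ u u' = (0 : ℂ)) :
    inner ℂ (A u') (A u + t • K1 v) = (0 : ℂ) := by
  let S : Submodule ℂ U := LinearMap.ker (innerSL ℂ u).toLinearMap
  obtain ⟨w, hw0, hw, hwZ⟩ := face_lemma hf hu hv (S.map A) (by
    rintro t ht _ ⟨x, hx, rfl⟩
    have hx' : inner ℂ u x = (0 : ℂ) := by simpa [S] using hx
    have := hJ _ (norm_tro hu hv ht) x
    simpa [ro_apply, hx'] using this) t ht
  have h1 : w ∈ Kc f (t • ro v u) (sV (t • ro v u) u (innerSL ℂ v)) := by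
    intro Z hZ
    have := hwZ _ (adm_of_sV hu hv hZ)
    simpa using this
  have h2 : A u + t • K1 v ∈ Kc f (t • ro v u) (sV (t • ro v u) u (innerSL ℂ v)) := by
    intro Z hZ
    have a1 := hJ Z hZ.1 u
    have a2 := hJ _ (norm_tro hu hv ht) u
    rw [hZ.2.1, ro_ne_zero_apply hu, map_smul] at a1
    rw [ro_ne_zero_apply hu, map_smul] at a2
    rw [a1, a2]
  obtain ⟨c, hc⟩ : ∃ c : ℂ, c • w = A u + t • K1 v := by
    have := (finrank_le_one_iff.mp hdim)
    obtain ⟨e, he⟩ := this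
    obtain ⟨a, ha⟩ := he ⟨w, h1⟩
    obtain ⟨b, hb⟩ := he ⟨_, h2⟩
    have ha' : a • (e : E) = w := congrArg Subtype.val ha
    have hb' : b • (e : E) = A u + t • K1 v := congrArg Subtype.val hb
    have ha0 : a ≠ 0 := by rintro rfl; apply hw0; rw [← ha', zero_smul]
    refine ⟨b * a⁻¹, ?_⟩
    rw [← ha', ← hb', smul_smul]; congr 1; field_simp
  rw [← hc, inner_smul_right]
  have := (Submodule.mem_orthogonal _ _).mp hw (A u') ⟨u', by simpa [S] using hu', rfl⟩
  rw [this, mul_zero]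

theorem null1 {f : (U →L[ℂ] G) → (E →L[ℂ] F)} (hf : GM f)
    {A : U →ₗ[ℂ] E} {K1 : G →ₗ[ℂ] E} {K2 : G →ₗ[ℂ] F} (hA : Function.Injective A)
    (hEU : Module.finrank ℂ E ≤ Module.finrank ℂ U + 1)
    (hJ : ∀ Y, ‖Y‖ < 1 → ∀ u, f Y (A u + K1 (Y u)) = K2 (Y u))
    (h1 : ∀ u u', inner ℂ u u' = (0 : ℂ) → inner ℂ (A u) (A u') = (0 : ℂ))
    (h2 : ∀ u v, inner ℂ (A u) (K1 v) = (0 : ℂ))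
    {v : G} {u : U} (hu : ‖u‖ = 1) (hv : ‖v‖ = 1)
    (hdim : Module.finrank ℂ (Kc f 0 (sV 0 u (innerSL ℂ v))) ≤ 1) :
    ‖K2 v‖ ^ 2 = ‖A u‖ ^ 2 + ‖K1 v‖ ^ 2 := by
  by_contra hcon
  let S : Submodule ℂ U := LinearMap.ker (innerSL ℂ u).toLinearMap
  have hSm : ∀ x, x ∈ S ↔ inner ℂ u x = (0 : ℂ) := fun x => by simp [S]
  set X : Submodule ℂ E := (S.map A)ᗮ with hX
  have hXm : ∀ w, w ∈ X ↔ ∀ x, inner ℂ u x = (0 : ℂ) → inner ℂ (A x) w = (0 : ℂ) := by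
    intro w
    rw [hX, Submodule.mem_orthogonal]
    constructor
    · intro h x hx
      exact h _ ⟨x, (hSm x).mpr hx, rfl⟩
    · rintro h _ ⟨x, hx, rfl⟩
      exact h x ((hSm x).mp hx)
  have hXd : Module.finrank ℂ X ≤ 2 := by
    have a1 := (S.map A).finrank_add_finrank_orthogonal
    have a2 : Module.finrank ℂ (S.map A) = Module.finrank ℂ S :=
      (LinearEquiv.finrank_eq (Submodule.equivMapOfInjective A hA S)).symm
    have a3 := LinearMap.finrank_range_add_finrank_ker (innerSL ℂ u).toLinearMap
    have a4 : Module.finrank ℂ (LinearMap.range (innerSL ℂ u).toLinearMap) ≤ 1 := by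
      refine (Submodule.finrank_le _).trans ?_
      simp
    change _ + Module.finrank ℂ S = _ at a3
    change _ + Module.finrank ℂ X = _ at a1
    omega
  -- the boundary analysis
  have key : ∀ t : ℕ → ℂ, (∀ n, ‖t n‖ < 1) → Tendsto (fun n => ‖t n‖) atTop (𝓝 1) →
      ∃ φ : ℕ → ℕ, StrictMono φ ∧ ∃ a ∈ X, ∃ b ∈ X, LinearIndependent ℂ ![a, b] ∧
        ∀ Z', Adm v u Z' →
        Tendsto (fun n => f (Z' + t (φ n) • ro v u) a - f (t (φ n) • ro v u) a) atTop (𝓝 0) ∧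
        Tendsto (fun n => f (Z' + t (φ n) • ro v u) b - f (t (φ n) • ro v u) b) atTop (𝓝 0) := by
    intro t ht1 ht2
    obtain ⟨τ, -, φ1, hφ1, hτ⟩ := (isCompact_closedBall (0 : ℂ) 1).tendsto_subseq
      (x := t) (fun n => by simpa using (ht1 n).le)
    have hτ1 : ‖τ‖ = 1 := tendsto_nhds_unique hτ.norm (ht2.comp hφ1.tendsto_atTop)
    obtain ⟨A0, φ2, hφ2, hA0⟩ := hf.subseq (Z := fun n => t (φ1 n) • ro v u)
      (fun n => norm_tro hu hv (ht1 _))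
    have hA01 : ‖A0‖ = 1 := by
      refine hf.limit_norm (Z := fun n => t (φ1 (φ2 n)) • ro v u)
        (fun n => norm_tro hu hv (ht1 _)) ?_ hA0
      simp only [norm_smul, norm_ro, hu, hv, mul_one]
      exact ht2.comp (hφ1.comp hφ2).tendsto_atTop
    obtain ⟨a, ha1, ha2⟩ := exists_norm_attain hA01
    have hτ' : Tendsto (fun n => t (φ1 (φ2 n))) atTop (𝓝 τ) := hτ.comp hφ2.tendsto_atTop
    have hA0w : ∀ w, Tendsto (fun n => f (t (φ1 (φ2 n)) • ro v u) w) atTop (𝓝 (A0 w)) := fun w =>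
      ((ContinuousLinearMap.apply ℂ F w).continuous.tendsto A0).comp hA0
    have hA0k : ∀ x, inner ℂ u x = (0 : ℂ) → A0 (A x) = 0 := by
      intro x hx
      refine tendsto_nhds_unique (hA0w (A x)) ?_
      have : ∀ n, f (t (φ1 (φ2 n)) • ro v u) (A x) = 0 := by
        intro n
        have := hJ _ (norm_tro hu hv (ht1 (φ1 (φ2 n)))) x
        simpa [ro_apply, hx] using this
      simp [this]
    set b : E := A u + τ • K1 v with hb
    have haX : a ∈ X := by
      rw [hXm]
      intro x hx
      have := attain hA01.le (by rw [ha1, ha2]) (A x) (w := a)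
      rw [hA0k x hx, inner_zero_right] at this
      rw [← inner_conj_symm, ← this, map_zero]
    have hbX : b ∈ X := by
      rw [hXm]
      intro x hx
      rw [hb, inner_add_right, inner_smul_right, h2, mul_zero, add_zero]
      refine h1 _ _ ?_
      rw [← inner_conj_symm, hx, map_zero]
    have hbn : ‖b‖ ^ 2 = ‖A u‖ ^ 2 + ‖K1 v‖ ^ 2 := by
      have := norm_add_sq (𝕜 := ℂ) (A u) (τ • K1 v)
      rw [inner_smul_right, h2, norm_smul, hτ1] at this
      simpa using this
    have hA0b : A0 b = τ • K2 v := by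
      have e1 : Tendsto (fun n => f (t (φ1 (φ2 n)) • ro v u) (A u + t (φ1 (φ2 n)) • K1 v)) atTop
          (𝓝 (A0 b)) :=
        tendsto_clm hA0 (tendsto_const_nhds.add (hτ'.smul_const _))
      refine tendsto_nhds_unique e1 ?_
      have : ∀ n, f (t (φ1 (φ2 n)) • ro v u) (A u + t (φ1 (φ2 n)) • K1 v)
          = t (φ1 (φ2 n)) • K2 v := by
        intro n
        have := hJ _ (norm_tro hu hv (ht1 (φ1 (φ2 n)))) u
        simpa [ro_ne_zero_apply hu] using this
      simp only [this]
      exact hτ'.smul_const _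
    refine ⟨φ1 ∘ φ2, hφ1.comp hφ2, a, haX, b, hbX, ?_, fun Z' hZ' => ⟨?_, ?_⟩⟩
    · have ha0 : a ≠ 0 := by rintro rfl; simp at ha1
      rw [LinearIndependent.pair_iff' ha0]
      intro c hc
      apply hcon
      rw [← hbn]
      have e1 : ‖A0 b‖ = ‖K2 v‖ := by rw [hA0b, norm_smul, hτ1, one_mul]
      rw [← e1, ← hc, map_smul, norm_smul, norm_smul, ha1, ha2]
    · have := (face_limit hf hu hv (fun n => ht1 (φ1 (φ2 n))) hA0 ha1 ha2 hZ').sub (hA0w a)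
      simpa using this
    · have e0 : ∀ n, f (Z' + t (φ1 (φ2 n)) • ro v u) b - f (t (φ1 (φ2 n)) • ro v u) b
          = f (Z' + t (φ1 (φ2 n)) • ro v u) ((τ - t (φ1 (φ2 n))) • K1 v) -
            f (t (φ1 (φ2 n)) • ro v u) ((τ - t (φ1 (φ2 n))) • K1 v) := by
        intro n
        have eb : b = (A u + t (φ1 (φ2 n)) • K1 v) + (τ - t (φ1 (φ2 n))) • K1 v := by
          rw [hb, sub_smul]; abel
        have e1 := hJ _ (norm_tro hu hv (ht1 (φ1 (φ2 n)))) u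
        have e2 := hJ _ (norm_face_lt hu hv hZ' (ht1 (φ1 (φ2 n)))) u
        rw [ContinuousLinearMap.add_apply, hZ'.2.1, zero_add] at e2
        rw [ro_ne_zero_apply hu, map_smul, map_smul] at e1 e2
        rw [eb, map_add _ (A u + _), map_add _ (A u + _), e1, e2]
        abel
      simp only [Function.comp_apply, e0]
      have hl : Tendsto (fun n => 2 * ‖(τ - t (φ1 (φ2 n))) • K1 v‖) atTop (𝓝 0) := by
        have := ((tendsto_const_nhds (x := τ)).sub hτ').smul_const (K1 v) |>.norm.const_mul 2
        simpa using this
      refine squeeze_zero_norm (fun n => ?_) hl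
      refine (norm_sub_le _ _).trans ?_
      have b1 := (f (Z' + t (φ1 (φ2 n)) • ro v u)).le_of_opNorm_le
        (hf.maps _ (norm_face_lt hu hv hZ' (ht1 (φ1 (φ2 n))))).le ((τ - t (φ1 (φ2 n))) • K1 v)
      have b2 := (f (t (φ1 (φ2 n)) • ro v u)).le_of_opNorm_le
        (hf.maps _ (norm_tro hu hv (ht1 (φ1 (φ2 n))))).le ((τ - t (φ1 (φ2 n))) • K1 v)
      linarith
  have hrng : ∀ a b : E, Set.range ![a, b] = {a, b} := fun a b => by
    simp [Matrix.range_cons, Set.pair_comm]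
  have hspan : ∀ a ∈ X, ∀ b ∈ X, LinearIndependent ℂ ![a, b] → X = Submodule.span ℂ {a, b} := by
    intro a ha b hb hab
    symm
    apply Submodule.eq_of_le_of_finrank_le
    · rw [Submodule.span_le]
      rintro x (rfl | rfl) <;> assumption
    · have := finrank_span_eq_card hab
      rw [hrng, Fintype.card_fin] at this
      rw [this]; exact hXd
  have hX2 : X ≤ Kc f 0 (sV 0 u (innerSL ℂ v)) := by
    intro w hw Z hZ
    have hZ' : Adm v u Z := by
      have := adm_of_sV hu hv (t := 0) (by simpa using hZ)
      simpa using this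
    have := disc_zero (δ := fun t : ℂ => f (Z + t • ro v u) w - f (t • ro v u) w) ?_ ?_ 0 (by simp)
    · simpa [sub_eq_zero] using this
    · have hev : ∀ g : ℂ → (U →L[ℂ] G), Differentiable ℂ g → (∀ t ∈ ball (0:ℂ) 1, ‖g t‖ < 1) →
          DifferentiableOn ℂ (fun t => f (g t) w) (ball 0 1) := by
        intro g hg hg1
        have := hf.diff.comp hg.differentiableOn (fun t ht => by simpa using hg1 t ht)
        exact (ContinuousLinearMap.apply ℂ F w).differentiable.comp_differentiableOn this
      refine (hev _ (by fun_prop) fun t ht => ?_).sub (hev _ (by fun_prop) fun t ht => ?_)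
      · exact norm_face_lt hu hv hZ' (by simpa using ht)
      · exact norm_tro hu hv (by simpa using ht)
    · intro t ht1 ht2
      obtain ⟨φ, hφ, a, ha, b, hb, hab, hlim⟩ := key t ht1 ht2
      refine ⟨φ, hφ, ?_⟩
      rw [hspan a ha b hb hab, Submodule.mem_span_pair] at hw
      obtain ⟨c, d, rfl⟩ := hw
      have := ((hlim Z hZ').1.const_smul c).add ((hlim Z hZ').2.const_smul d)
      simp only [smul_zero, add_zero] at this
      refine this.congr fun n => ?_
      simp only [map_add, map_smul, smul_sub]
      abel
  obtain ⟨φ, hφ, a, ha, b, hb, hab, -⟩ := key (fun n => 1 - 1 / ((n : ℂ) + 1)) (fun n => by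
      have : (1 - 1 / ((n : ℂ) + 1)) = ((1 - 1 / ((n : ℝ) + 1) : ℝ) : ℂ) := by push_cast; rfl
      rw [this, Complex.norm_real, Real.norm_of_nonneg]
      · have : 0 < 1 / ((n:ℝ) + 1) := by positivity
        linarith
      · have : 1 / ((n:ℝ) + 1) ≤ 1 := by
          rw [div_le_one (by positivity)]; linarith [Nat.cast_nonneg (α := ℝ) n]
        linarith) (by
      have h0 : Tendsto (fun n : ℕ => (1 : ℂ) - 1 / ((n : ℂ) + 1)) atTop (𝓝 (1 - 0)) :=
        tendsto_const_nhds.sub (by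
          exact tendsto_one_div_add_atTop_nhds_zero_nat (𝕜 := ℂ))
      simpa using h0.norm)
  have h3 := hab.fintype_card_le_finrank
  have e1 := finrank_span_eq_card hab
  rw [hrng, Fintype.card_fin] at e1
  rw [← hspan a ha b hb hab] at e1
  have := Submodule.finrank_mono hX2
  omega
end TypeI

end

section
open Matrix
open scoped ComplexOrder
open Set Filter Topology Metric
set_option linter.unusedSectionVars false
set_option linter.unusedSimpArgs false
set_option linter.style.haveILetI false
set_option linter.unusedVariables false
set_option linter.deprecated false

namespace TypeI

variable {U G E F : Type*}
  [NormedAddCommGroup U] [InnerProductSpace ℂ U] [FiniteDimensional ℂ U]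
  [NormedAddCommGroup G] [InnerProductSpace ℂ G] [FiniteDimensional ℂ G]
  [NormedAddCommGroup E] [InnerProductSpace ℂ E] [FiniteDimensional ℂ E]
  [NormedAddCommGroup F] [InnerProductSpace ℂ F] [FiniteDimensional ℂ F]


theorem stage2_base {f : (U →L[ℂ] G) → (E →L[ℂ] F)} (hf : GM f)
    {A : U →ₗ[ℂ] E} {K1 : G →ₗ[ℂ] E} {K2 : G →ₗ[ℂ] F} (hA : Function.Injective A)
    (h3 : 3 ≤ Module.finrank ℂ U)
    (hEU : Module.finrank ℂ E ≤ Module.finrank ℂ U + 1)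
    (hJ : ∀ Y, ‖Y‖ < 1 → ∀ u, f Y (A u + K1 (Y u)) = K2 (Y u))
    {v1 : G} {u1 : U} (hu1 : ‖u1‖ = 1) (hv1 : ‖v1‖ = 1)
    (hdim : Module.finrank ℂ (Kc f 0 (sV 0 u1 (innerSL ℂ v1))) ≤ 1) :
    ∃ c : ℝ, 0 < c ∧ (∀ u, ‖A u‖ ^ 2 = c * ‖u‖ ^ 2) ∧
      (∀ u v, inner ℂ (A u) (K1 v) = (0 : ℂ)) ∧
      (∀ v, ‖K2 v‖ ^ 2 = c * ‖v‖ ^ 2 + ‖K1 v‖ ^ 2) := by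
  have hu10 : u1 ≠ 0 := by rintro rfl; simp at hu1
  have hv10 : v1 ≠ 0 := by rintro rfl; simp at hv1
  have := FiniteDimensional.complete ℂ U
  have := FiniteDimensional.complete ℂ E
  have hAc : Continuous A := A.continuous_of_finiteDimensional
  have hK1c : Continuous K1 := K1.continuous_of_finiteDimensional
  have hγ : innerSL ℂ v1 ≠ 0 := by
    intro h
    have : innerSL ℂ v1 v1 = 0 := by rw [h]; simp
    simp [hv10] at this
  let nu : U → U := fun u => ((‖u‖⁻¹ : ℝ) : ℂ) • u
  let nv : G → G := fun v => ((‖v‖⁻¹ : ℝ) : ℂ) • v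
  have hnu1 : ∀ u, u ≠ 0 → ‖nu u‖ = 1 := fun u hu => by simp [nu, norm_smul, hu]
  have hnv1 : ∀ v, v ≠ 0 → ‖nv v‖ = 1 := fun u hu => by simp [nv, norm_smul, hu]
  have hnuc : ContinuousAt nu u1 := by
    refine ContinuousAt.smul ?_ continuousAt_id
    exact Complex.continuous_ofReal.continuousAt.comp
      (continuous_norm.continuousAt.inv₀ (by simp [hu10]))
  have hnvc : ContinuousAt nv v1 := by
    refine ContinuousAt.smul ?_ continuousAt_id
    exact Complex.continuous_ofReal.continuousAt.comp
      (continuous_norm.continuousAt.inv₀ (by simp [hv10]))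
  have hnuu : nu u1 = u1 := by simp [nu, hu1]
  have hnvv : nv v1 = v1 := by simp [nv, hv1]
  have hcl := (closed_V hf.diff.continuousOn (Y := (0 : U →L[ℂ] G)) (by simp) hu10 hγ).eventually_finrank_le
  have hroc : Continuous (fun x : G × U => ro x.1 x.2) := by
    unfold ro
    fun_prop
  have hcont : Tendsto (fun x : ℂ × U × G => ((x.1 • ro (nv x.2.2) (nu x.2.1), nu x.2.1,
      innerSL ℂ (nv x.2.2)) : (U →L[ℂ] G) × U × (G →L[ℂ] ℂ))) (𝓝 (0, u1, v1))
      (𝓝 (0, u1, innerSL ℂ v1)) := by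
    have a1 : Tendsto (fun x : ℂ × U × G => nu x.2.1) (𝓝 (0, u1, v1)) (𝓝 u1) := by
      have : ContinuousAt (fun x : ℂ × U × G => nu x.2.1) (0, u1, v1) :=
        ContinuousAt.comp (f := fun x : ℂ × U × G => x.2.1) (x := (0, u1, v1)) hnuc (by fun_prop)
      simpa [ContinuousAt, hnuu] using this
    have a2 : Tendsto (fun x : ℂ × U × G => nv x.2.2) (𝓝 (0, u1, v1)) (𝓝 v1) := by
      have : ContinuousAt (fun x : ℂ × U × G => nv x.2.2) (0, u1, v1) :=
        ContinuousAt.comp (f := fun x : ℂ × U × G => x.2.2) (x := (0, u1, v1)) hnvc (by fun_prop)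
      simpa [ContinuousAt, hnvv] using this
    refine Tendsto.prodMk_nhds ?_ (Tendsto.prodMk_nhds a1 ?_)
    · have b1 : Tendsto (fun x : ℂ × U × G => x.1) (𝓝 (0, u1, v1)) (𝓝 0) :=
        (continuous_fst.tendsto _)
      have b2 := (hroc.tendsto (v1, u1)).comp (a2.prodMk_nhds a1)
      simpa using b1.smul b2
    · exact ((innerSL ℂ).continuous.tendsto v1).comp a2
  have hne : ∀ᶠ x : (U →L[ℂ] G) × U × (G →L[ℂ] ℂ) in 𝓝 (0, u1, innerSL ℂ v1),
      A x.2.1 + K1 (x.1 x.2.1) ≠ 0 := by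
    have hc : Continuous (fun x : (U →L[ℂ] G) × U × (G →L[ℂ] ℂ) =>
        A x.2.1 + K1 (x.1 x.2.1)) := by fun_prop
    refine hc.continuousAt.eventually_ne ?_
    simp only [ContinuousLinearMap.zero_apply, map_zero, add_zero]
    intro h
    exact hu10 (hA (by rw [h, map_zero]))
  have hev : ∀ᶠ x : ℂ × U × G in 𝓝 (0, u1, v1), ‖x.1‖ < 1 ∧ x.2.1 ≠ 0 ∧ x.2.2 ≠ 0 ∧
      Module.finrank ℂ (Kc f (x.1 • ro (nv x.2.2) (nu x.2.1))
        (sV (x.1 • ro (nv x.2.2) (nu x.2.1)) (nu x.2.1) (innerSL ℂ (nv x.2.2)))) ≤ 1 ∧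
      A (nu x.2.1) + K1 ((x.1 • ro (nv x.2.2) (nu x.2.1)) (nu x.2.1)) ≠ 0 := by
    have c1 : ∀ᶠ x : ℂ × U × G in 𝓝 (0, u1, v1), ‖x.1‖ < 1 := by
      have hc : Continuous (fun x : ℂ × U × G => ‖x.1‖) := by fun_prop
      exact hc.continuousAt.eventually_lt continuousAt_const (by simp)
    have c2 : ∀ᶠ x : ℂ × U × G in 𝓝 (0, u1, v1), x.2.1 ≠ 0 := by
      have hc : Continuous (fun x : ℂ × U × G => x.2.1) := by fun_prop
      exact hc.continuousAt.eventually_ne hu10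
    have c3 : ∀ᶠ x : ℂ × U × G in 𝓝 (0, u1, v1), x.2.2 ≠ 0 := by
      have hc : Continuous (fun x : ℂ × U × G => x.2.2) := by fun_prop
      exact hc.continuousAt.eventually_ne hv10
    filter_upwards [c1, c2, c3, hcont.eventually hcl, hcont.eventually hne] with x x1 x2 x3 x4 x5
    exact ⟨x1, x2, x3, x4.trans hdim, x5⟩
  -- extract product neighbourhoods
  obtain ⟨T, hT, O, hO, hTO⟩ := mem_nhds_prod_iff.mp hev
  obtain ⟨OU, OG, hOU, hOU1, hOG, hOG1, hOO⟩ := mem_nhds_prod_iff'.mp hO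
  have hP : ∀ t ∈ T, ∀ u ∈ OU, ∀ v ∈ OG, ‖t‖ < 1 ∧ u ≠ 0 ∧ v ≠ 0 ∧
      Module.finrank ℂ (Kc f (t • ro (nv v) (nu u))
        (sV (t • ro (nv v) (nu u)) (nu u) (innerSL ℂ (nv v)))) ≤ 1 ∧
      A (nu u) + K1 ((t • ro (nv v) (nu u)) (nu u)) ≠ 0 := fun t ht u hu v hv =>
    hTO (show (t, u, v) ∈ T ×ˢ O from ⟨ht, hOO ⟨hu, hv⟩⟩)
  have h0T : (0 : ℂ) ∈ T := mem_of_mem_nhds hT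
  obtain ⟨t1, ht1, ht10⟩ : ∃ t ∈ T, t ≠ 0 := by
    have : ∀ᶠ t in 𝓝[≠] (0 : ℂ), t ∈ T ∧ t ≠ 0 :=
      (nhdsWithin_le_nhds hT |> fun h => h : ∀ᶠ t in 𝓝[≠] (0:ℂ), t ∈ T).and
        self_mem_nhdsWithin
    exact this.exists
  have horth : ∀ t ∈ T, ∀ u ∈ OU, ∀ v ∈ OG, ∀ u', inner ℂ u u' = (0 : ℂ) →
      inner ℂ (A u') (A (nu u) + t • K1 (nv v)) = (0 : ℂ) := by
    intro t ht u hu v hv u' huu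
    obtain ⟨p1, p2, p3, p4, p5⟩ := hP t ht u hu v hv
    rw [ro_ne_zero_apply (hnu1 u p2), K1.map_smul] at p5
    refine orth1 hf hJ (hnu1 u p2) (hnv1 v p3) p1 p4 p5 u' ?_
    simp [nu, inner_smul_left, huu]
  have hAA : ∀ u ∈ OU, ∀ u', inner ℂ u u' = (0 : ℂ) → inner ℂ (A u') (A u) = (0 : ℂ) := by
    intro u hu u' huu
    have := horth 0 h0T u hu v1 hOG1 u' huu
    simp only [nu, zero_smul, add_zero, map_smul, inner_smul_right] at this
    rcases mul_eq_zero.mp this with h | h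
    · have p2 := (hP 0 h0T u hu v1 hOG1).2.1
      simp [p2] at h
    · exact h
  have hAK : ∀ u ∈ OU, ∀ v ∈ OG, ∀ u', inner ℂ u u' = (0 : ℂ) →
      inner ℂ (A u') (K1 v) = (0 : ℂ) := by
    intro u hu v hv u' huu
    have a1 := horth 0 h0T u hu v hv u' huu
    have a2 := horth t1 ht1 u hu v hv u' huu
    have p3 := (hP 0 h0T u hu v hv).2.2.1
    rw [inner_add_right] at a1 a2
    simp only [zero_smul, inner_zero_right, add_zero] at a1
    rw [a1, zero_add, inner_smul_right] at a2
    have a3 := (mul_eq_zero.mp a2).resolve_left ht10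
    simp only [nv, map_smul, inner_smul_right] at a3
    rcases mul_eq_zero.mp a3 with h | h
    · simp [p3] at h
    · exact h
  -- orthogonal complement of orthogonal complement of a line
  have hline : ∀ u x : U, u ≠ 0 → (∀ u', inner ℂ u u' = (0 : ℂ) → inner ℂ u' x = (0 : ℂ)) →
      ∃ c : ℂ, x = c • u := by
    intro u x hu h
    have huu : (inner ℂ u u : ℂ) ≠ 0 := by simp [hu]
    refine ⟨inner ℂ u x / inner ℂ u u, ?_⟩
    set y := x - (inner ℂ u x / inner ℂ u u : ℂ) • u with hy
    have h1 : inner ℂ u y = (0 : ℂ) := by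
      rw [hy, inner_sub_right, inner_smul_right, div_mul_cancel₀ _ huu, sub_self]
    have h2 := h y h1
    have h4 : inner ℂ y u = (0 : ℂ) := by rw [← inner_conj_symm, h1, map_zero]
    have h5 : inner ℂ y y = (0 : ℂ) := by
      nth_rewrite 2 [hy]
      rw [inner_sub_right, inner_smul_right, h2, h4, mul_zero, sub_self]
    have := inner_self_eq_zero.mp h5
    exact sub_eq_zero.mp this
  set Q : U →ₗ[ℂ] U := LinearMap.adjoint A ∘ₗ A with hQ
  have hOne : OU.Nonempty := ⟨u1, hOU1⟩
  have hOGne : OG.Nonempty := ⟨v1, hOG1⟩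
  obtain ⟨c, hc⟩ := proportional (V := U) LinearMap.id Q Function.injective_id hOU hOne (by
    intro u hu
    refine hline u (Q u) (hP 0 h0T u hu v1 hOG1).2.1 fun u' huu => ?_
    rw [hQ, LinearMap.comp_apply, LinearMap.adjoint_inner_right]
    exact hAA u hu u' huu)
  have hcc : ∀ u u', inner ℂ (A u) (A u') = c * inner ℂ u u' := by
    intro u u'
    rw [← LinearMap.adjoint_inner_right]
    have := hc u'
    rw [hQ, LinearMap.comp_apply] at this
    rw [this, LinearMap.id_apply, inner_smul_right]
  have hcr : c = ((‖A u1‖ ^ 2 : ℝ) : ℂ) := by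
    have := hcc u1 u1
    rw [inner_self_eq_norm_sq_to_K, inner_self_eq_norm_sq_to_K, hu1] at this
    simp at this
    rw [← this]; push_cast; rfl
  have hAn : ∀ u, ‖A u‖ ^ 2 = ‖A u1‖ ^ 2 * ‖u‖ ^ 2 := by
    intro u
    have := hcc u u
    rw [inner_self_eq_norm_sq_to_K, inner_self_eq_norm_sq_to_K, hcr] at this
    have h : ((‖A u‖ ^ 2 : ℝ) : ℂ) = ((‖A u1‖ ^ 2 * ‖u‖ ^ 2 : ℝ) : ℂ) := by
      push_cast
      push_cast at this
      exact this
    exact Complex.ofReal_injective h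
  have hAK0 : ∀ v, LinearMap.adjoint A (K1 v) = 0 := by
    have hon : ∀ v ∈ OG, LinearMap.adjoint A (K1 v) = 0 := by
      intro v hv
      obtain ⟨b, hb⟩ := basis_in_open hOU hOne
      have hbb : ∀ i, ∃ c : ℂ, LinearMap.adjoint A (K1 v) = c • b i := by
        intro i
        refine hline (b i) _ (b.ne_zero i) fun u' huu => ?_
        rw [LinearMap.adjoint_inner_right]
        exact hAK (b i) (hb i) v hv u' huu
      let i0 : Fin (Module.finrank ℂ U) := ⟨0, by omega⟩
      let i1 : Fin (Module.finrank ℂ U) := ⟨1, by omega⟩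
      obtain ⟨c0, hc0⟩ := hbb i0
      obtain ⟨c1, hc1⟩ := hbb i1
      have hi : i0 ≠ i1 := by simp [i0, i1]
      have := congrArg (fun x => b.repr x i0) (hc0.symm.trans hc1)
      simp [hi.symm, Finsupp.single_apply] at this
      rw [hc0, this, zero_smul]
    obtain ⟨b, hb⟩ := basis_in_open hOG hOGne
    have : LinearMap.adjoint A ∘ₗ K1 = 0 := b.ext fun i => by
      simpa using hon (b i) (hb i)
    intro v
    exact LinearMap.congr_fun this v
  have hAK1 : ∀ u v, inner ℂ (A u) (K1 v) = (0 : ℂ) := by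
    intro u v
    rw [← LinearMap.adjoint_inner_right, hAK0, inner_zero_right]
  have hAu1 : 0 < ‖A u1‖ ^ 2 := by
    have : A u1 ≠ 0 := fun h => hu10 (hA (by rw [h, map_zero]))
    positivity
  refine ⟨‖A u1‖ ^ 2, hAu1, hAn, hAK1, ?_⟩
  have hnull : ∀ v ∈ OG, ‖K2 v‖ ^ 2 = ‖A u1‖ ^ 2 * ‖v‖ ^ 2 + ‖K1 v‖ ^ 2 := by
    intro v hv
    obtain ⟨-, p2, p3, p4, -⟩ := hP 0 h0T u1 hOU1 v hv
    rw [zero_smul, hnuu] at p4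
    have := null1 hf hA hEU hJ (fun u u' h => by rw [hcc, h, mul_zero]) hAK1 hu1 (hnv1 v p3) p4
    simp only [nv, map_smul, norm_smul, mul_pow] at this
    simp only [Complex.norm_real, norm_inv, norm_norm] at this
    have hv0 : 0 < ‖v‖ := norm_pos_iff.mpr p3
    field_simp at this
    linarith
  -- parallelogram law
  intro w
  let q : G → ℝ := fun v => ‖K2 v‖ ^ 2 - (‖A u1‖ ^ 2 * ‖v‖ ^ 2 + ‖K1 v‖ ^ 2)
  have hq0 : ∀ v ∈ OG, q v = 0 := fun v hv => by simp [q, hnull v hv]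
  have hqp : ∀ x y, q (x + y) + q (x - y) = 2 * q x + 2 * q y := by
    intro x y
    have a1 := parallelogram_law_with_norm ℂ (K2 x) (K2 y)
    have a2 := parallelogram_law_with_norm ℂ (K1 x) (K1 y)
    have a3 := parallelogram_law_with_norm ℂ x y
    simp only [q, map_add, map_sub, pow_two]
    linear_combination a1 - ‖A u1‖ * ‖A u1‖ * a3 - a2
  have hsm : ∀ᶠ s : ℂ in 𝓝[≠] 0, (v1 + s • w ∈ OG ∧ v1 - s • w ∈ OG) ∧ s ≠ 0 := by
    refine Filter.Eventually.and (nhdsWithin_le_nhds ?_) self_mem_nhdsWithin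
    have d1 : Continuous (fun s : ℂ => v1 + s • w) := by fun_prop
    have d2 : Continuous (fun s : ℂ => v1 - s • w) := by fun_prop
    exact (d1.continuousAt.eventually_mem (hOG.mem_nhds (by simpa using hOG1))).and
      (d2.continuousAt.eventually_mem (hOG.mem_nhds (by simpa using hOG1)))
  obtain ⟨s, ⟨hs1, hs2⟩, hs0⟩ := hsm.exists
  have h6 := hqp v1 (s • w)
  rw [hq0 _ hs1, hq0 _ hs2, hq0 _ hOG1] at h6
  have h7 : q (s • w) = ‖s‖ ^ 2 * q w := by
    simp only [q, map_smul, norm_smul, mul_pow]; ring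
  rw [h7] at h6
  have h8 : 0 < ‖s‖ ^ 2 := by positivity
  have h9 : q w = 0 := by
    have : ‖s‖ ^ 2 * q w = 0 := by linarith
    exact (mul_eq_zero.mp this).resolve_left h8.ne'
  simp only [q] at h9
  linarith
end TypeI

end

section
open Matrix
open scoped ComplexOrder
open Set Filter Topology Metric
set_option linter.unusedSectionVars false
set_option linter.unusedSimpArgs false
set_option linter.style.haveILetI false
set_option linter.unusedVariables false
set_option linter.deprecated false

namespace TypeI

variable {U G E F : Type*}
  [NormedAddCommGroup U] [InnerProductSpace ℂ U] [FiniteDimensional ℂ U]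
  [NormedAddCommGroup G] [InnerProductSpace ℂ G] [FiniteDimensional ℂ G]
  [NormedAddCommGroup E] [InnerProductSpace ℂ E] [FiniteDimensional ℂ E]
  [NormedAddCommGroup F] [InnerProductSpace ℂ F] [FiniteDimensional ℂ F]


theorem transport_V {Y : U →L[ℂ] G} {u : U} {γ : G →L[ℂ] ℂ} (hY : ‖Y‖ < 1) (hu : u ≠ 0)
    (hγ : γ ≠ 0) {M : Mob U G} (hM : M.Base Y) :
    ∃ (u1 : U) (v1 : G), ‖u1‖ = 1 ∧ ‖v1‖ = 1 ∧ ∀ Z ∈ sV Y u γ, Adm v1 u1 (M.symm.map Z) := by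
  have h0 : ‖(0 : U →L[ℂ] G)‖ < 1 := by simp
  obtain ⟨x, hx⟩ := M.den_surj h0 u
  have hMx : M.M (x, 0) = (u, Y u) := by
    have := M.graph h0 x
    rw [hx, hM.map_zero] at this
    exact this
  have hx0 : x ≠ 0 := by rintro rfl; simp at hx; exact hu hx.symm
  let Λ : (U × G) →L[ℂ] ℂ := γ ∘L (ContinuousLinearMap.snd ℂ U G - Y ∘L ContinuousLinearMap.fst ℂ U G)
  have hΛ : ∀ p : U × G, Λ p = γ (p.2 - Y p.1) := fun p => by simp [Λ]
  have hΛ0 : ∀ y, Λ (M.M (y, 0)) = 0 := fun y => by rw [hΛ, hM y]; simp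
  let γt : G →L[ℂ] ℂ := Λ ∘L (M.M : (U × G) →L[ℂ] (U × G)) ∘L ContinuousLinearMap.inr ℂ U G
  have hγt : ∀ y c, Λ (M.M (y, c)) = γt c := by
    intro y c
    have : ((y, c) : U × G) = (y, 0) + (0, c) := by simp
    rw [this, map_add, map_add, hΛ0]
    simp [γt]
  have := FiniteDimensional.complete ℂ G
  set v := (InnerProductSpace.toDual ℂ G).symm γt with hv
  have hv' : ∀ c, inner ℂ v c = γt c := fun c => by simp [hv]
  have hv0 : v ≠ 0 := by
    intro h
    apply hγ
    ext c
    have h1 := hΛ (0, c)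
    have h2 : Λ (0, c) = 0 := by
      have : ((0, c) : U × G) = M.M ((M.M.symm (0, c)).1, (M.M.symm (0, c)).2) := by simp
      rw [this, hγt, ← hv', h]; simp
    simpa [h2] using h1.symm
  set u1 : U := ((‖x‖⁻¹ : ℝ) : ℂ) • x with hu1
  set v1 : G := ((‖v‖⁻¹ : ℝ) : ℂ) • v with hv1
  have hu1n : ‖u1‖ = 1 := by simp [hu1, norm_smul, hx0]
  have hv1n : ‖v1‖ = 1 := by simp [hv1, norm_smul, hv0]
  refine ⟨u1, v1, hu1n, hv1n, ?_⟩
  rintro Z ⟨hZ, hZu, hZγ⟩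
  refine ⟨M.symm.map_lt hZ, ?_, fun y => ?_⟩
  · have h1 := M.symm.graph hZ u
    rw [hZu, ← hMx] at h1
    have h2 : M.symm.M (M.M (x, 0)) = (x, 0) := by simp [Mob.symm]
    rw [h2, Prod.mk.injEq] at h1
    rw [← h1.1] at h1
    rw [hu1, map_smul, ← h1.2, smul_zero]
  · have h1 := M.graph (M.symm.map_lt hZ) y
    rw [M.map_symm hZ] at h1
    have h2 := hγt y (M.symm.map Z y)
    rw [h1, hΛ, map_sub, hZγ, sub_self, ← hv'] at h2
    rw [hv1, inner_smul_left, ← h2, mul_zero]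

theorem stage2 {f : (U →L[ℂ] G) → (E →L[ℂ] F)} (hf : GM f)
    (h3 : 3 ≤ Module.finrank ℂ U) (hEU : Module.finrank ℂ E ≤ Module.finrank ℂ U + 1)
    {Y2 : U →L[ℂ] G} {u2 : U} {γ : G →L[ℂ] ℂ} {JE : (U × G) →ₗ[ℂ] E} {JF : (U × G) →ₗ[ℂ] F}
    (hY2 : ‖Y2‖ < 1) (hu2 : u2 ≠ 0) (hγ : γ ≠ 0)
    (hdim : Module.finrank ℂ (Kc f Y2 (sV Y2 u2 γ)) ≤ 1)
    (hJ : ∀ Y, ‖Y‖ < 1 → ∀ u, f Y (JE (u, Y u)) = JF (u, Y u))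
    (hinj : ∀ u, JE (u, Y2 u) = 0 → u = 0) :
    ∃ c : ℝ, 0 < c ∧ ∀ x, ‖JE x‖ ^ 2 - ‖JF x‖ ^ 2 = c * (‖x.1‖ ^ 2 - ‖x.2‖ ^ 2) := by
  obtain ⟨M, hM⟩ := Mob.exists_base hY2
  obtain ⟨N, hN⟩ := Mob.exists_base (hf.maps _ hY2)
  have h0 : ‖(0 : U →L[ℂ] G)‖ < 1 := by simp
  have h0' : ‖(0 : E →L[ℂ] F)‖ < 1 := by simp
  obtain ⟨u1, v1, hu1, hv1, hadm⟩ := transport_V hY2 hu2 hγ hM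
  have hg := hf.conj M N.symm
  set g : (U →L[ℂ] G) → (E →L[ℂ] F) := fun Z => N.symm.map (f (M.map Z)) with hgdef
  have hg0 : g 0 = 0 := by
    simp only [hgdef]
    rw [hM.map_zero, ← hN.map_zero, N.symm_map h0']
  let Jt : (U × G) →ₗ[ℂ] (E × F) :=
    (N.symm.M : (E × F) →L[ℂ] (E × F)).toLinearMap ∘ₗ (JE.prod JF) ∘ₗ
      (M.M : (U × G) →L[ℂ] (U × G)).toLinearMap
  have hJt : ∀ x, Jt x = N.symm.M (JE (M.M x), JF (M.M x)) := fun x => rfl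
  have hJg : ∀ Z, ‖Z‖ < 1 → ∀ u, g Z (Jt (u, Z u)).1 = (Jt (u, Z u)).2 := by
    intro Z hZ u
    rw [hJt, M.graph hZ u, ← hJ _ (M.map_lt hZ), N.symm.graph (hf.maps _ (M.map_lt hZ))]
  let A : U →ₗ[ℂ] E := LinearMap.fst ℂ E F ∘ₗ Jt ∘ₗ LinearMap.inl ℂ U G
  let K1 : G →ₗ[ℂ] E := LinearMap.fst ℂ E F ∘ₗ Jt ∘ₗ LinearMap.inr ℂ U G
  let K2 : G →ₗ[ℂ] F := LinearMap.snd ℂ E F ∘ₗ Jt ∘ₗ LinearMap.inr ℂ U G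
  have hJu : ∀ u, Jt (u, 0) = (A u, 0) := by
    intro u
    have := hJg 0 h0 u
    rw [hg0] at this
    ext
    · rfl
    · simpa using this.symm
  have hJs : ∀ u c, Jt (u, c) = (A u + K1 c, K2 c) := by
    intro u c
    have : ((u, c) : U × G) = (u, 0) + (0, c) := by simp
    rw [this, map_add, hJu]
    ext
    · rfl
    · simp [K2]
  have hA : Function.Injective A := by
    rw [← LinearMap.ker_eq_bot, LinearMap.ker_eq_bot']
    intro u hu
    have h1 := hJu u
    rw [hu, hJt] at h1
    have h2 : (JE (M.M (u, 0)), JF (M.M (u, 0))) = (0, 0) := by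
      apply N.symm.M.injective
      rw [h1]; exact (map_zero N.symm.M).symm
    have h4 := M.graph h0 u
    rw [hM.map_zero, ContinuousLinearMap.zero_apply] at h4
    rw [h4, Prod.mk.injEq] at h2
    have h5 := hinj _ h2.1
    rw [h5, map_zero] at h4
    have h6 : ((u, 0) : U × G) = 0 := M.M.injective (by rw [h4]; simp)
    simpa using h6
  have hdim' : Module.finrank ℂ (Kc g 0 (sV 0 u1 (innerSL ℂ v1))) ≤ 1 := by
    refine le_trans ?_ hdim
    let L : E →ₗ[ℂ] E := LinearMap.fst ℂ E F ∘ₗ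
      (N.M : (E × F) →L[ℂ] (E × F)).toLinearMap ∘ₗ LinearMap.inl ℂ E F
    have hL : ∀ w, N.M (w, 0) = (L w, f Y2 (L w)) := by
      intro w
      have := N.graph h0' w
      rw [hN.map_zero, ContinuousLinearMap.zero_apply] at this
      have h1 : L w = N.den 0 w := (congrArg Prod.fst this :)
      rw [this, h1]
    have hLi : Function.Injective L := by
      rw [← LinearMap.ker_eq_bot, LinearMap.ker_eq_bot']
      intro w hw
      have h1 := hL w
      rw [hw, map_zero] at h1
      have h6 : ((w, 0) : E × F) = 0 := N.M.injective (by rw [h1]; simp)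
      simpa using h6
    have hmap : (Kc g 0 (sV 0 u1 (innerSL ℂ v1))).map L ≤ Kc f Y2 (sV Y2 u2 γ) := by
      rintro _ ⟨w, hw, rfl⟩ Z hZ
      have ha := hadm Z hZ
      have h1 : g (M.symm.map Z) w = g 0 w := hw _ ⟨ha.1, by simpa using ha.2.1, fun x => by
        simpa using ha.2.2 x⟩
      rw [hg0, ContinuousLinearMap.zero_apply] at h1
      simp only [hgdef] at h1
      rw [M.map_symm hZ.1] at h1
      have h2 := N.graph (N.symm.map_lt (hf.maps _ hZ.1)) w
      rw [h1, N.map_symm (hf.maps _ hZ.1), hL, Prod.mk.injEq] at h2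
      rw [h2.2, ← h2.1]
    calc _ = Module.finrank ℂ ((Kc g 0 (sV 0 u1 (innerSL ℂ v1))).map L) :=
          LinearEquiv.finrank_eq (Submodule.equivMapOfInjective L hLi _)
      _ ≤ _ := Submodule.finrank_mono hmap
  obtain ⟨c, hc, c1, c2, c3⟩ := stage2_base hg hA h3 hEU (K1 := K1) (K2 := K2) (by
    intro Z hZ u
    have := hJg Z hZ u
    rw [hJs] at this
    exact this) hu1 hv1 hdim'
  refine ⟨c, hc, fun x => ?_⟩
  have e1 := N.symm.pres (JE x, JF x)
  have e2 := M.pres (M.M.symm x)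
  rw [M.M.apply_symm_apply] at e2
  have e3 : N.symm.M (JE x, JF x) = Jt (M.M.symm x) := by rw [hJt, M.M.apply_symm_apply]
  rw [e3] at e1
  rw [e2]
  generalize M.M.symm x = y at e1 e2 e3 ⊢
  obtain ⟨u, d⟩ := y
  rw [hJs] at e1
  simp only at e1 ⊢
  rw [← e1, c3]
  have := norm_add_sq (𝕜 := ℂ) (A u) (K1 d)
  rw [c2 u d, c1] at this
  simp only [map_zero, mul_zero, add_zero] at this
  rw [this]; ring
end TypeI

end

section
open Matrix
open scoped ComplexOrder
open Set Filter Topology Metric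
set_option linter.unusedSectionVars false
set_option linter.unusedSimpArgs false
set_option linter.style.haveILetI false
set_option linter.unusedVariables false
set_option linter.deprecated false

namespace TypeI

variable {U G E F : Type*}
  [NormedAddCommGroup U] [InnerProductSpace ℂ U] [FiniteDimensional ℂ U]
  [NormedAddCommGroup G] [InnerProductSpace ℂ G] [FiniteDimensional ℂ G]
  [NormedAddCommGroup E] [InnerProductSpace ℂ E] [FiniteDimensional ℂ E]
  [NormedAddCommGroup F] [InnerProductSpace ℂ F] [FiniteDimensional ℂ F]


theorem stage3a {f : (U →L[ℂ] G) → (E →L[ℂ] F)} (hf : GM f)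
    {A : U →ₗ[ℂ] E} {K1 : G →ₗ[ℂ] E} {K2 : G →ₗ[ℂ] F}
    (hJ : ∀ Y, ‖Y‖ < 1 → ∀ u, f Y (A u + K1 (Y u)) = K2 (Y u))
    (hA : ∀ u, ‖A u‖ = ‖u‖) (hAK : ∀ u v, inner ℂ (A u) (K1 v) = (0 : ℂ))
    (hK : ∀ v, ‖K2 v‖ ^ 2 = ‖v‖ ^ 2 + ‖K1 v‖ ^ 2)
    {v : G} {u : U} (hu : ‖u‖ = 1) (hv : ‖v‖ = 1) {Z' : U →L[ℂ] G} (hZ' : Adm v u Z')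
    {e : E} (he : ∀ x, inner ℂ (A x) e = (0 : ℂ)) :
    ∀ t : ℂ, ‖t‖ < 1 → inner ℂ (K2 v) (f (Z' + t • ro v u) e) = inner ℂ (K1 v) e := by
  have hn : ∀ t : ℂ, ‖t‖ < 1 → ‖Z' + t • ro v u‖ < 1 := fun t ht => norm_face_lt hu hv hZ' ht
  intro t0 ht0
  have := disc_zero (δ := fun t : ℂ => inner ℂ (K2 v) (f (Z' + t • ro v u) e) - inner ℂ (K1 v) e)
    ?_ ?_ t0 ht0
  · exact sub_eq_zero.mp this
  · refine DifferentiableOn.sub_const ?_ _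
    have h1 : DifferentiableOn ℂ (fun t : ℂ => f (Z' + t • ro v u)) (ball 0 1) :=
      hf.diff.comp (g := f) (f := fun t : ℂ => Z' + t • ro v u) (by fun_prop)
        (fun t ht => by simpa using hn t (by simpa using ht))
    exact ((innerSL ℂ (K2 v)) ∘L (ContinuousLinearMap.apply ℂ F e)).differentiable.comp_differentiableOn h1
  · intro t ht1 ht2
    obtain ⟨τ, -, φ1, hφ1, hτ⟩ := (isCompact_closedBall (0 : ℂ) 1).tendsto_subseq
      (x := t) (fun n => by simpa using (ht1 n).le)
    have hτ1 : ‖τ‖ = 1 := tendsto_nhds_unique hτ.norm (ht2.comp hφ1.tendsto_atTop)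
    obtain ⟨A0, φ2, hφ2, hA0⟩ := hf.subseq (Z := fun n => Z' + t (φ1 n) • ro v u)
      (fun n => hn _ (ht1 _))
    have hA01 : ‖A0‖ ≤ 1 := by
      refine le_of_tendsto hA0.norm (Eventually.of_forall fun n => ?_)
      exact (hf.maps _ (hn _ (ht1 _))).le
    have hτ' : Tendsto (fun n => t (φ1 (φ2 n))) atTop (𝓝 τ) := hτ.comp hφ2.tendsto_atTop
    refine ⟨φ1 ∘ φ2, hφ1.comp hφ2, ?_⟩
    have hA0w : Tendsto (fun n => f (Z' + t (φ1 (φ2 n)) • ro v u) e) atTop (𝓝 (A0 e)) :=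
      ((ContinuousLinearMap.apply ℂ F e).continuous.tendsto A0).comp hA0
    set b : E := A u + τ • K1 v with hb
    have hbn : ‖b‖ ^ 2 = 1 + ‖K1 v‖ ^ 2 := by
      have := norm_add_sq (𝕜 := ℂ) (A u) (τ • K1 v)
      rw [inner_smul_right, hAK, norm_smul, hτ1, hA, hu] at this
      simpa using this
    have hA0b : A0 b = τ • K2 v := by
      have e1 : Tendsto (fun n => f (Z' + t (φ1 (φ2 n)) • ro v u) (A u + t (φ1 (φ2 n)) • K1 v)) atTop
          (𝓝 (A0 b)) :=
        tendsto_clm hA0 (tendsto_const_nhds.add (hτ'.smul_const _))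
      refine tendsto_nhds_unique e1 ?_
      have : ∀ n, f (Z' + t (φ1 (φ2 n)) • ro v u) (A u + t (φ1 (φ2 n)) • K1 v)
          = t (φ1 (φ2 n)) • K2 v := by
        intro n
        have := hJ _ (hn _ (ht1 (φ1 (φ2 n)))) u
        rw [ContinuousLinearMap.add_apply, hZ'.2.1, zero_add, ro_ne_zero_apply hu] at this
        rw [K1.map_smul, K2.map_smul] at this
        exact this
      simp only [this]
      exact hτ'.smul_const _
    have hat := attain hA01 (w := b) (by
      have : ‖A0 b‖ ^ 2 = ‖b‖ ^ 2 := by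
        rw [hA0b, norm_smul, hτ1, one_mul, hK, hbn, hv]; simp
      exact (sq_eq_sq₀ (norm_nonneg _) (norm_nonneg _)).mp this) e
    rw [hA0b, hb, inner_smul_left, inner_add_left, he, inner_smul_left, zero_add] at hat
    have hτ0 : (starRingEnd ℂ) τ ≠ 0 := by
      intro h
      have : τ = 0 := by simpa using h
      rw [this] at hτ1; simp at hτ1
    have hfin := mul_left_cancel₀ hτ0 hat
    have h5 := ((innerSL ℂ (K2 v)).continuous.tendsto _).comp hA0w
    have h6 := h5.sub_const (inner ℂ (K1 v) e : ℂ)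
    simp only [innerSL_apply_apply, hfin, sub_self] at h6
    exact h6

theorem stage3b {ψ : (U →L[ℂ] G) → G} (hU : 0 < Module.finrank ℂ U)
    (hd : DifferentiableOn ℂ ψ (ball 0 1))
    (h : ∀ Z : U →L[ℂ] G, ‖Z‖ < 1 → ∀ z, inner ℂ (Z z) (ψ Z) = (0 : ℂ)) :
    ∀ Z : U →L[ℂ] G, ‖Z‖ < 1 → ψ Z = 0 := by
  intro Z hZ
  have key : ∀ (W : U →L[ℂ] G) (z : U), inner ℂ (W z) (ψ Z) = (0 : ℂ) := by
    intro W z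
    have hl : Tendsto (fun s : ℂ => Z + s • W) (𝓝 0) (𝓝 Z) := by
      have : Continuous (fun s : ℂ => Z + s • W) := by fun_prop
      simpa using this.tendsto 0
    have hev : ∀ᶠ s : ℂ in 𝓝 0, ‖Z + s • W‖ < 1 := by
      have := hl.norm
      exact this.eventually_lt_const hZ
    have hψ : DifferentiableAt ℂ ψ Z := hd.differentiableAt (isOpen_ball.mem_nhds (by simpa using hZ))
    have hg : DifferentiableAt ℂ (fun s : ℂ => (inner ℂ (Z z) (ψ (Z + s • W)) : ℂ)) 0 := by
      have h1 : DifferentiableAt ℂ (fun s : ℂ => ψ (Z + s • W)) 0 := by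
        refine DifferentiableAt.comp (g := ψ) (f := fun s : ℂ => Z + s • W) (0:ℂ) ?_ (by fun_prop)
        simpa using hψ
      exact (innerSL ℂ (Z z)).differentiableAt.comp (0:ℂ) h1
    set g : ℂ → ℂ := fun s : ℂ => (inner ℂ (Z z) (ψ (Z + s • W)) : ℂ) with hgd
    set k : ℂ → ℂ := fun s : ℂ => (inner ℂ (W z) (ψ (Z + s • W)) : ℂ) with hkd
    have hk : Tendsto k (𝓝 0) (𝓝 (inner ℂ (W z) (ψ Z))) := by
      have := ((innerSL ℂ (W z)).continuous.tendsto _).comp (hψ.continuousAt.tendsto.comp hl)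
      exact this
    have hgk : ∀ᶠ s : ℂ in 𝓝 0, g s = - ((starRingEnd ℂ) s * k s) := by
      filter_upwards [hev] with s hs
      have := h _ hs z
      rw [ContinuousLinearMap.add_apply, ContinuousLinearMap.smul_apply, inner_add_left,
        inner_smul_left] at this
      exact eq_neg_of_add_eq_zero_left this
    have hg0 : g 0 = 0 := by simpa [hgd] using h Z hZ z
    have hder := hg.hasDerivAt.tendsto_slope_zero
    have hlim : ∀ θ : ℂ, θ ≠ 0 → deriv g 0 * θ = - ((starRingEnd ℂ) θ * inner ℂ (W z) (ψ Z)) := by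
      intro θ hθ
      have hs : Tendsto (fun r : ℝ => (r : ℂ) * θ) (𝓝[≠] 0) (𝓝[≠] 0) := by
        refine tendsto_nhdsWithin_iff.mpr ⟨?_, ?_⟩
        · have : Continuous (fun r : ℝ => (r : ℂ) * θ) := by fun_prop
          have := this.tendsto 0
          simp only [Complex.ofReal_zero, zero_mul] at this
          exact this.mono_left nhdsWithin_le_nhds
        · filter_upwards [self_mem_nhdsWithin] with r hr
          simpa [hθ] using hr
      have h1 := (hder.comp hs).mul_const θ
      have h2 : Tendsto (fun r : ℝ => - ((starRingEnd ℂ) θ * k ((r : ℂ) * θ))) (𝓝[≠] 0)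
          (𝓝 (- ((starRingEnd ℂ) θ * inner ℂ (W z) (ψ Z)))) := by
        exact ((hk.comp (hs.mono_right nhdsWithin_le_nhds)).const_mul _).neg
      refine tendsto_nhds_unique h1 (h2.congr' ?_)
      have h3 := (hs.mono_right nhdsWithin_le_nhds).eventually hgk
      filter_upwards [h3, self_mem_nhdsWithin] with r hr hr0
      have hr0' : (r : ℂ) ≠ 0 := by simpa using hr0
      simp only [Function.comp_apply, zero_add, hg0, sub_zero, smul_eq_mul]
      rw [hr, map_mul, Complex.conj_ofReal]
      field_simp
    have e1 := hlim 1 one_ne_zero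
    have e2 := hlim Complex.I Complex.I_ne_zero
    simp only [map_one, one_mul, mul_one, Complex.conj_I] at e1 e2
    rw [e1] at e2
    have : (2 * Complex.I) * inner ℂ (W z) (ψ Z) = 0 := by linear_combination -e2
    exact (mul_eq_zero.mp this).resolve_left (by simp)
  have : Nontrivial U := Module.finrank_pos_iff.mp hU
  obtain ⟨z, hz⟩ := exists_ne (0 : U)
  obtain ⟨ξ, hξ⟩ := exists_one hz
  have h1 := key (ξ.smulRight (ψ Z)) z
  simp only [ContinuousLinearMap.smulRight_apply, hξ, one_smul] at h1
  exact inner_self_eq_zero.mp h1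

/-- orthogonality along singular vectors implies orthogonality to the range. -/
theorem sing_orth {Z : U →L[ℂ] G} (hZ : ‖Z‖ < 1) {y : G}
    (h : ∀ (v : G) (u : U) (t : ℂ), ‖u‖ = 1 → ‖v‖ = 1 → ‖t‖ < 1 → Adm v u (Z - t • ro v u) →
      inner ℂ v y = (0 : ℂ)) (z : U) : inner ℂ (Z z) y = (0 : ℂ) := by
  have := FiniteDimensional.complete ℂ U
  have := FiniteDimensional.complete ℂ G
  let T : U →ₗ[ℂ] U := LinearMap.adjoint Z.toLinearMap ∘ₗ Z.toLinearMap
  have hT : T.IsSymmetric := by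
    intro x y
    simp only [T, LinearMap.comp_apply]
    rw [LinearMap.adjoint_inner_left, LinearMap.adjoint_inner_right]
  let b := hT.eigenvectorBasis rfl
  have hb : ∀ i, inner ℂ (Z (b i)) y = (0 : ℂ) := by
    intro i
    by_cases hzb : Z (b i) = 0
    · rw [hzb, inner_zero_left]
    have hb1 : ‖b i‖ = 1 := b.norm_eq_one i
    set r : ℝ := ‖Z (b i)‖ with hr
    have hr0 : 0 < r := norm_pos_iff.mpr hzb
    have hrc : (r : ℂ) ≠ 0 := by exact_mod_cast hr0.ne'
    set v : G := (r : ℂ)⁻¹ • Z (b i) with hv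
    have hv1 : ‖v‖ = 1 := by
      rw [hv, norm_smul, norm_inv, Complex.norm_real, norm_norm]
      exact inv_mul_cancel₀ hr0.ne'
    have hr1 : r < 1 := by
      have := Z.le_opNorm (b i)
      rw [hb1, mul_one] at this
      exact this.trans_lt hZ
    have hZi : ∀ x, inner ℂ (Z (b i)) (Z x) = ((r : ℂ) ^ 2) * inner ℂ (b i) x := by
      have h0 : ∀ x, inner ℂ (Z (b i)) (Z x) = (hT.eigenvalues rfl i : ℂ) * inner ℂ (b i) x := by
        intro x
        have h1 : inner ℂ (T (b i)) x = inner ℂ (Z (b i)) (Z x) := by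
          simp only [T, LinearMap.comp_apply]
          rw [LinearMap.adjoint_inner_left]; rfl
        rw [← h1, hT.apply_eigenvectorBasis rfl i, inner_smul_left]
        simp [b]
      have h2 := h0 (b i)
      rw [inner_self_eq_norm_sq_to_K, inner_self_eq_norm_sq_to_K, hb1] at h2
      intro x
      rw [h0 x, ← hr] at *
      simp at h2
      rw [h2]
    have hadm : Adm v (b i) (Z - (r : ℂ) • ro v (b i)) := by
      refine adm_of_sV hb1 hv1 ⟨hZ, ?_, fun x => ?_⟩
      · rw [ro_ne_zero_apply hb1, hv, smul_smul, mul_inv_cancel₀ hrc, one_smul]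
      · have hvv : inner ℂ v v = (1 : ℂ) := by rw [inner_self_eq_norm_sq_to_K, hv1]; simp
        simp only [innerSL_apply_apply, ContinuousLinearMap.smul_apply, ro_apply, inner_smul_right, hvv]
        rw [hv, inner_smul_left, hZi, map_inv₀, Complex.conj_ofReal]
        field_simp
    have := h v (b i) r hb1 hv1 (by rw [Complex.norm_real, Real.norm_of_nonneg hr0.le]; exact hr1) hadm
    rw [hv, inner_smul_left] at this
    refine (mul_eq_zero.mp this).resolve_left ?_
    simpa using hrc
  have hlin : (innerSL ℂ y).toLinearMap ∘ₗ Z.toLinearMap = 0 := by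
    refine b.toBasis.ext fun i => ?_
    have := hb i
    have h2 : inner ℂ y (Z (b i)) = (0 : ℂ) := by rw [← inner_conj_symm, this, map_zero]
    simpa using h2
  have := LinearMap.congr_fun hlin z
  rw [← inner_conj_symm]
  have h2 : inner ℂ y (Z z) = (0 : ℂ) := this
  rw [h2, map_zero]

theorem stage3 {f : (U →L[ℂ] G) → (E →L[ℂ] F)} (hf : GM f) (hf0 : f 0 = 0)
    (h3 : 0 < Module.finrank ℂ U) (hG1 : 0 < Module.finrank ℂ G)
    {JE : (U × G) →ₗ[ℂ] E} {JF : (U × G) →ₗ[ℂ] F}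
    (hJ : ∀ Y, ‖Y‖ < 1 → ∀ u, f Y (JE (u, Y u)) = JF (u, Y u))
    {c : ℝ} (hc : 0 < c)
    (hH : ∀ x, ‖JE x‖ ^ 2 - ‖JF x‖ ^ 2 = c * (‖x.1‖ ^ 2 - ‖x.2‖ ^ 2)) :
    ∃ (A : U →ₗᵢ[ℂ] E) (B : G →ₗᵢ[ℂ] F), (∀ Z, ‖Z‖ < 1 → ∀ u, f Z (A u) = B (Z u)) ∧
      ∀ e, (∀ x, inner ℂ (A x) e = (0 : ℂ)) → ∀ Z, ‖Z‖ < 1 → ∀ x,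
        inner ℂ (B x) (f Z e) = (0 : ℂ) := by
  have := FiniteDimensional.complete ℂ U
  have := FiniteDimensional.complete ℂ G
  have := FiniteDimensional.complete ℂ F
  have hJF0 : ∀ u, JF (u, 0) = 0 := by
    intro u
    have := hJ 0 (by simp) u
    rw [hf0] at this
    simpa using this.symm
  set s : ℂ := (((Real.sqrt c)⁻¹ : ℝ) : ℂ) with hs
  have hsn : ‖s‖ ^ 2 = c⁻¹ := by
    rw [hs, Complex.norm_real, Real.norm_of_nonneg (by positivity), inv_pow, Real.sq_sqrt hc.le]
  let A : U →ₗ[ℂ] E := s • (JE ∘ₗ LinearMap.inl ℂ U G)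
  let K1 : G →ₗ[ℂ] E := s • (JE ∘ₗ LinearMap.inr ℂ U G)
  let K2 : G →ₗ[ℂ] F := s • (JF ∘ₗ LinearMap.inr ℂ U G)
  have hsplit : ∀ (u : U) (g : G), ((u, g) : U × G) = (u, 0) + (0, g) := fun u g => by simp
  have hE : ∀ u g, s • JE (u, g) = A u + K1 g := by
    intro u g
    rw [hsplit, map_add, smul_add]; rfl
  have hF : ∀ u g, s • JF (u, g) = K2 g := by
    intro u g
    rw [hsplit, map_add, hJF0, zero_add]; rfl
  have hq : ∀ u g, ‖A u + K1 g‖ ^ 2 - ‖K2 g‖ ^ 2 = ‖u‖ ^ 2 - ‖g‖ ^ 2 := by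
    intro u g
    rw [← hE, ← hF u g, norm_smul, norm_smul, mul_pow, mul_pow, ← mul_sub, hH, hsn]
    field_simp
  have hJ' : ∀ Y, ‖Y‖ < 1 → ∀ u, f Y (A u + K1 (Y u)) = K2 (Y u) := by
    intro Y hY u
    rw [← hE, ← hF u, map_smul, hJ Y hY]
  have hA2 : ∀ u, ‖A u‖ ^ 2 = ‖u‖ ^ 2 := fun u => by simpa using hq u 0
  have hA : ∀ u, ‖A u‖ = ‖u‖ := fun u =>
    (sq_eq_sq₀ (norm_nonneg _) (norm_nonneg _)).mp (hA2 u)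
  have hK : ∀ v, ‖K2 v‖ ^ 2 = ‖v‖ ^ 2 + ‖K1 v‖ ^ 2 := fun v => by
    have := hq 0 v
    simp only [map_zero, zero_add, norm_zero] at this
    linarith
  have hre : ∀ u v, (inner ℂ (A u) (K1 v) : ℂ).re = 0 := by
    intro u v
    have h1 := norm_add_sq (𝕜 := ℂ) (A u) (K1 v)
    have h2 := hq u v
    rw [h1, hK, hA2] at h2
    have : RCLike.re (inner ℂ (A u) (K1 v) : ℂ) = 0 := by linarith
    simpa using this
  have hAK : ∀ u v, inner ℂ (A u) (K1 v) = (0 : ℂ) := by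
    intro u v
    refine Complex.ext (hre u v) ?_
    have := hre (Complex.I • u) v
    rw [map_smul, inner_smul_left] at this
    simpa using this
  -- K1 vanishes
  have : Nontrivial U := Module.finrank_pos_iff.mp h3
  obtain ⟨u0, hu0⟩ := exists_norm_eq U (zero_le_one (α := ℝ))
  have hK1u : ∀ v, ‖v‖ = 1 → K1 v = 0 := by
    intro v hv
    have := stage3a hf hJ' hA hAK hK hu0 hv (Adm.zero v u0) (e := K1 v) (fun x => hAK x v) 0 (by simp)
    simp only [zero_smul, add_zero, hf0, ContinuousLinearMap.zero_apply, inner_zero_right] at this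
    exact inner_self_eq_zero.mp this.symm
  have hK1 : ∀ v, K1 v = 0 := by
    intro v
    by_cases hv : v = 0
    · rw [hv, map_zero]
    have := hK1u (((‖v‖⁻¹ : ℝ) : ℂ) • v) (by simp [norm_smul, hv])
    rw [map_smul] at this
    exact (smul_eq_zero.mp this).resolve_left (by simpa using hv)
  have hB : ∀ v, ‖K2 v‖ = ‖v‖ := fun v => by
    have := hK v
    rw [hK1, norm_zero] at this
    refine (sq_eq_sq₀ (norm_nonneg _) (norm_nonneg _)).mp ?_
    simpa using this
  refine ⟨⟨A, hA⟩, ⟨K2, hB⟩, ?_, ?_⟩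
  · intro Z hZ u
    have := hJ' Z hZ u
    rw [hK1, add_zero] at this
    exact this
  · intro e he
    have he' : ∀ x, inner ℂ (A x) e = (0 : ℂ) := he
    let ψ : (U →L[ℂ] G) → G := fun Z => LinearMap.adjoint K2 (f Z e)
    have h5 := stage3b (ψ := ψ) h3 ?_ ?_
    · intro Z hZ x
      change inner ℂ (K2 x) (f Z e) = (0 : ℂ)
      rw [← LinearMap.adjoint_inner_right]
      have := h5 Z hZ
      simp only [ψ] at this
      rw [this, inner_zero_right]
    · exact ((LinearMap.toContinuousLinearMap (LinearMap.adjoint K2)) ∘L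
        (ContinuousLinearMap.apply ℂ F e)).differentiable.comp_differentiableOn hf.diff
    · intro Z hZ z
      refine sing_orth hZ (fun v u t hu hv ht hadm => ?_) z
      have := stage3a hf hJ' hA hAK hK hu hv hadm he' t ht
      rw [sub_add_cancel, hK1, inner_zero_left] at this
      simp only [ψ]
      rw [LinearMap.adjoint_inner_right, this]
end TypeI

end

section
open Matrix
open scoped ComplexOrder
open Set Filter Topology Metric
set_option linter.unusedSectionVars false
set_option linter.unusedSimpArgs false
set_option linter.style.haveILetI false
set_option linter.unusedVariables false
set_option linter.deprecated false

namespace TypeI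

variable {U G E F : Type*}
  [NormedAddCommGroup U] [InnerProductSpace ℂ U] [FiniteDimensional ℂ U]
  [NormedAddCommGroup G] [InnerProductSpace ℂ G] [FiniteDimensional ℂ G]
  [NormedAddCommGroup E] [InnerProductSpace ℂ E] [FiniteDimensional ℂ E]
  [NormedAddCommGroup F] [InnerProductSpace ℂ F] [FiniteDimensional ℂ F]


theorem structure_thm {f : (U →L[ℂ] G) → (E →L[ℂ] F)} (hf : GM f) (hf0 : f 0 = 0)
    (h3 : 3 ≤ Module.finrank ℂ U) (hEU : Module.finrank ℂ E ≤ Module.finrank ℂ U + 1)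
    (hEG : Module.finrank ℂ E < Module.finrank ℂ G) :
    ∃ (A : U →ₗᵢ[ℂ] E) (B : G →ₗᵢ[ℂ] F), (∀ Z, ‖Z‖ < 1 → ∀ u, f Z (A u) = B (Z u)) ∧
      ∀ e, (∀ x, inner ℂ (A x) e = (0 : ℂ)) → ∀ Z, ‖Z‖ < 1 → ∀ x,
        inner ℂ (B x) (f Z e) = (0 : ℂ) := by
  have := FiniteDimensional.complete ℂ E
  let C : Submodule ℂ E :=
    { carrier := {w | ∀ Z, ‖Z‖ < 1 → f Z w = 0}
      add_mem' := fun {a b} ha hb Z hZ => by rw [map_add, ha Z hZ, hb Z hZ, add_zero]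
      zero_mem' := fun Z _ => map_zero _
      smul_mem' := fun c x hx Z hZ => by rw [map_smul, hx Z hZ, smul_zero] }
  have hC : ∀ w, w ∈ C ↔ ∀ Z, ‖Z‖ < 1 → f Z w = 0 := fun w => Iff.rfl
  let D : Submodule ℂ E := Cᗮ
  let g : (U →L[ℂ] G) → (D →L[ℂ] F) := fun Z => (f Z) ∘L D.subtypeL
  have hgf : ∀ Z, ∀ w : D, g Z w = f Z (w : E) := fun Z w => rfl
  have hdec : ∀ x : E, ∃ d : D, x - d ∈ C ∧ ‖d‖ ≤ ‖x‖ := by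
    intro x
    refine ⟨D.orthogonalProjection x, ?_, D.norm_orthogonalProjection_apply_le x⟩
    have := D.sub_starProjection_mem_orthogonal x
    rw [Submodule.orthogonal_orthogonal] at this
    exact this
  have hfd : ∀ (x : E) (d : D), x - d ∈ C → ∀ Z, ‖Z‖ < 1 → f Z x = g Z d := by
    intro x d h Z hZ
    have := h Z hZ
    rw [map_sub, sub_eq_zero] at this
    exact this
  have hle : ∀ Z, ‖Z‖ < 1 → ‖f Z‖ ≤ ‖g Z‖ := by
    intro Z hZ
    refine ContinuousLinearMap.opNorm_le_bound _ (g Z).opNorm_nonneg fun x => ?_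
    obtain ⟨d, hd, hdn⟩ := hdec x
    rw [hfd x d hd Z hZ]
    exact ((g Z).le_opNorm d).trans (mul_le_mul_of_nonneg_left hdn (g Z).opNorm_nonneg)
  have hg : GM g := by
    refine ⟨?_, ?_, ?_⟩
    · exact ((ContinuousLinearMap.compL ℂ D E F).flip D.subtypeL).differentiable.comp_differentiableOn
        hf.diff
    · intro Z hZ
      refine lt_of_le_of_lt ?_ (hf.maps Z hZ)
      refine ContinuousLinearMap.opNorm_le_bound _ (norm_nonneg _) fun x => ?_
      exact (f Z).le_opNorm x
    · intro r hr
      obtain ⟨s, hs, h⟩ := hf.proper r hr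
      exact ⟨s, hs, fun Z hZ hgr => h Z hZ ((hle Z hZ).trans hgr)⟩
  have hg0 : g 0 = 0 := by ext w; rw [hgf, hf0]; simp
  have hDE : Module.finrank ℂ D ≤ Module.finrank ℂ E := Submodule.finrank_le D
  have hN0 : ∀ w, (∀ Z, ‖Z‖ < 1 → g Z w = g 0 w) → w = 0 := by
    intro w hw
    have hwC : (w : E) ∈ C := by
      intro Z hZ
      have := hw Z hZ
      rw [hg0] at this
      exact this
    have := (Submodule.mem_orthogonal _ _).mp w.2 w hwC
    exact Subtype.ext (inner_self_eq_zero.mp this)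
  obtain ⟨Y2, u2, γ, JE, JF, hY2, hu2, hγ, hdim, hJ, hinj⟩ :=
    stage1 hg h3 (hDE.trans hEU) hN0 (by omega)
  obtain ⟨c, hc, hH⟩ := stage2 hg h3 (hDE.trans hEU) hY2 hu2 hγ hdim hJ hinj
  obtain ⟨A, B, h1, h2⟩ := stage3 hg hg0 (by omega) (by omega) hJ hc hH
  refine ⟨D.subtypeₗᵢ.comp A, B, ?_, ?_⟩
  · intro Z hZ u
    exact h1 Z hZ u
  · intro e he Z hZ x
    obtain ⟨d, hd, -⟩ := hdec e
    rw [hfd e d hd Z hZ]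
    refine h2 d (fun y => ?_) Z hZ x
    have h5 := he y
    have h6 : inner ℂ ((A y : D) : E) (e - d) = (0 : ℂ) := by
      have := (Submodule.mem_orthogonal _ _).mp (A y).2 _ hd
      rw [← inner_conj_symm, this, map_zero]
    rw [inner_sub_right] at h6
    have h7 : inner ℂ ((A y : D) : E) e = (0 : ℂ) := h5
    rw [h7, zero_sub, neg_eq_zero] at h6
    exact h6
end TypeI

end

section
open Matrix
open scoped ComplexOrder
open Set Filter Topology Metric
set_option linter.unusedSectionVars false
set_option linter.unusedSimpArgs false
set_option linter.style.haveILetI false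
set_option linter.unusedVariables false
set_option linter.deprecated false

namespace TypeI

variable {U G E F : Type*}
  [NormedAddCommGroup U] [InnerProductSpace ℂ U] [FiniteDimensional ℂ U]
  [NormedAddCommGroup G] [InnerProductSpace ℂ G] [FiniteDimensional ℂ G]
  [NormedAddCommGroup E] [InnerProductSpace ℂ E] [FiniteDimensional ℂ E]
  [NormedAddCommGroup F] [InnerProductSpace ℂ F] [FiniteDimensional ℂ F]

attribute [local instance] Matrix.normedAddCommGroup Matrix.normedSpace

/-- Euclidean space -/
abbrev Eu (n : ℕ) := EuclideanSpace ℂ (Fin n)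

/-- matrices as continuous linear maps -/
noncomputable def T (m n : ℕ) : Matrix (Fin m) (Fin n) ℂ ≃L[ℂ] (Eu n →L[ℂ] Eu m) :=
  ((Matrix.toLpLin 2 2).trans LinearMap.toContinuousLinearMap).toContinuousLinearEquiv

theorem T_apply {m n : ℕ} (Z : Matrix (Fin m) (Fin n) ℂ) (v : Eu n) :
    T m n Z v = WithLp.toLp 2 (Z *ᵥ v.ofLp) := rfl

theorem T_entry {m n : ℕ} (Z : Matrix (Fin m) (Fin n) ℂ) (i : Fin m) (j : Fin n) :
    T m n Z (EuclideanSpace.single j 1) i = Z i j := by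
  rw [T_apply]
  simp

theorem T_symm_entry {m n : ℕ} (X : Eu n →L[ℂ] Eu m) (i : Fin m) (j : Fin n) :
    (T m n).symm X i j = X (EuclideanSpace.single j 1) i := by
  have h := T_entry ((T m n).symm X) i j
  rw [ContinuousLinearEquiv.apply_symm_apply] at h
  exact h.symm

theorem quad {m n : ℕ} (Z : Matrix (Fin m) (Fin n) ℂ) (v : Eu n) :
    star v.ofLp ⬝ᵥ ((1 - Zᴴ * Z) *ᵥ v.ofLp) = ((‖v‖ ^ 2 - ‖T m n Z v‖ ^ 2 : ℝ) : ℂ) := by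
  have h1 : ∀ {k : ℕ} (w : Eu k), star w.ofLp ⬝ᵥ w.ofLp = ((‖w‖ ^ 2 : ℝ) : ℂ) := by
    intro k w
    rw [dotProduct_comm, ← EuclideanSpace.inner_eq_star_dotProduct w w,
      inner_self_eq_norm_sq_to_K]
    push_cast; rfl
  rw [Matrix.sub_mulVec, dotProduct_sub, Matrix.one_mulVec, h1, ← Matrix.mulVec_mulVec,
    Complex.ofReal_sub, ← h1 (T m n Z v), T_apply]
  congr 1
  rw [Matrix.dotProduct_mulVec, ← Matrix.star_mulVec]

theorem mem_dom {m n : ℕ} (Z : Matrix (Fin m) (Fin n) ℂ) :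
    Z ∈ typeIDomain m n ↔ ‖T m n Z‖ < 1 := by
  unfold typeIDomain
  rw [mem_setOf_eq, Matrix.posDef_iff_dotProduct_mulVec]
  constructor
  · rintro ⟨-, h⟩
    refine Mob.norm_lt_one_of fun u hu => ?_
    have h1 := h (x := u.ofLp) (by intro h; apply hu; ext i; exact congrFun h i)
    rw [quad] at h1
    have h2 : 0 < ‖u‖ ^ 2 - ‖T m n Z u‖ ^ 2 := by exact_mod_cast h1
    refine abs_lt_of_sq_lt_sq' ?_ (norm_nonneg _) |>.2
    linarith
  · intro h
    refine ⟨?_, fun x hx => ?_⟩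
    · exact Matrix.isHermitian_one.sub (Matrix.isHermitian_conjTranspose_mul_self Z)
    · have h1 := quad Z (WithLp.toLp 2 x)
      have h2 := Mob.apply_lt h (u := WithLp.toLp 2 x) (by
        intro h; apply hx; ext i; exact congrFun (congrArg WithLp.ofLp h) i)
      rw [show x = (WithLp.toLp 2 x : Eu n).ofLp from rfl, h1]
      have : 0 < ‖(WithLp.toLp 2 x : Eu n)‖ ^ 2 - ‖T m n Z (WithLp.toLp 2 x)‖ ^ 2 := by
        nlinarith [norm_nonneg (T m n Z (WithLp.toLp 2 x))]
      exact_mod_cast this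

theorem mapsTo_T {m n : ℕ} : MapsTo (T m n) (typeIDomain m n) (ball 0 1) := fun Z hZ => by
  simpa using (mem_dom Z).1 hZ

theorem symm_mem {m n : ℕ} {X : Eu n →L[ℂ] Eu m} (hX : ‖X‖ < 1) :
    (T m n).symm X ∈ typeIDomain m n := by
  rw [mem_dom]; simpa using hX

theorem mapsTo_T_symm {m n : ℕ} : MapsTo (T m n).symm (ball 0 1) (typeIDomain m n) := fun X hX => 
  symm_mem (by simpa using hX)

theorem gm_of {p q p' q' : ℕ} {f : Matrix (Fin p) (Fin q) ℂ → Matrix (Fin p') (Fin q') ℂ}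
    (hf : DifferentiableOn ℂ f (typeIDomain p q))
    (hfp : ProperOn f (typeIDomain p q) (typeIDomain p' q')) :
    GM (fun Z => T p' q' (f ((T p q).symm Z))) where
  diff := (T p' q').differentiable.comp_differentiableOn
    (hf.comp (T p q).symm.differentiable.differentiableOn mapsTo_T_symm)
  maps Z hZ := (mem_dom _).1 (hfp.1 (symm_mem hZ))
  proper r hr := by
    have hK : IsCompact ((T p' q').symm '' closedBall 0 r) :=
      (isCompact_closedBall _ _).image (T p' q').symm.continuous
    have hC := hfp.2 _ (by
      rintro _ ⟨X, hX, rfl⟩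
      exact symm_mem (lt_of_le_of_lt (by simpa using hX) hr)) hK
    rcases (typeIDomain p q ∩ f ⁻¹' ((T p' q').symm '' closedBall 0 r)).eq_empty_or_nonempty
      with he | hne
    · refine ⟨0, zero_lt_one, fun Z hZ hle => ?_⟩
      exfalso
      have : (T p q).symm Z ∈ (∅ : Set _) := by
        rw [← he]
        exact ⟨symm_mem hZ, _, by simpa using hle, by simp⟩
      exact this
    · obtain ⟨Z0, hZ0, hmax⟩ := hC.exists_isMaxOn hne (f := fun Z => ‖T p q Z‖)
        (T p q).continuous.norm.continuousOn
      refine ⟨_, (mem_dom _).1 hZ0.1, fun Z hZ hle => ?_⟩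
      have := hmax (a := (T p q).symm Z) ⟨symm_mem hZ, _, by simpa using hle, by simp⟩
      simpa using this

theorem isAut_of {m n : ℕ} {a b : (Eu n →L[ℂ] Eu m) → (Eu n →L[ℂ] Eu m)}
    (ha : ∀ X, ‖X‖ < 1 → ‖a X‖ < 1) (hb : ∀ X, ‖X‖ < 1 → ‖b X‖ < 1)
    (hda : DifferentiableOn ℂ a (ball 0 1)) (hdb : DifferentiableOn ℂ b (ball 0 1))
    (hba : ∀ X, ‖X‖ < 1 → b (a X) = X) (hab : ∀ X, ‖X‖ < 1 → a (b X) = X) :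
    IsAutOf (fun X => (T m n).symm (a (T m n X))) := by
  refine ⟨fun X hX => symm_mem (ha _ ((mem_dom X).1 hX)), ?_,
    fun X => (T m n).symm (b (T m n X)), fun X hX => symm_mem (hb _ ((mem_dom X).1 hX)), ?_, ?_, ?_⟩
  · exact (T m n).symm.differentiable.comp_differentiableOn
      (hda.comp (T m n).differentiable.differentiableOn mapsTo_T)
  · exact (T m n).symm.differentiable.comp_differentiableOn
      (hdb.comp (T m n).differentiable.differentiableOn mapsTo_T)
  · intro Z hZ
    simp [hba _ ((mem_dom Z).1 hZ)]
  · intro Z hZ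
    simp [hab _ ((mem_dom Z).1 hZ)]

theorem exists_basis {n k m : ℕ} (hm : n + k = m) (A : Eu n →ₗᵢ[ℂ] Eu m) :
    ∃ b : OrthonormalBasis (Fin (n + k)) ℂ (Eu m),
      ∀ j, b (Fin.castAdd k j) = A (EuclideanSpace.single j 1) := by
  let v : Fin (n + k) → Eu m := Fin.addCases (fun j => A (EuclideanSpace.single j 1)) (fun _ => 0)
  have hv : ∀ j, v (Fin.castAdd k j) = A (EuclideanSpace.single j 1) := by
    intro j; simp [v]
  have ho : Orthonormal ℂ ((range (Fin.castAdd k : Fin n → _)).restrict v) := by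
    have h1 : Orthonormal ℂ (fun j : Fin n => A (EuclideanSpace.single j (1 : ℂ))) := by
      have := (EuclideanSpace.orthonormal_single (𝕜 := ℂ) (ι := Fin n)).comp_linearIsometry A
      exact this
    rw [orthonormal_iff_ite] at h1 ⊢
    rintro ⟨_, i, rfl⟩ ⟨_, j, rfl⟩
    have h2 := h1 i j
    rw [← hv, ← hv] at h2
    refine h2.trans ?_
    by_cases hij : i = j
    · subst hij; simp
    · rw [if_neg hij, if_neg]
      intro h
      exact hij (Fin.castAdd_injective _ _ (congrArg Subtype.val h))
  obtain ⟨b, hb⟩ := ho.exists_orthonormalBasis_extension_of_card_eq (by simp [hm])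
  exact ⟨b, fun j => by rw [hb _ ⟨j, rfl⟩, hv]⟩


theorem dom_of_diag {p q k l : ℕ} {Z : Matrix (Fin p) (Fin q) ℂ} {W : Matrix (Fin k) (Fin l) ℂ}
    (h : diagBlock rfl rfl Z W ∈ typeIDomain (p + k) (q + l)) : W ∈ typeIDomain k l := by
  unfold typeIDomain at h ⊢
  rw [mem_setOf_eq] at h ⊢
  have h1 := h.submatrix (e := (Fin.natAdd q : Fin l → Fin (q + l))) (Fin.natAdd_injective _ _)
  convert h1 using 1
  ext i j
  simp [diagBlock, Matrix.mul_apply, Fin.sum_univ_add, Matrix.one_apply]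

/-- conjugation by unitaries -/
noncomputable def cj {E' F' : Type*} [NormedAddCommGroup E'] [InnerProductSpace ℂ E']
    [NormedAddCommGroup F'] [InnerProductSpace ℂ F']
    (V : E' ≃ₗᵢ[ℂ] E) (W : F' ≃ₗᵢ[ℂ] F) (X : E' →L[ℂ] F') : E →L[ℂ] F :=
  (W.toContinuousLinearEquiv : F' →L[ℂ] F) ∘L X ∘L (V.symm.toContinuousLinearEquiv : E →L[ℂ] E')

theorem cj_diff {E' F' : Type*} [NormedAddCommGroup E'] [InnerProductSpace ℂ E']
    [NormedAddCommGroup F'] [InnerProductSpace ℂ F']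
    (V : E' ≃ₗᵢ[ℂ] E) (W : F' ≃ₗᵢ[ℂ] F) : Differentiable ℂ (cj V W) := by
  unfold cj
  fun_prop

theorem cj_apply {E' F' : Type*} [NormedAddCommGroup E'] [InnerProductSpace ℂ E']
    [NormedAddCommGroup F'] [InnerProductSpace ℂ F']
    (V : E' ≃ₗᵢ[ℂ] E) (W : F' ≃ₗᵢ[ℂ] F) (X : E' →L[ℂ] F') (e : E) :
    cj V W X e = W (X (V.symm e)) := rfl

theorem cj_symm {E' F' : Type*} [NormedAddCommGroup E'] [InnerProductSpace ℂ E']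
    [NormedAddCommGroup F'] [InnerProductSpace ℂ F'] [FiniteDimensional ℂ E']
    [FiniteDimensional ℂ F']
    (V : E' ≃ₗᵢ[ℂ] E) (W : F' ≃ₗᵢ[ℂ] F) (X : E' →L[ℂ] F') :
    cj V.symm W.symm (cj V W X) = X := by
  ext e
  simp [cj_apply]

theorem cj_lt {E' F' : Type*} [NormedAddCommGroup E'] [InnerProductSpace ℂ E']
    [NormedAddCommGroup F'] [InnerProductSpace ℂ F']
    (V : E' ≃ₗᵢ[ℂ] E) (W : F' ≃ₗᵢ[ℂ] F) (X : E' →L[ℂ] F') (hX : ‖X‖ < 1) : ‖cj V W X‖ < 1 := by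
  refine lt_of_le_of_lt ?_ hX
  refine ContinuousLinearMap.opNorm_le_bound _ (norm_nonneg _) fun e => ?_
  rw [cj_apply, LinearIsometryEquiv.norm_map]
  simpa using X.le_opNorm (V.symm e)

theorem core {p q k : ℕ} (h3q : 3 ≤ q) (hqp : q + 1 < p)
    (f : Matrix (Fin p) (Fin q) ℂ → Matrix (Fin (p + k)) (Fin (q + 1)) ℂ)
    (N : Mob (Eu (q + 1)) (Eu (p + k)))
    (A : Eu q →ₗᵢ[ℂ] Eu (q + 1)) (B : Eu p →ₗᵢ[ℂ] Eu (p + k))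
    (hf : GM fun Z => T _ _ (f ((T p q).symm Z)))
    (g : (Eu q →L[ℂ] Eu p) → (Eu (q + 1) →L[ℂ] Eu (p + k)))
    (hg : GM g) (hgf : ∀ Z, ‖Z‖ < 1 → T _ _ (f ((T p q).symm Z)) = N.map (g Z))
    (h1 : ∀ Z, ‖Z‖ < 1 → ∀ u, g Z (A u) = B (Z u))
    (h2 : ∀ e, (∀ x, inner ℂ (A x) e = 0) → ∀ Z, ‖Z‖ < 1 → ∀ x, inner ℂ (B x) (g Z e) = 0) :
    ∃ (Φ : Matrix (Fin (p + k)) (Fin (q + 1)) ℂ → Matrix (Fin (p + k)) (Fin (q + 1)) ℂ)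
      (ψ : Matrix (Fin p) (Fin q) ℂ → Matrix (Fin p) (Fin q) ℂ)
      (h : Matrix (Fin p) (Fin q) ℂ → Matrix (Fin k) (Fin 1) ℂ),
      IsAutOf Φ ∧ IsAutOf ψ ∧
      DifferentiableOn ℂ h (typeIDomain p q) ∧
      Set.MapsTo h (typeIDomain p q) (typeIDomain k 1) ∧
      ∀ Z ∈ typeIDomain p q, f Z = Φ (diagBlock rfl rfl (ψ Z) (h (ψ Z))) := by
  obtain ⟨b, hb⟩ := exists_basis rfl A
  obtain ⟨c, hc⟩ := exists_basis rfl B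
  -- the normalised map in matrix form
  let D : Matrix (Fin p) (Fin q) ℂ → Matrix (Fin (p + k)) (Fin (q + 1)) ℂ := fun Z =>
    (T _ _).symm (cj b.repr c.repr (g (T _ _ Z)))
  have hDdiff : DifferentiableOn ℂ D (typeIDomain p q) :=
    (T _ _).symm.differentiable.comp_differentiableOn
      ((cj_diff b.repr c.repr).comp_differentiableOn
        (hg.diff.comp (T _ _).differentiable.differentiableOn mapsTo_T))
  have hDmem : ∀ Z ∈ typeIDomain p q, D Z ∈ typeIDomain (p + k) (q + 1) := fun Z hZ =>
    symm_mem (cj_lt _ _ _ (hg.maps _ ((mem_dom Z).1 hZ)))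
  have hDe : ∀ Z i j, D Z i j = inner ℂ (c i) (g (T _ _ Z) (b j)) := by
    intro Z i j
    refine (T_symm_entry _ i j).trans ?_
    rw [cj_apply, OrthonormalBasis.repr_symm_single, OrthonormalBasis.repr_apply_apply]
  let h : Matrix (Fin p) (Fin q) ℂ → Matrix (Fin k) (Fin 1) ℂ := fun Z =>
    (D Z).submatrix (Fin.natAdd p) (Fin.natAdd q)
  have hdiag : ∀ Z ∈ typeIDomain p q, D Z = diagBlock rfl rfl Z (h Z) := by
    intro Z hZ
    have hZ1 := (mem_dom Z).1 hZ
    have hBc : ∀ (y : Eu p) (i : Fin k), inner ℂ (c (Fin.natAdd p i)) (B y) = 0 := by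
      intro y i
      have hy : y = ∑ l, y l • EuclideanSpace.single l (1 : ℂ) := by
        ext l
        simp [Finset.sum_apply, Pi.single_apply]
      rw [hy, map_sum, inner_sum]
      refine Finset.sum_eq_zero fun l _ => ?_
      rw [map_smul, inner_smul_right, ← hc, c.inner_eq_zero, mul_zero]
      intro hh
      have := congrArg Fin.val hh
      simp at this
      omega
    have hAb : ∀ (x : Eu q) (j : Fin 1), inner ℂ (A x) (b (Fin.natAdd q j)) = 0 := by
      intro x j
      have hy : x = ∑ l, x l • EuclideanSpace.single l (1 : ℂ) := by
        ext l
        simp [Finset.sum_apply, Pi.single_apply]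
      rw [hy, map_sum, sum_inner]
      refine Finset.sum_eq_zero fun l _ => ?_
      rw [map_smul, inner_smul_left, ← hb, b.inner_eq_zero, mul_zero]
      intro hh
      have := congrArg Fin.val hh
      simp at this
      omega
    ext i j
    induction i using Fin.addCases with
    | left i =>
      induction j using Fin.addCases with
      | left j =>
        rw [hDe, hb, h1 _ hZ1, hc, LinearIsometry.inner_map_map, EuclideanSpace.inner_single_left,
          T_entry]
        simp [diagBlock]
      | right j =>
        rw [hDe, hc, h2 _ (fun x => hAb x j) _ hZ1]
        simp [diagBlock]
    | right i =>
      induction j using Fin.addCases with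
      | left j =>
        rw [hDe, hb, h1 _ hZ1, hBc]
        simp [diagBlock]
      | right j =>
        simp [diagBlock, h]
  refine ⟨fun X => (T _ _).symm (N.map (cj b.repr.symm c.repr.symm (T _ _ X))), fun Z => Z, h,
    ?_, ?_, ?_, ?_, ?_⟩
  · refine isAut_of (a := fun X => N.map (cj b.repr.symm c.repr.symm X))
      (b := fun X => cj b.repr c.repr (N.symm.map X)) ?_ ?_ ?_ ?_ ?_ ?_
    · exact fun X hX => N.map_lt (cj_lt _ _ _ hX)
    · exact fun X hX => cj_lt _ _ _ (N.symm.map_lt hX)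
    · exact N.map_diff.comp (cj_diff _ _).differentiableOn
        (fun X hX => by simpa using cj_lt _ _ _ (by simpa using hX))
    · exact (cj_diff b.repr c.repr).comp_differentiableOn N.symm.map_diff
    · intro X hX
      change cj b.repr c.repr (N.symm.map (N.map _)) = X
      rw [N.symm_map (cj_lt _ _ _ hX)]
      exact cj_symm b.repr.symm c.repr.symm X
    · intro X hX
      change N.map (cj b.repr.symm c.repr.symm (cj b.repr c.repr (N.symm.map X))) = X
      rw [cj_symm, N.map_symm hX]
  · exact ⟨fun Z hZ => hZ, differentiableOn_id, fun Z => Z, fun Z hZ => hZ, differentiableOn_id,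
      fun Z _ => rfl, fun Z _ => rfl⟩
  · let L : Matrix (Fin (p + k)) (Fin (q + 1)) ℂ →ₗ[ℂ] Matrix (Fin k) (Fin 1) ℂ :=
      { toFun := fun X => X.submatrix (Fin.natAdd p) (Fin.natAdd q)
        map_add' := fun _ _ => rfl
        map_smul' := fun _ _ => rfl }
    exact (LinearMap.toContinuousLinearMap L).differentiable.comp_differentiableOn hDdiff
  · intro Z hZ
    have := hDmem Z hZ
    rw [hdiag Z hZ] at this
    exact dom_of_diag this
  · intro Z hZ
    change f Z = (T _ _).symm (N.map (cj b.repr.symm c.repr.symm (T _ _ (diagBlock rfl rfl Z (h Z)))))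
    rw [← hdiag Z hZ]
    have := hgf _ ((mem_dom Z).1 hZ)
    rw [ContinuousLinearEquiv.symm_apply_apply] at this
    change f Z = (T _ _).symm (N.map (cj b.repr.symm c.repr.symm (T _ _ ((T _ _).symm _))))
    rw [ContinuousLinearEquiv.apply_symm_apply, cj_symm, ← this,
      ContinuousLinearEquiv.symm_apply_apply]

theorem final (p q p' : ℕ) 
    (h3q : 3 ≤ q) (hqp : q ≤ p - 2)
    (f : Matrix (Fin p) (Fin q) ℂ → Matrix (Fin p') (Fin (q + 1)) ℂ)
    (hf : DifferentiableOn ℂ f (typeIDomain p q))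
    (hfp : ProperOn f (typeIDomain p q) (typeIDomain p' (q + 1))) :
    p ≤ p' ∧
    ∃ (hpp : p + (p' - p) = p')
      (Φ : Matrix (Fin p') (Fin (q + 1)) ℂ → Matrix (Fin p') (Fin (q + 1)) ℂ)
      (ψ : Matrix (Fin p) (Fin q) ℂ → Matrix (Fin p) (Fin q) ℂ)
      (h : Matrix (Fin p) (Fin q) ℂ → Matrix (Fin (p' - p)) (Fin 1) ℂ),
      IsAutOf Φ ∧ IsAutOf ψ ∧
      DifferentiableOn ℂ h (typeIDomain p q) ∧
      Set.MapsTo h (typeIDomain p q) (typeIDomain (p' - p) 1) ∧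
      ∀ Z ∈ typeIDomain p q, f Z = Φ (diagBlock hpp rfl (ψ Z) (h (ψ Z))) := by
  have hq2 : q + 1 < p := by omega
  have hG := gm_of hf hfp
  have h00 : ‖(0 : Eu q →L[ℂ] Eu p)‖ < 1 := by simp
  obtain ⟨N, hN⟩ := Mob.exists_base (hG.maps 0 h00)
  have hg : GM fun Z => N.symm.map (T p' (q + 1) (f ((T p q).symm Z))) :=
    { diff := N.symm.map_diff.comp hG.diff
        (fun Z hZ => by simpa using hG.maps Z (by simpa using hZ))
      maps := fun Z hZ => N.symm.map_lt (hG.maps Z hZ)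
      proper := fun r hr => by
        obtain ⟨r1, hr1, h1⟩ := N.map_bound hr
        obtain ⟨s, hs, h2⟩ := hG.proper r1 hr1
        refine ⟨s, hs, fun Z hZ hle => h2 Z hZ ?_⟩
        have := h1 _ hle
        rwa [N.map_symm (hG.maps Z hZ)] at this }
  have hg0 : N.symm.map (T p' (q + 1) (f ((T p q).symm 0))) = 0 := by
    have h1 := N.symm_map (Z := 0) (by simp)
    rw [hN.map_zero] at h1
    exact h1
  obtain ⟨A, B, h1, h2⟩ := structure_thm hg hg0 (by simpa using h3q) (by simp) (by simpa using hq2)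
  have hle : p ≤ p' := by
    have := LinearMap.finrank_le_finrank_of_injective (f := B.toLinearMap) B.injective
    simpa using this
  refine ⟨hle, by omega, ?_⟩
  obtain ⟨k, rfl⟩ := Nat.exists_eq_add_of_le hle
  have hk : p + k - p = k := by omega
  have := core h3q hq2 f N A B hG _ hg (fun Z hZ => (N.map_symm (hG.maps Z hZ)).symm) h1 h2
  clear h1 h2
  generalize_proofs pf1
  revert pf1
  generalize p + k - p = k' at hk ⊢
  subst hk
  intro pf1
  exact this

end TypeI

end

/-- A proper holomorphic map `f : D^I_{p,q} → D^I_{p',q+1}` with `3 ≤ q ≤ p - 2`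
satisfies `p' ≥ p` and is of diagonal type: `f` is equivalent to `G_h` for some
holomorphic `h : D^I_{p,q} → D^I_{p'-p,1}`. -/
theorem stmt_1 (p q p' : ℕ) (h0p : 0 < p) (h0q : 0 < q) (h0p' : 0 < p')
    (h3q : 3 ≤ q) (hqp : q ≤ p - 2)
    (f : Matrix (Fin p) (Fin q) ℂ → Matrix (Fin p') (Fin (q + 1)) ℂ)
    (hf : DifferentiableOn ℂ f (typeIDomain p q))
    (hfp : ProperOn f (typeIDomain p q) (typeIDomain p' (q + 1))) :
    p ≤ p' ∧
    ∃ (hpp : p + (p' - p) = p')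
      (Φ : Matrix (Fin p') (Fin (q + 1)) ℂ → Matrix (Fin p') (Fin (q + 1)) ℂ)
      (ψ : Matrix (Fin p) (Fin q) ℂ → Matrix (Fin p) (Fin q) ℂ)
      (h : Matrix (Fin p) (Fin q) ℂ → Matrix (Fin (p' - p)) (Fin 1) ℂ),
      IsAutOf Φ ∧ IsAutOf ψ ∧
      DifferentiableOn ℂ h (typeIDomain p q) ∧
      Set.MapsTo h (typeIDomain p q) (typeIDomain (p' - p) 1) ∧
      ∀ Z ∈ typeIDomain p q, f Z = Φ (diagBlock hpp rfl (ψ Z) (h (ψ Z))) := by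
  exact TypeI.final p q p' h3q hqp f hf hfp
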